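/- arXiv:1909.09232 — 9 statements merged into one kernel-verified Lean document; each statement's English description precedes it below -/
import Mathlib

section
/- Let T > 0 and t = (t₁,t₂,t₃) ∈ ℝ³ with t₁+t₂+t₃ = 0, t₁−t₂ ≥ 1/T and t₂−t₃ ≥ 1/T. Then ∫_{ℝ³} (1+x₁²)^{(−1+t₂−t₁)/2} (1+x₂²)^{(−1+t₃−t₂)/2} (1+x₃²)^{(−1+t₃−t₁)/2} dx₁ dx₂ dx₃ ≤ C·(1+T³) for an absolute constant C > 0. -/
open MeasureTheory

theorem integrable_one_add_sq_rpow {a : ℝ} (ha : 0 < a) :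
    Integrable (fun x : ℝ => (1 + x ^ 2) ^ ((-1 - a) / 2)) := by
  have h := integrable_rpow_neg_one_add_norm_sq (E := ℝ) (μ := volume) (r := 1 + a)
    (by simpa using ha)
  convert h using 3 with x
  · simp
  · ring

theorem integral_one_add_sq_rpow_le {a : ℝ} (ha : 0 < a) :
    ∫ x : ℝ, (1 + x ^ 2) ^ ((-1 - a) / 2) ≤ 2 * (1 + 1 / a) := by
  have hint := integrable_one_add_sq_rpow ha
  have habs : ∫ x : ℝ, (1 + x ^ 2) ^ ((-1 - a) / 2) =
      2 * ∫ x in Set.Ioi (0 : ℝ), (1 + x ^ 2) ^ ((-1 - a) / 2) := by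
    rw [← integral_comp_abs (f := fun x : ℝ => (1 + x ^ 2) ^ ((-1 - a) / 2))]
    simp only [sq_abs]
  have hnear : ∫ x in Set.Ioc (0 : ℝ) 1, (1 + x ^ 2) ^ ((-1 - a) / 2) ≤ 1 := by
    calc _ ≤ ∫ _ in Set.Ioc (0 : ℝ) 1, (1 : ℝ) := by
          refine setIntegral_mono hint.integrableOn (by simp) fun x => ?_
          exact Real.rpow_le_one_of_one_le_of_nonpos (by nlinarith [sq_nonneg x]) (by linarith)
      _ = 1 := by simp
  have hfar : ∫ x in Set.Ioi (1 : ℝ), (1 + x ^ 2) ^ ((-1 - a) / 2) ≤ 1 / a := by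
    calc _ ≤ ∫ x in Set.Ioi (1 : ℝ), x ^ (-1 - a) := by
          refine setIntegral_mono_on hint.integrableOn
            (integrableOn_Ioi_rpow_of_lt (by linarith) one_pos) measurableSet_Ioi fun x hx => ?_
          have hx0 : 0 < x := one_pos.trans hx
          calc (1 + x ^ 2) ^ ((-1 - a) / 2) ≤ (x ^ 2) ^ ((-1 - a) / 2) :=
                Real.rpow_le_rpow_of_nonpos (by positivity) (by linarith) (by linarith)
            _ = x ^ (-1 - a) := by
                rw [← Real.rpow_natCast, ← Real.rpow_mul hx0.le]
                congr 1
                push_cast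
                ring
      _ = 1 / a := by
          rw [integral_Ioi_rpow_of_lt (by linarith) one_pos, Real.one_rpow,
            show -1 - a + 1 = -a by ring, neg_div_neg_eq]
  rw [habs, ← Set.Ioc_union_Ioi_eq_Ioi zero_le_one,
    setIntegral_union (Set.Ioc_disjoint_Ioi le_rfl) measurableSet_Ioi
      hint.integrableOn hint.integrableOn]
  linarith

theorem integral_one_add_sq_rpow_le_of_one_div_le {T a : ℝ} (hT : 0 < T) (ha : 1 / T ≤ a) :
    ∫ x : ℝ, (1 + x ^ 2) ^ ((-1 - a) / 2) ≤ 2 * (1 + T) := by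
  have ha0 : 0 < a := (one_div_pos.2 hT).trans_le ha
  have := one_div_le hT ha0 |>.1 ha
  linarith [integral_one_add_sq_rpow_le ha0]


/-- The triple integral `∫_{U(ℝ)} p_{ρ+t}(w_l x) dx`, written out explicitly, converges
absolutely and is bounded by an absolute constant times `1 + T³`. -/
theorem stmt0 :
    ∃ C : ℝ, 0 < C ∧ ∀ (T : ℝ), 0 < T → ∀ t₁ t₂ t₃ : ℝ,
      t₁ + t₂ + t₃ = 0 → 1 / T ≤ t₁ - t₂ → 1 / T ≤ t₂ - t₃ →
      Integrable (fun x : ℝ × ℝ × ℝ =>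
        (1 + x.1 ^ 2) ^ ((-1 + t₂ - t₁) / 2) * (1 + x.2.1 ^ 2) ^ ((-1 + t₃ - t₂) / 2) *
          (1 + x.2.2 ^ 2) ^ ((-1 + t₃ - t₁) / 2)) ∧
      (∫ x : ℝ × ℝ × ℝ,
        (1 + x.1 ^ 2) ^ ((-1 + t₂ - t₁) / 2) * (1 + x.2.1 ^ 2) ^ ((-1 + t₃ - t₂) / 2) *
          (1 + x.2.2 ^ 2) ^ ((-1 + t₃ - t₁) / 2)) ≤ C * (1 + T ^ 3) := by
  refine ⟨32, by norm_num, fun T hT t₁ t₂ t₃ _ h₁₂ h₂₃ => ?_⟩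
  have hT0 : 0 < 1 / T := one_div_pos.2 hT
  have h₁₃ : 1 / T ≤ t₁ - t₃ := by linarith
  rw [show -1 + t₂ - t₁ = -1 - (t₁ - t₂) by ring, show -1 + t₃ - t₂ = -1 - (t₂ - t₃) by ring,
    show -1 + t₃ - t₁ = -1 - (t₁ - t₃) by ring]
  generalize t₁ - t₂ = a at *
  generalize t₂ - t₃ = b at *
  generalize t₁ - t₃ = c at *
  have hnonneg (d : ℝ) : 0 ≤ ∫ x : ℝ, (1 + x ^ 2) ^ ((-1 - d) / 2) :=
    integral_nonneg fun x => by positivity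
  simp only [mul_assoc]
  constructor
  · exact (integrable_one_add_sq_rpow (hT0.trans_le h₁₂)).mul_prod
      ((integrable_one_add_sq_rpow (hT0.trans_le h₂₃)).mul_prod
        (integrable_one_add_sq_rpow (hT0.trans_le h₁₃)))
  · have hprod := integral_prod_mul (μ := (volume : Measure ℝ)) (ν := (volume : Measure (ℝ × ℝ)))
      (fun x : ℝ => (1 + x ^ 2) ^ ((-1 - a) / 2))
      (fun y : ℝ × ℝ => (1 + y.1 ^ 2) ^ ((-1 - b) / 2) * (1 + y.2 ^ 2) ^ ((-1 - c) / 2))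
    have hprod' := integral_prod_mul (μ := (volume : Measure ℝ)) (ν := (volume : Measure ℝ))
      (fun x : ℝ => (1 + x ^ 2) ^ ((-1 - b) / 2)) (fun x : ℝ => (1 + x ^ 2) ^ ((-1 - c) / 2))
    rw [← Measure.volume_eq_prod] at hprod hprod'
    rw [hprod, hprod']
    calc _ ≤ (2 * (1 + T)) * ((2 * (1 + T)) * (2 * (1 + T))) :=
          mul_le_mul (integral_one_add_sq_rpow_le_of_one_div_le hT h₁₂)
            (mul_le_mul (integral_one_add_sq_rpow_le_of_one_div_le hT h₂₃)
              (integral_one_add_sq_rpow_le_of_one_div_le hT h₁₃) (hnonneg c) (by positivity))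
            (mul_nonneg (hnonneg b) (hnonneg c)) (by positivity)
      _ ≤ 32 * (1 + T ^ 3) := by
          nlinarith [mul_nonneg (add_nonneg zero_le_one hT.le) (sq_nonneg (1 - T))]
end

section
/- Let η > 0 and 0 < δ < 1/10, and let (c_j)_{j≥0} be positive constants. There is a constant C' depending only on η, δ and finitely many of the c_j such that the following holds. Let A ∈ ℝ∖{0}, B > 0, C > 1/2, T > 6^{1/η}, and let w : ℝ → ℂ be smooth, supported in {x : 1+|x| ∈ [C/2, 2C]}, with |w^{(j)}(x)| ≤ c_j C^{−j} for every j ≥ 0. If either (i) |A| > T^η · max(1/C, B/C²), or (ii) T^{2η}·C < B < T^{−η}·C³ and C^{1+δ} ≤ B, then |∫_ℝ w(x) e^{2πi(Ax + Bx/(1+x²))} dx| ≤ C'·C·T^{−η}. -/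
open MeasureTheory

/-- Integration by parts against a phase: if `f` vanishes at the endpoints, then
`∫ f φ' e^{sφ}` is controlled by the total variation of `f`. -/
theorem norm_integral_mul_deriv_mul_exp_le {a b : ℝ} (hab : a ≤ b) {s : ℂ} (hs : s.re = 0)
    (hs1 : 1 ≤ ‖s‖) {φ p : ℝ → ℝ} {f f' : ℝ → ℂ}
    (hφ : ∀ x ∈ Set.Icc a b, HasDerivAt φ (p x) x) (hp : ContinuousOn p (Set.Icc a b))
    (hf : ∀ x ∈ Set.Icc a b, HasDerivAt f (f' x) x) (hf' : ContinuousOn f' (Set.Icc a b))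
    (ha : f a = 0) (hb : f b = 0) :
    ‖∫ x in a..b, f x * p x * Complex.exp (s * φ x)‖ ≤ ∫ x in a..b, ‖f' x‖ := by
  have hE : ∀ x, ‖Complex.exp (s * φ x)‖ = 1 := by
    intro x
    simp [Complex.norm_exp, hs]
  have hφc : ContinuousOn φ (Set.Icc a b) := fun x hx => (hφ x hx).continuousAt.continuousWithinAt
  have hfc : ContinuousOn f (Set.Icc a b) := fun x hx => (hf x hx).continuousAt.continuousWithinAt
  have hEc : ContinuousOn (fun x => Complex.exp (s * φ x)) (Set.Icc a b) := by
    fun_prop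
  have i1 : IntervalIntegrable (fun x => f' x * Complex.exp (s * φ x)) volume a b :=
    (hf'.mul hEc).intervalIntegrable_of_Icc hab
  have hpc : ContinuousOn (fun x => (p x : ℂ)) (Set.Icc a b) := by fun_prop
  have i2 : IntervalIntegrable (fun x => f x * p x * Complex.exp (s * φ x)) volume a b :=
    ((hfc.mul hpc).mul hEc).intervalIntegrable_of_Icc hab
  have key : ∫ x in a..b, (f' x * Complex.exp (s * φ x)
      + s * (f x * p x * Complex.exp (s * φ x))) = 0 := by
    rw [intervalIntegral.integral_eq_sub_of_hasDerivAt
      (f := fun x => f x * Complex.exp (s * φ x)) _ (i1.add (i2.const_mul s))]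
    · simp [ha, hb]
    · intro x hx
      rw [Set.uIcc_of_le hab] at hx
      refine ((hf x hx).mul (((hφ x hx).ofReal_comp.const_mul s).cexp)).congr_deriv ?_
      ring
  rw [intervalIntegral.integral_add i1 (i2.const_mul s), intervalIntegral.integral_const_mul] at key
  have h2 : ‖s * ∫ x in a..b, f x * p x * Complex.exp (s * φ x)‖
      = ‖∫ x in a..b, f' x * Complex.exp (s * φ x)‖ := by
    rw [eq_neg_of_add_eq_zero_right key, norm_neg]
  have h3 : ‖∫ x in a..b, f' x * Complex.exp (s * φ x)‖ ≤ ∫ x in a..b, ‖f' x‖ := by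
    refine (intervalIntegral.norm_integral_le_integral_norm hab).trans (le_of_eq ?_)
    simp [hE]
  rw [norm_mul] at h2
  nlinarith [norm_nonneg (∫ x in a..b, f x * p x * Complex.exp (s * φ x))]

/-- First derivative test for weighted oscillatory integrals. -/
theorem norm_integral_mul_exp_le_of_le_abs_deriv {a b : ℝ} (hab : a ≤ b) {s : ℂ} (hs : s.re = 0)
    (hs1 : 1 ≤ ‖s‖) {φ p q : ℝ → ℝ} {w w' : ℝ → ℂ} {m Q M N : ℝ} (hm : 0 < m)
    (hφ : ∀ x ∈ Set.Icc a b, HasDerivAt φ (p x) x)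
    (hp : ∀ x ∈ Set.Icc a b, HasDerivAt p (q x) x) (hq : ContinuousOn q (Set.Icc a b))
    (hw : ∀ x ∈ Set.Icc a b, HasDerivAt w (w' x) x) (hw' : ContinuousOn w' (Set.Icc a b))
    (ha : w a = 0) (hb : w b = 0)
    (hpm : ∀ x ∈ Set.Icc a b, m ≤ |p x|) (hqQ : ∀ x ∈ Set.Icc a b, |q x| ≤ Q)
    (hM : ∀ x ∈ Set.Icc a b, ‖w x‖ ≤ M) (hN : ∀ x ∈ Set.Icc a b, ‖w' x‖ ≤ N) :
    ‖∫ x in a..b, w x * Complex.exp (s * φ x)‖ ≤ (N / m + M * Q / m ^ 2) * (b - a) := by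
  have hp0 : ∀ x ∈ Set.Icc a b, (p x : ℂ) ≠ 0 := by
    intro x hx h
    have h' : p x = 0 := by exact_mod_cast h
    have := hpm x hx
    rw [h', abs_zero] at this
    linarith
  have hpc : ContinuousOn p (Set.Icc a b) := fun x hx => (hp x hx).continuousAt.continuousWithinAt
  have hwc : ContinuousOn w (Set.Icc a b) := fun x hx => (hw x hx).continuousAt.continuousWithinAt
  have hpc' : ContinuousOn (fun x => (p x : ℂ)) (Set.Icc a b) := by fun_prop
  have hqc' : ContinuousOn (fun x => (q x : ℂ)) (Set.Icc a b) := by fun_prop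
  set f' : ℝ → ℂ := fun x => (w' x * p x - w x * q x) / (p x : ℂ) ^ 2 with hf'def
  have hf'c : ContinuousOn f' (Set.Icc a b) :=
    ((hw'.mul hpc').sub (hwc.mul hqc')).div (hpc'.pow 2) fun x hx => pow_ne_zero 2 (hp0 x hx)
  have h1 := norm_integral_mul_deriv_mul_exp_le hab hs hs1 hφ hpc (f := fun x => w x / p x)
    (f' := f') (fun x hx => (hw x hx).div (hp x hx).ofReal_comp (hp0 x hx)) hf'c
    (by simp [ha]) (by simp [hb])
  have h2 : ∫ x in a..b, w x / p x * p x * Complex.exp (s * φ x)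
      = ∫ x in a..b, w x * Complex.exp (s * φ x) := by
    refine intervalIntegral.integral_congr fun x hx => ?_
    rw [Set.uIcc_of_le hab] at hx
    simp only [div_mul_cancel₀ _ (hp0 x hx)]
  rw [h2] at h1
  refine h1.trans ?_
  have h3 : ∫ x in a..b, ‖f' x‖ ≤ ∫ x in a..b, (N / m + M * Q / m ^ 2) := by
    refine intervalIntegral.integral_mono_on hab (hf'c.norm.intervalIntegrable_of_Icc hab)
      intervalIntegrable_const fun x hx => ?_
    have e : f' x = w' x / p x - w x * q x / (p x : ℂ) ^ 2 := by
      have := hp0 x hx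
      simp only [hf'def]
      field_simp
    have hM0 := (norm_nonneg _).trans (hM x hx)
    have hN0 := (norm_nonneg _).trans (hN x hx)
    have hQ0 := (abs_nonneg _).trans (hqQ x hx)
    rw [e]
    refine (norm_sub_le _ _).trans (add_le_add ?_ ?_)
    · rw [norm_div, Complex.norm_real, Real.norm_eq_abs]
      exact div_le_div₀ hN0 (hN x hx) hm (hpm x hx)
    · rw [norm_div, norm_mul, norm_pow, Complex.norm_real, Complex.norm_real, Real.norm_eq_abs,
        Real.norm_eq_abs]
      exact div_le_div₀ (mul_nonneg hM0 hQ0)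
        (mul_le_mul (hM x hx) (hqQ x hx) (abs_nonneg _) hM0) (by positivity)
        (pow_le_pow_left₀ hm.le (hpm x hx) 2)
  refine h3.trans (le_of_eq ?_)
  rw [intervalIntegral.integral_const, smul_eq_mul, mul_comm]

/-- Second derivative test (van der Corput) for weighted oscillatory integrals. -/
theorem norm_integral_mul_exp_le_of_sq_le_deriv2 {a b : ℝ} (hab : a ≤ b) {s : ℂ} (hs : s.re = 0)
    (hs1 : 1 ≤ ‖s‖) {φ p q : ℝ → ℝ} {w w' : ℝ → ℂ} {μ M N : ℝ} (hμ : 0 < μ)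
    (hφ : ∀ x ∈ Set.Icc a b, HasDerivAt φ (p x) x)
    (hp : ∀ x ∈ Set.Icc a b, HasDerivAt p (q x) x) (hq : ContinuousOn q (Set.Icc a b))
    (hw : ∀ x ∈ Set.Icc a b, HasDerivAt w (w' x) x) (hw' : ContinuousOn w' (Set.Icc a b))
    (ha : w a = 0) (hb : w b = 0) (hqμ : ∀ x ∈ Set.Icc a b, μ ^ 2 ≤ q x)
    (hM : ∀ x ∈ Set.Icc a b, ‖w x‖ ≤ M) (hN : ∀ x ∈ Set.Icc a b, ‖w' x‖ ≤ N) :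
    ‖∫ x in a..b, w x * Complex.exp (s * φ x)‖
      ≤ (2 * M * Real.pi + N * (b - a)) / μ := by
  have hM0 : 0 ≤ M := (norm_nonneg _).trans (hM a ⟨le_rfl, hab⟩)
  have hN0 : 0 ≤ N := (norm_nonneg _).trans (hN a ⟨le_rfl, hab⟩)
  have hD : ∀ x, 0 < p x ^ 2 + μ ^ 2 := fun x => by positivity
  have hpc : ContinuousOn p (Set.Icc a b) := fun x hx => (hp x hx).continuousAt.continuousWithinAt
  have hwc : ContinuousOn w (Set.Icc a b) := fun x hx => (hw x hx).continuousAt.continuousWithinAt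
  have hφc : ContinuousOn φ (Set.Icc a b) := fun x hx => (hφ x hx).continuousAt.continuousWithinAt
  set g : ℝ → ℝ := fun x => q x / (p x ^ 2 + μ ^ 2) with hg
  have hgc : ContinuousOn g (Set.Icc a b) :=
    hq.div (by fun_prop) fun x _ => (hD x).ne'
  have gi : IntervalIntegrable g volume a b := hgc.intervalIntegrable_of_Icc hab
  have hgint : ∫ x in a..b, g x ≤ Real.pi / μ := by
    rw [intervalIntegral.integral_eq_sub_of_hasDerivAt
      (f := fun x => Real.arctan (p x / μ) / μ) _ gi]
    · have h1 := Real.arctan_lt_pi_div_two (p b / μ)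
      have h2 := Real.neg_pi_div_two_lt_arctan (p a / μ)
      rw [← sub_div]
      gcongr
      linarith
    · intro x hx
      rw [Set.uIcc_of_le hab] at hx
      refine (((hp x hx).div_const μ).arctan.div_const μ).congr_deriv ?_
      have := (hD x).ne'
      have h' : 1 + (p x / μ) ^ 2 = (p x ^ 2 + μ ^ 2) / μ ^ 2 := by
        field_simp
        ring
      simp only [hg]
      rw [h']
      field_simp
  set u : ℝ → ℝ := fun x => p x / (p x ^ 2 + μ ^ 2) with hu
  set u' : ℝ → ℝ := fun x => q x * (μ ^ 2 - p x ^ 2) / (p x ^ 2 + μ ^ 2) ^ 2 with hu'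
  have hud : ∀ x ∈ Set.Icc a b, HasDerivAt u (u' x) x := by
    intro x hx
    refine ((hp x hx).div (((hp x hx).pow 2).add_const (μ ^ 2)) (hD x).ne').congr_deriv ?_
    simp only [hu', Pi.pow_apply]
    congr 1
    push_cast
    ring
  have huc : ContinuousOn u (Set.Icc a b) := fun x hx => (hud x hx).continuousAt.continuousWithinAt
  have hu'c : ContinuousOn u' (Set.Icc a b) :=
    ContinuousOn.div (by fun_prop) (by fun_prop) fun x _ => pow_ne_zero 2 (hD x).ne'
  set f' : ℝ → ℂ := fun x => w' x * u x + w x * u' x with hf'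
  have hf'c : ContinuousOn f' (Set.Icc a b) := by fun_prop
  have h1 := norm_integral_mul_deriv_mul_exp_le hab hs hs1 hφ hpc (f := fun x => w x * u x)
    (f' := f') (fun x hx => (hw x hx).mul (hud x hx).ofReal_comp) hf'c
    (by simp [ha]) (by simp [hb])
  have h3 : ∫ x in a..b, ‖f' x‖ ≤ ∫ x in a..b, (N / μ + M * g x) := by
    refine intervalIntegral.integral_mono_on hab (hf'c.norm.intervalIntegrable_of_Icc hab)
      (intervalIntegrable_const.add (gi.const_mul M)) fun x hx => ?_
    have hux : |u x| ≤ 1 / μ := by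
      simp only [hu]
      rw [abs_div, abs_of_pos (hD x), div_le_div_iff₀ (hD x) hμ, ← sq_abs (p x)]
      nlinarith [sq_nonneg (|p x| - μ), mul_nonneg (abs_nonneg (p x)) hμ.le]
    have hqx : 0 ≤ q x := (sq_nonneg μ).trans (hqμ x hx)
    have hu'x : |u' x| ≤ g x := by
      simp only [hu', hg]
      rw [abs_div, abs_mul, abs_of_nonneg hqx, abs_of_pos (pow_pos (hD x) 2),
        div_le_div_iff₀ (pow_pos (hD x) 2) (hD x)]
      have : |μ ^ 2 - p x ^ 2| ≤ p x ^ 2 + μ ^ 2 := by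
        rw [abs_le]
        constructor <;> nlinarith [sq_nonneg μ, sq_nonneg (p x)]
      have h := mul_le_mul_of_nonneg_left this (mul_nonneg hqx (hD x).le)
      linarith
    refine (norm_add_le _ _).trans (add_le_add ?_ ?_)
    · rw [norm_mul, Complex.norm_real, Real.norm_eq_abs, div_eq_mul_one_div]
      exact mul_le_mul (hN x hx) hux (abs_nonneg _) hN0
    · rw [norm_mul, Complex.norm_real, Real.norm_eq_abs]
      exact mul_le_mul (hM x hx) hu'x (abs_nonneg _) hM0
  have hE : ∀ x, ‖Complex.exp (s * φ x)‖ = 1 := by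
    intro x
    simp [Complex.norm_exp, hs]
  set v : ℝ → ℝ := fun x => μ ^ 2 / (p x ^ 2 + μ ^ 2) with hv
  have hvc : ContinuousOn v (Set.Icc a b) :=
    ContinuousOn.div (by fun_prop) (by fun_prop) fun x _ => (hD x).ne'
  have c1 : ContinuousOn (fun x => w x * u x * p x * Complex.exp (s * φ x)) (Set.Icc a b) := by
    fun_prop
  have c2 : ContinuousOn (fun x => w x * v x * Complex.exp (s * φ x)) (Set.Icc a b) := by
    fun_prop
  have h4 : ‖∫ x in a..b, w x * v x * Complex.exp (s * φ x)‖ ≤ ∫ x in a..b, M * g x := by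
    refine (intervalIntegral.norm_integral_le_integral_norm hab).trans ?_
    refine intervalIntegral.integral_mono_on hab (c2.norm.intervalIntegrable_of_Icc hab)
      (gi.const_mul M) fun x hx => ?_
    have hv0 : 0 ≤ v x := by simp only [hv]; positivity
    have hvg : v x ≤ g x := div_le_div_of_nonneg_right (hqμ x hx) (hD x).le
    rw [norm_mul, norm_mul, hE, mul_one, Complex.norm_real, Real.norm_of_nonneg hv0]
    exact mul_le_mul (hM x hx) hvg hv0 hM0
  have h5 : ∫ x in a..b, w x * Complex.exp (s * φ x)
      = (∫ x in a..b, w x * u x * p x * Complex.exp (s * φ x))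
        + ∫ x in a..b, w x * v x * Complex.exp (s * φ x) := by
    rw [← intervalIntegral.integral_add (c1.intervalIntegrable_of_Icc hab)
      (c2.intervalIntegrable_of_Icc hab)]
    refine intervalIntegral.integral_congr fun x _ => ?_
    have hr : u x * p x + v x = 1 := by
      have := (hD x).ne'
      simp only [hu, hv]
      field_simp
    have hc : (u x : ℂ) * p x + v x = 1 := by exact_mod_cast hr
    linear_combination (-(w x) * Complex.exp (s * φ x)) * hc
  rw [intervalIntegral.integral_add intervalIntegrable_const (gi.const_mul M),
    intervalIntegral.integral_const_mul, intervalIntegral.integral_const, smul_eq_mul] at h3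
  rw [intervalIntegral.integral_const_mul] at h4
  have h6 := mul_le_mul_of_nonneg_left hgint hM0
  rw [h5]
  refine (norm_add_le _ _).trans ?_
  have h7 : (2 * M * Real.pi + N * (b - a)) / μ
      = (b - a) * (N / μ) + 2 * (M * (Real.pi / μ)) := by ring
  rw [h7]
  linarith

/-- The derivative of the phase `Ax + Bx/(1+x²)`. -/
theorem hasDerivAt_phase (A B x : ℝ) :
    HasDerivAt (fun x : ℝ => A * x + B * x / (1 + x ^ 2))
      (A + B * (1 - x ^ 2) / (1 + x ^ 2) ^ 2) x := by
  have hD : (1 + x ^ 2 : ℝ) ≠ 0 := by positivity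
  have h1 := ((hasDerivAt_id x).const_mul B).div (((hasDerivAt_id x).pow 2).const_add 1) hD
  refine (((hasDerivAt_id x).const_mul A).add h1).congr_deriv ?_
  simp only [id, Pi.pow_apply]
  field_simp
  push_cast
  ring

/-- The second derivative of the phase `Ax + Bx/(1+x²)`. -/
theorem hasDerivAt_deriv_phase (A B x : ℝ) :
    HasDerivAt (fun x : ℝ => A + B * (1 - x ^ 2) / (1 + x ^ 2) ^ 2)
      (2 * B * x * (x ^ 2 - 3) / (1 + x ^ 2) ^ 3) x := by
  have hD : ((1 + x ^ 2) ^ 2 : ℝ) ≠ 0 := by positivity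
  have h1 := (((hasDerivAt_id x).pow 2).const_sub 1 |>.const_mul B).div
    ((((hasDerivAt_id x).pow 2).const_add 1).pow 2) hD
  refine (h1.const_add A).congr_deriv ?_
  simp only [id, Pi.pow_apply]
  have hD : (1 + x ^ 2 : ℝ) ≠ 0 := by positivity
  field_simp
  push_cast
  ring

/-- The second derivative of the phase is continuous. -/
theorem continuous_deriv2_phase (B : ℝ) :
    Continuous fun x : ℝ => 2 * B * x * (x ^ 2 - 3) / (1 + x ^ 2) ^ 3 :=
  Continuous.div (by fun_prop) (by fun_prop) fun x => by positivity

/-- The oscillatory integral on an interval, when the linear part of the phase dominates. -/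
theorem norm_integral_phase_le_of_linear_dominates {A B C X a b c₀ c₁ : ℝ} {w w' : ℝ → ℂ}
    (hB : 0 < B) (hC : 0 < C) (hX : 100 ≤ X) (hA1 : X * (1 / C) < |A|)
    (hA2 : X * (B / C ^ 2) < |A|) (hab : a ≤ b) (haC : -(2 * C) ≤ a) (hbC : b ≤ 2 * C)
    (hfar : ∀ x ∈ Set.Icc a b, C ^ 2 / 16 ≤ 1 + x ^ 2)
    (hw : ∀ x ∈ Set.Icc a b, HasDerivAt w (w' x) x) (hw' : ContinuousOn w' (Set.Icc a b))
    (ha : w a = 0) (hb : w b = 0)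
    (h0 : ∀ x ∈ Set.Icc a b, ‖w x‖ ≤ c₀) (h1 : ∀ x ∈ Set.Icc a b, ‖w' x‖ ≤ c₁ / C) :
    ‖∫ x in a..b, w x * Complex.exp (2 * (Real.pi : ℂ) * Complex.I *
      ((A * x + B * x / (1 + x ^ 2) : ℝ) : ℂ))‖ ≤ (8 * c₁ + 512 * c₀) * C / X := by
  have hX0 : 0 < X := by linarith
  have hAp : 0 < |A| := lt_of_le_of_lt (by positivity) hA1
  have hc0 : 0 ≤ c₀ := (norm_nonneg _).trans (h0 a ⟨le_rfl, hab⟩)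
  have hc1 : 0 ≤ c₁ / C := (norm_nonneg _).trans (h1 a ⟨le_rfl, hab⟩)
  have hc1 : 0 ≤ c₁ := by
    by_contra! h
    exact absurd hc1 (not_le.mpr (div_neg_of_neg_of_pos h hC))
  have hBA : 100 * (B / C ^ 2) ≤ |A| := by
    have : 0 ≤ B / C ^ 2 := by positivity
    nlinarith
  refine (norm_integral_mul_exp_le_of_le_abs_deriv (m := |A| / 2) (Q := 32 * |A| / C)
    (M := c₀) (N := c₁ / C) hab (by simp) ?_ (by positivity)
    (fun x _ => hasDerivAt_phase A B x) (fun x _ => hasDerivAt_deriv_phase A B x)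
    (continuous_deriv2_phase B).continuousOn hw hw' ha hb ?_ ?_ h0 h1).trans ?_
  · simp [abs_of_pos Real.pi_pos]
    linarith [Real.pi_gt_three]
  · intro x hx
    have hD : 0 < 1 + x ^ 2 := by positivity
    have hb1 : |B * (1 - x ^ 2) / (1 + x ^ 2) ^ 2| ≤ 16 * (B / C ^ 2) := by
      rw [abs_div, abs_mul, abs_of_pos hB, abs_of_pos (pow_pos hD 2)]
      have e1 : |1 - x ^ 2| ≤ 1 + x ^ 2 := by
        rw [abs_le]; constructor <;> nlinarith [sq_nonneg x]
      calc B * |1 - x ^ 2| / (1 + x ^ 2) ^ 2 ≤ B * (1 + x ^ 2) / (1 + x ^ 2) ^ 2 := by gcongr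
        _ = B / (1 + x ^ 2) := by field_simp
        _ ≤ B / (C ^ 2 / 16) := by gcongr; exact hfar x hx
        _ = 16 * (B / C ^ 2) := by field_simp
    have := abs_sub_abs_le_abs_add A (B * (1 - x ^ 2) / (1 + x ^ 2) ^ 2)
    linarith
  · intro x hx
    have hD : 0 < 1 + x ^ 2 := by positivity
    have hxC : |x| ≤ 2 * C := abs_le.mpr ⟨by linarith [hx.1], by linarith [hx.2]⟩
    rw [abs_div, abs_mul, abs_mul, abs_mul, abs_of_pos hB, abs_of_pos (pow_pos hD 3)]
    have e1 : |x ^ 2 - 3| ≤ 3 * (1 + x ^ 2) := by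
      rw [abs_le]; constructor <;> nlinarith [sq_nonneg x]
    calc |(2 : ℝ)| * B * |x| * |x ^ 2 - 3| / (1 + x ^ 2) ^ 3
        ≤ |(2 : ℝ)| * B * (2 * C) * (3 * (1 + x ^ 2)) / (1 + x ^ 2) ^ 3 := by gcongr
      _ = 12 * B * C / (1 + x ^ 2) ^ 2 := by
        rw [abs_of_pos two_pos]; field_simp; ring
      _ ≤ 12 * B * C / (C ^ 2 / 16) ^ 2 := by gcongr; exact hfar x hx
      _ = 3072 * (B / C ^ 2) / C := by field_simp; ring
      _ ≤ 32 * |A| / C := div_le_div_of_nonneg_right (by linarith) hC.le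
  · have hlen : b - a ≤ 4 * C := by linarith
    calc (c₁ / C / (|A| / 2) + c₀ * (32 * |A| / C) / (|A| / 2) ^ 2) * (b - a)
        ≤ (c₁ / C / (|A| / 2) + c₀ * (32 * |A| / C) / (|A| / 2) ^ 2) * (4 * C) := by gcongr
      _ = (8 * c₁ + 512 * c₀) * (1 / |A|) := by field_simp; ring
      _ ≤ (8 * c₁ + 512 * c₀) * (1 / (X * (1 / C))) := by gcongr
      _ = (8 * c₁ + 512 * c₀) * C / X := by field_simp

/-- Lower bound for the second derivative of the phase on a dyadic interval. -/
theorem le_deriv2_phase {B C X x : ℝ} (hB : 0 < B) (hC : 16 ≤ C) (hX : X ^ 2 * C ≤ B)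
    (hx1 : C / 4 ≤ x) (hx2 : x ≤ 2 * C) :
    (X / (8 * C)) ^ 2 ≤ 2 * B * x * (x ^ 2 - 3) / (1 + x ^ 2) ^ 3 := by
  have hC0 : 0 < C := by linarith
  have hx0 : 4 ≤ x := by linarith
  have hxp : 0 < x := by linarith
  calc (X / (8 * C)) ^ 2 = X ^ 2 * C / (64 * C ^ 3) := by field_simp; norm_num
    _ ≤ B / (64 * C ^ 3) := by gcongr
    _ = B / (8 * (2 * C) ^ 3) := by ring
    _ ≤ B / (8 * x ^ 3) := by gcongr
    _ = 2 * B * x * (x ^ 2 / 2) / (x ^ 2 + x ^ 2) ^ 3 := by field_simp; ring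
    _ ≤ 2 * B * x * (x ^ 2 - 3) / (1 + x ^ 2) ^ 3 := by
        have h3 : x ^ 2 / 2 ≤ x ^ 2 - 3 := by nlinarith
        have h1 : 1 + x ^ 2 ≤ x ^ 2 + x ^ 2 := by nlinarith
        have h0 : 0 ≤ x ^ 2 - 3 := by nlinarith
        gcongr

/-- An integral whose integrand is supported in the annulus `C/2 ≤ 1 + |x| ≤ 2C` splits into the
two dyadic intervals when `C > 4`. -/
theorem integral_eq_add_of_support_annulus {C : ℝ} (hC : 4 < C) {F : ℝ → ℂ} (hF : Continuous F)
    (hsupp : ∀ x, F x ≠ 0 → C / 2 ≤ 1 + |x| ∧ 1 + |x| ≤ 2 * C) :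
    ∫ x, F x = (∫ x in (-(2 * C))..(-(C / 4)), F x) + ∫ x in (C / 4)..(2 * C), F x := by
  have h1 : ∫ x, F x = ∫ x in (-(2 * C))..(2 * C), F x := by
    refine (intervalIntegral.integral_eq_integral_of_support_subset fun x hx => ?_).symm
    have := (hsupp x hx).2
    have h := abs_le.mp (show |x| ≤ 2 * C - 1 by linarith)
    exact ⟨by linarith [h.1], by linarith [h.2]⟩
  have h2 : ∫ x in (-(C / 4))..(C / 4), F x = 0 := by
    refine intervalIntegral.integral_zero_ae (Filter.Eventually.of_forall fun x hx => ?_)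
    rw [Set.uIoc_of_le (by linarith)] at hx
    by_contra h
    have := (hsupp x h).1
    have := abs_le.mpr ⟨hx.1.le, hx.2⟩
    linarith
  rw [h1, ← intervalIntegral.integral_add_adjacent_intervals (b := -(C / 4))
    (hF.intervalIntegrable _ _) (hF.intervalIntegrable _ _),
    ← intervalIntegral.integral_add_adjacent_intervals (a := -(C / 4)) (b := C / 4)
    (hF.intervalIntegrable _ _) (hF.intervalIntegrable _ _), h2, zero_add]

/-- Stationary phase lemma for the oscillatory integral `∫ w(x) e(Ax + Bx/(1+x²)) dx`. -/
theorem stmt1 (η δ : ℝ) (hη : 0 < η) (hδ0 : 0 < δ) (hδ : δ < 1 / 10)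
    (c : ℕ → ℝ) (hc : ∀ j, 0 < c j) :
    ∃ C' : ℝ, 0 < C' ∧ ∀ (A B C T : ℝ) (w : ℝ → ℂ),
      A ≠ 0 → 0 < B → 1 / 2 < C → (6 : ℝ) ^ (1 / η) < T →
      ContDiff ℝ (⊤ : ℕ∞) w →
      (∀ x : ℝ, w x ≠ 0 → C / 2 ≤ 1 + |x| ∧ 1 + |x| ≤ 2 * C) →
      (∀ (j : ℕ) (x : ℝ), ‖iteratedDeriv j w x‖ ≤ c j / C ^ j) →
      ((T ^ η * max (1 / C) (B / C ^ 2) < |A|) ∨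
        (T ^ (2 * η) * C < B ∧ B < T ^ (-η) * C ^ 3 ∧ C ^ (1 + δ) ≤ B)) →
      ‖∫ x : ℝ, w x *
          Complex.exp (2 * (Real.pi : ℂ) * Complex.I * ((A * x + B * x / (1 + x ^ 2) : ℝ) : ℂ))‖ ≤
        C' * C * T ^ (-η) := by
  have hc0 := hc 0
  have hc1 := hc 1
  refine ⟨64 * c 1 + 1024 * c 0, by positivity, ?_⟩
  intro A B C T w _ hB hC hT hw hsupp hder hcase
  have hC0 : 0 < C := by linarith
  have hT0 : 0 < T := (Real.rpow_pos_of_pos (by norm_num) _).trans hT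
  set X := T ^ η with hXdef
  have hX0 : 0 < X := Real.rpow_pos_of_pos hT0 _
  have hXinv : T ^ (-η) = 1 / X := by rw [Real.rpow_neg hT0.le, one_div]
  have hX2 : T ^ (2 * η) = X ^ 2 := by
    rw [hXdef, ← Real.rpow_natCast, ← Real.rpow_mul hT0.le, mul_comm]
    norm_num
  rw [hXinv, hX2] at hcase
  rw [hXinv]
  have hb0 : ∀ x, ‖w x‖ ≤ c 0 := fun x => by simpa using hder 0 x
  have hb1 : ∀ x, ‖deriv w x‖ ≤ c 1 / C := fun x => by simpa using hder 1 x
  have hwd : ∀ x, HasDerivAt w (deriv w x) x := fun x =>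
    (hw.differentiable (by simp) x).hasDerivAt
  have hwd' : Continuous (deriv w) := hw.continuous_deriv (by simp)
  have hwc : Continuous w := hw.continuous
  have hz : ∀ x, 2 * C ≤ |x| → w x = 0 := by
    intro x hx
    by_contra h
    linarith [(hsupp x h).2]
  have hz' : 4 < C → ∀ x, |x| ≤ C / 4 → w x = 0 := by
    intro h4 x hx
    by_contra h
    linarith [(hsupp x h).1]
  set F : ℝ → ℂ := fun x => w x * Complex.exp (2 * (Real.pi : ℂ) * Complex.I *
    ((A * x + B * x / (1 + x ^ 2) : ℝ) : ℂ)) with hF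
  have hφc : Continuous fun x : ℝ => A * x + B * x / (1 + x ^ 2) :=
    continuous_iff_continuousAt.mpr fun x => (hasDerivAt_phase A B x).continuousAt
  have hFc : Continuous F := by fun_prop
  have hFs : ∀ x, F x ≠ 0 → w x ≠ 0 := fun x h => left_ne_zero_of_mul h
  have hwhole : ∫ x, F x = ∫ x in (-(2 * C))..(2 * C), F x := by
    refine (intervalIntegral.integral_eq_integral_of_support_subset fun x hx => ?_).symm
    have := (hsupp x (hFs x hx)).2
    have h := abs_le.mp (show |x| ≤ 2 * C - 1 by linarith)
    exact ⟨by linarith [h.1], by linarith [h.2]⟩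
  have hzr : w (2 * C) = 0 := hz _ (le_abs_self _)
  have hzl : w (-(2 * C)) = 0 := hz _ (by rw [abs_neg]; exact le_abs_self _)
  rcases lt_or_ge X 100 with hXs | hXl
  · rw [hwhole]
    have h : ∀ x ∈ Set.uIoc (-(2 * C)) (2 * C), ‖F x‖ ≤ c 0 := by
      intro x _
      have : ‖F x‖ = ‖w x‖ := by
        simp only [hF]
        rw [norm_mul, Complex.norm_exp, Complex.re_mul_ofReal]
        simp
      rw [this]
      exact hb0 x
    refine (intervalIntegral.norm_integral_le_of_norm_le_const h).trans ?_
    rw [abs_of_nonneg (by linarith), mul_one_div, le_div_iff₀ hX0]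
    have e1 : c 0 * C * X ≤ c 0 * C * 100 := by gcongr
    have e2 : 0 < c 0 * C := by positivity
    have e3 : 0 < c 1 * C := by positivity
    linarith
  have hfinal : ∀ I : ℂ, ‖I‖ ≤ 2 * ((32 * c 1 + 512 * c 0) * C / X) →
      ‖I‖ ≤ (64 * c 1 + 1024 * c 0) * C * (1 / X) := fun I h => h.trans (le_of_eq (by ring))
  apply hfinal
  rcases hcase with hA | ⟨hBl, hBu, -⟩
  · have hA1 : X * (1 / C) < |A| := lt_of_le_of_lt (by gcongr; exact le_max_left _ _) hA
    have hA2 : X * (B / C ^ 2) < |A| := lt_of_le_of_lt (by gcongr; exact le_max_right _ _) hA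
    have hmono : (8 * c 1 + 512 * c 0) * C / X ≤ (32 * c 1 + 512 * c 0) * C / X := by
      gcongr; norm_num
    rcases le_or_gt C 4 with h4 | h4
    · rw [hwhole]
      have := norm_integral_phase_le_of_linear_dominates hB hC0 hXl hA1 hA2
        (a := -(2 * C)) (b := 2 * C) (by linarith) le_rfl le_rfl
        (fun x _ => by nlinarith [sq_nonneg x])
        (fun x _ => hwd x) hwd'.continuousOn hzl hzr (fun x _ => hb0 x) (fun x _ => hb1 x)
      have : 0 ≤ (32 * c 1 + 512 * c 0) * C / X := by positivity
      linarith
    · rw [integral_eq_add_of_support_annulus h4 hFc fun x hx => hsupp x (hFs x hx)]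
      have z1 : w (C / 4) = 0 := hz' h4 _ (abs_of_pos (by linarith)).le
      have z2 : w (-(C / 4)) = 0 := hz' h4 _ (by rw [abs_neg]; exact (abs_of_pos (by linarith)).le)
      have i1 := norm_integral_phase_le_of_linear_dominates hB hC0 hXl hA1 hA2
        (a := -(2 * C)) (b := -(C / 4)) (by linarith) le_rfl (by linarith)
        (fun x hx => by nlinarith [hx.2])
        (fun x _ => hwd x) hwd'.continuousOn hzl z2 (fun x _ => hb0 x) (fun x _ => hb1 x)
      have i2 := norm_integral_phase_le_of_linear_dominates hB hC0 hXl hA1 hA2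
        (a := C / 4) (b := 2 * C) (by linarith) (by linarith) le_rfl
        (fun x hx => by nlinarith [hx.1])
        (fun x _ => hwd x) hwd'.continuousOn z1 hzr (fun x _ => hb0 x) (fun x _ => hb1 x)
      refine (norm_add_le _ _).trans ?_
      linarith
  · have hC16 : 16 ≤ C := by
      have h1 : X ^ 3 < C ^ 2 := by
        have h := hBl.trans hBu
        rw [one_div, inv_mul_eq_div, lt_div_iff₀ hX0] at h
        have h' : X ^ 3 * C < C ^ 2 * C := by linarith
        exact lt_of_mul_lt_mul_right h' hC0.le
      have h2 : (100 : ℝ) ^ 3 ≤ X ^ 3 := by gcongr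
      nlinarith
    have h4 : 4 < C := by linarith
    rw [integral_eq_add_of_support_annulus h4 hFc fun x hx => hsupp x (hFs x hx)]
    have z1 : w (C / 4) = 0 := hz' h4 _ (abs_of_pos (by linarith)).le
    have z2 : w (-(C / 4)) = 0 := hz' h4 _ (by rw [abs_neg]; exact (abs_of_pos (by linarith)).le)
    have hπ : 1 ≤ 2 * Real.pi := by linarith [Real.pi_gt_three]
    have hμ : 0 < X / (8 * C) := by positivity
    have hbound : ∀ l : ℝ, l ≤ 2 * C → (2 * c 0 * Real.pi + c 1 / C * l) / (X / (8 * C))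
        ≤ (32 * c 1 + 512 * c 0) * C / X := by
      intro l hl
      have hπ4 := Real.pi_le_four
      calc (2 * c 0 * Real.pi + c 1 / C * l) / (X / (8 * C))
          ≤ (2 * c 0 * 4 + c 1 / C * (2 * C)) / (X / (8 * C)) := by gcongr
        _ = (16 * c 1 + 64 * c 0) * C / X := by field_simp; ring
        _ ≤ (32 * c 1 + 512 * c 0) * C / X := by gcongr <;> norm_num
    have i2 := norm_integral_mul_exp_le_of_sq_le_deriv2 (a := C / 4) (b := 2 * C)
      (s := 2 * (Real.pi : ℂ) * Complex.I) (by linarith) (by simp)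
      (by simpa [abs_of_pos Real.pi_pos] using hπ) hμ
      (fun x _ => hasDerivAt_phase A B x) (fun x _ => hasDerivAt_deriv_phase A B x)
      (continuous_deriv2_phase B).continuousOn (fun x _ => hwd x) hwd'.continuousOn z1 hzr
      (fun x hx => le_deriv2_phase hB hC16 hBl.le hx.1 hx.2) (fun x _ => hb0 x) (fun x _ => hb1 x)
    have i1 := norm_integral_mul_exp_le_of_sq_le_deriv2 (a := -(2 * C)) (b := -(C / 4))
      (s := -(2 * (Real.pi : ℂ) * Complex.I)) (by linarith) (by simp)
      (by simpa [abs_of_pos Real.pi_pos] using hπ) hμ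
      (fun x _ => (hasDerivAt_phase A B x).neg) (fun x _ => (hasDerivAt_deriv_phase A B x).neg)
      (continuous_deriv2_phase B).neg.continuousOn (fun x _ => hwd x) hwd'.continuousOn hzl z2
      (fun x hx => by
        refine (le_deriv2_phase (x := -x) hB hC16 hBl.le (by linarith [hx.2])
          (by linarith [hx.1])).trans (le_of_eq ?_)
        rw [neg_sq]
        ring)
      (fun x _ => hb0 x) (fun x _ => hb1 x)
    have e1 : ∀ x : ℝ, w x * Complex.exp (-(2 * (Real.pi : ℂ) * Complex.I) *
        ((-fun x : ℝ => A * x + B * x / (1 + x ^ 2)) x : ℝ)) = F x := by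
      intro x
      simp only [hF, Pi.neg_apply, Complex.ofReal_neg, neg_mul_neg]
    simp only [e1] at i1
    refine (norm_add_le _ _).trans ?_
    have b1 := hbound (-(C / 4) - -(2 * C)) (by linarith)
    have b2 := hbound (2 * C - C / 4) (by linarith)
    have i2' := i2.trans b2
    have i1' := i1.trans b1
    linarith
end

section
/- There is an absolute constant C such that for all integers d ≥ 2, N ≥ 0 and all real y > 0, |𝒲̃_{d,N}(y)| ≤ C·((1+N/d)·log(3+(d+N)/y))^{1/4}. -/
open MeasureTheory

/-- The normalized GL(2) Whittaker function
`𝒲̃_{d,N}(y) = 2π e^{−y/2} Σ_{k=0}^{N} [(−1)^{N−k} √(N!·(d−1+N)!) / (k!·(N−k)!·(d−1+k)!)]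
  y^{(d−1)/2+k}`. -/
noncomputable def Wtilde (d N : ℕ) (y : ℝ) : ℝ :=
  2 * Real.pi * Real.exp (-y / 2) *
    ∑ k ∈ Finset.range (N + 1),
      ((-1 : ℝ) ^ (N - k) *
          Real.sqrt ((Nat.factorial N : ℝ) * (Nat.factorial (d - 1 + N) : ℝ)) /
        ((Nat.factorial k : ℝ) * (Nat.factorial (N - k) : ℝ) *
          (Nat.factorial (d - 1 + k) : ℝ))) *
      y ^ (((d : ℝ) - 1) / 2 + (k : ℝ))

open PowerSeries in
/-- The power series `(X - x) ^ n * exp (x X)`. Up to normalization it is the image of `X ^ n` under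
a unitary translation of Fock space, the space in which `X ^ m` has squared norm `m!`. -/
noncomputable def fockTranslate (x : ℝ) (n : ℕ) : PowerSeries ℝ :=
  (X - C x) ^ n * rescale x (exp ℝ)

namespace fockTranslate

open PowerSeries Filter Topology

open scoped Nat

variable (x : ℝ)

lemma coeff_succ_succ (n m : ℕ) :
    coeff (m + 1) (fockTranslate x (n + 1)) =
      coeff m (fockTranslate x n) - x * coeff (m + 1) (fockTranslate x n) := by
  have h : fockTranslate x (n + 1) = X * fockTranslate x n - C x * fockTranslate x n := by
    simp only [fockTranslate]; ring
  rw [h, map_sub, coeff_succ_X_mul, coeff_C_mul]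

lemma coeff_zero_succ (n : ℕ) :
    coeff 0 (fockTranslate x (n + 1)) = -x * coeff 0 (fockTranslate x n) := by
  have h : fockTranslate x (n + 1) = X * fockTranslate x n - C x * fockTranslate x n := by
    simp only [fockTranslate]; ring
  rw [h, map_sub, coeff_zero_X_mul, coeff_C_mul]
  ring

lemma succ_mul_coeff_succ (n m : ℕ) :
    (m + 1 : ℝ) * coeff (m + 1) (fockTranslate x (n + 1)) =
      x * coeff m (fockTranslate x (n + 1)) + (n + 1) * coeff m (fockTranslate x n) := by
  have hE : derivative ℝ (rescale x (exp ℝ)) = C x * rescale x (exp ℝ) := by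
    ext k
    have : (k ! : ℝ) ≠ 0 := by positivity
    have : (k + 1 : ℝ) ≠ 0 := by positivity
    simp [coeff_derivative, coeff_rescale, coeff_exp, coeff_C_mul, Nat.factorial_succ, pow_succ]
    field_simp
  have hD : derivative ℝ (fockTranslate x (n + 1)) =
      C x * fockTranslate x (n + 1) + C (n + 1 : ℝ) * fockTranslate x n := by
    simp only [fockTranslate, Derivation.leibniz, Derivation.leibniz_pow, hE, map_sub,
      derivative_X, derivative_C, smul_eq_mul, nsmul_eq_mul, map_add, map_natCast, map_one]
    push_cast
    ring
  have h := congrArg (coeff m) hD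
  rw [coeff_derivative, map_add, coeff_C_mul, coeff_C_mul] at h
  linarith

/-- The Fock norm of `fockTranslate x n`. -/
lemma hasSum_sq (n : ℕ) :
    HasSum (fun m : ℕ => (m ! : ℝ) * coeff m (fockTranslate x n) ^ 2)
      (n ! * Real.exp (x ^ 2)) := by
  induction n with
  | zero =>
    have h := NormedSpace.expSeries_div_hasSum_exp (x ^ 2)
    rw [← Real.exp_eq_exp_ℝ] at h
    rw [Nat.factorial_zero, Nat.cast_one, one_mul]
    refine h.congr_fun fun m => ?_
    have : (m ! : ℝ) ≠ 0 := by positivity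
    simp [fockTranslate, coeff_rescale, coeff_exp]
    field_simp
    ring
  | succ n ih =>
    set A : ℕ → ℝ := fun m => (m ! : ℝ) * coeff m (fockTranslate x n) ^ 2 with hA
    set Q : ℕ → ℝ := fun m => (m ! : ℝ) * coeff m (fockTranslate x (n + 1)) ^ 2 with hQ
    set P : ℕ → ℝ := fun m => (m ! : ℝ) *
      (coeff m (fockTranslate x (n + 1)) * coeff m (fockTranslate x n)) with hP
    set S : ℝ := n ! * Real.exp (x ^ 2) with hS
    have hA0 : ∀ m, 0 ≤ A m := fun m => by positivity
    have hQ0 : ∀ m, 0 ≤ Q m := fun m => by positivity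
    have partial_sum : ∀ M, ∑ m ∈ Finset.range (M + 1), Q m =
        (n + 1) * ∑ m ∈ Finset.range M, A m - x * P M := by
      intro M
      induction M with
      | zero =>
        simp only [zero_add, Finset.sum_range_one, Finset.sum_range_zero, hQ, hP,
          coeff_zero_succ]
        ring
      | succ M ihM =>
        rw [Finset.sum_range_succ, ihM, Finset.sum_range_succ _ M]
        have h1 := coeff_succ_succ x n M
        have h2 := succ_mul_coeff_succ x n M
        simp only [hQ, hP, hA, Nat.factorial_succ]
        push_cast
        linear_combination (M + 1 : ℝ) * M ! * coeff (M + 1) (fockTranslate x (n + 1)) * h1 +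
          (M ! : ℝ) * coeff M (fockTranslate x n) * h2
    have hPAQ : ∀ t M, |t * P M| ≤ (t ^ 2 * A M + Q M) / 2 := by
      intro t M
      have hM : (0 : ℝ) ≤ M ! := by positivity
      simp only [hP, hA, hQ]
      rw [abs_le]
      constructor
      · nlinarith [mul_nonneg hM (sq_nonneg (t * coeff M (fockTranslate x n) +
          coeff M (fockTranslate x (n + 1))))]
      · nlinarith [mul_nonneg hM (sq_nonneg (t * coeff M (fockTranslate x n) -
          coeff M (fockTranslate x (n + 1))))]
    have bound : ∀ M, ∑ m ∈ Finset.range M, Q m ≤ (2 * (n + 1) + x ^ 2) * S := by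
      intro M
      have hsucc : ∑ m ∈ Finset.range M, Q m ≤ ∑ m ∈ Finset.range (M + 1), Q m := by
        rw [Finset.sum_range_succ]; linarith [hQ0 M]
      have hQM : Q M ≤ ∑ m ∈ Finset.range (M + 1), Q m :=
        Finset.single_le_sum (f := Q) (fun i _ => hQ0 i) (Finset.self_mem_range_succ M)
      have hAS : ∑ m ∈ Finset.range M, A m ≤ S := sum_le_hasSum _ (fun i _ => hA0 i) ih
      have hAM : A M ≤ S := le_hasSum ih M (fun i _ => hA0 i)
      have h1 := (abs_le.mp (hPAQ x M)).1
      have h2 := partial_sum M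
      have h3 : (n + 1 : ℝ) * ∑ m ∈ Finset.range M, A m ≤ (n + 1) * S := by gcongr
      have h4 : x ^ 2 * A M ≤ x ^ 2 * S := by gcongr
      linarith
    have hQsum : Summable Q := summable_of_sum_range_le hQ0 bound
    have hP0 : Tendsto (fun M => x * P M) atTop (𝓝 0) := by
      refine squeeze_zero_norm (fun M => hPAQ x M) ?_
      simpa using ((ih.summable.tendsto_atTop_zero.const_mul (x ^ 2)).add
        hQsum.tendsto_atTop_zero).div_const 2
    have hlim : Tendsto (fun M => ∑ m ∈ Finset.range (M + 1), Q m) atTop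
        (𝓝 ((n + 1) * S - 0)) := by
      simp_rw [partial_sum]
      exact (ih.tendsto_sum_nat.const_mul _).sub hP0
    have huniq := tendsto_nhds_unique hlim
      ((tendsto_add_atTop_iff_nat 1).mpr hQsum.hasSum.tendsto_sum_nat)
    have hval : ((n + 1)! : ℝ) * Real.exp (x ^ 2) = ∑' m, Q m := by
      rw [← huniq, hS, Nat.factorial_succ]
      push_cast
      ring
    rw [hval]
    exact hQsum.hasSum

lemma coeff_add (n a : ℕ) :
    coeff (n + a) (fockTranslate x n) =
      ∑ k ∈ Finset.range (n + 1),
        (-1 : ℝ) ^ k * n.choose k / (a + k)! * x ^ (a + 2 * k) := by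
  have h : fockTranslate x n = ∑ k ∈ Finset.range (n + 1),
      X ^ (n - k) * (C ((-x) ^ k * n.choose k) * rescale x (exp ℝ)) := by
    rw [fockTranslate, sub_eq_neg_add, add_pow, Finset.sum_mul]
    refine Finset.sum_congr rfl fun k _ => ?_
    simp only [map_mul, map_pow, map_neg, map_natCast]
    ring
  rw [h, map_sum]
  refine Finset.sum_congr rfl fun k hk => ?_
  have hk' : k ≤ n := Nat.lt_succ_iff.mp (Finset.mem_range.mp hk)
  rw [show n + a = (a + k) + (n - k) by omega, coeff_X_pow_mul, coeff_C_mul, coeff_rescale,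
    coeff_exp]
  simp only [map_div₀, map_one, map_natCast]
  rw [neg_pow]
  ring

end fockTranslate

open scoped Nat in
lemma Wtilde_eq_coeff_fockTranslate (d N : ℕ) {y : ℝ} (hd : 1 ≤ d) (hy : 0 < y) :
    Wtilde d N y = 2 * Real.pi * ((-1) ^ N * (Real.exp (-y / 2) *
      (√((N ! : ℝ) * (d - 1 + N)!) / N !) *
        PowerSeries.coeff (N + (d - 1)) (fockTranslate (√y) N))) := by
  obtain ⟨a, rfl⟩ : ∃ a, d = a + 1 := ⟨d - 1, by omega⟩
  rw [fockTranslate.coeff_add, Wtilde]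
  simp only [Nat.add_sub_cancel, Finset.mul_sum]
  refine Finset.sum_congr rfl fun k hk => ?_
  have hk' : k ≤ N := Nat.lt_succ_iff.mp (Finset.mem_range.mp hk)
  have hpow : y ^ ((((a + 1 : ℕ) : ℝ) - 1) / 2 + (k : ℝ)) = √y ^ (a + 2 * k) := by
    rw [Real.sqrt_eq_rpow, ← Real.rpow_natCast, ← Real.rpow_mul hy.le]
    congr 1
    push_cast
    ring
  have hsign : (-1 : ℝ) ^ (N - k) = (-1) ^ N * (-1) ^ k := by
    rw [← pow_add, show N + k = (N - k) + 2 * k by omega, pow_add, pow_mul]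
    simp
  rw [hpow, hsign, Nat.cast_choose ℝ hk']
  have : (N ! : ℝ) ≠ 0 := by positivity
  field_simp

open scoped Nat in
lemma abs_Wtilde_le (d N : ℕ) {y : ℝ} (hd : 1 ≤ d) (hy : 0 < y) :
    |Wtilde d N y| ≤ 2 * Real.pi := by
  rw [Wtilde_eq_coeff_fockTranslate d N hd hy, abs_mul, abs_of_pos Real.two_pi_pos, abs_mul,
    abs_pow, abs_neg, abs_one, one_pow, one_mul]
  refine mul_le_of_le_one_right Real.two_pi_pos.le ?_
  rw [← sq_le_one_iff_abs_le_one]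
  have h := le_hasSum (fockTranslate.hasSum_sq (√y) N) (N + (d - 1)) fun i _ => by positivity
  rw [Real.sq_sqrt hy.le] at h
  have hN : (0 : ℝ) < N ! := by positivity
  have hexp : Real.exp (-y / 2) ^ 2 = (Real.exp y)⁻¹ := by
    rw [← Real.exp_nat_mul, ← Real.exp_neg]
    congr 1
    push_cast
    ring
  rw [mul_pow, mul_pow, div_pow, Real.sq_sqrt (by positivity), hexp, add_comm (d - 1) N]
  calc _ = ((N + (d - 1))! * PowerSeries.coeff (N + (d - 1)) (fockTranslate (√y) N) ^ 2) /
        (N ! * Real.exp y) := by field_simp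
    _ ≤ 1 := (div_le_one (by positivity)).mpr h

/-- Generic bound: `|𝒲̃_{d,N}(y)| ≤ C·((1+N/d)·log(3+(d+N)/y))^{1/4}`. -/
theorem stmt2 :
    ∃ C : ℝ, 0 < C ∧ ∀ (d N : ℕ) (y : ℝ), 2 ≤ d → 0 < y →
      |Wtilde d N y| ≤
        C * ((1 + (N : ℝ) / (d : ℝ)) * Real.log (3 + ((d : ℝ) + (N : ℝ)) / y)) ^ ((1 : ℝ) / 4) := by
  refine ⟨2 * Real.pi, Real.two_pi_pos, fun d N y hd hy => ?_⟩
  refine (abs_Wtilde_le d N (by omega) hy).trans (le_mul_of_one_le_right Real.two_pi_pos.le ?_)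
  refine Real.one_le_rpow (one_le_mul_of_one_le_of_one_le ?_ ?_) (by norm_num)
  · linarith [show (0 : ℝ) ≤ N / d by positivity]
  · rw [Real.le_log_iff_exp_le (by positivity)]
    linarith [Real.exp_one_lt_d9, show (0 : ℝ) ≤ ((d : ℝ) + N) / y by positivity]
end

section
/- There is an absolute constant C such that for all integers d ≥ 2 and N ≥ 0: (a) if 0 < y < (d−1)/(e(N+1)) then |𝒲̃_{d,N}(y)| ≤ C·y^{1/2}·(N+1)^{3/2}·d^{−3/4}; and (b) if y > (d+3+2N)·max(N, 2·log²(d+3+2N)) then |𝒲̃_{d,N}(y)| ≤ C·(N+1)·e^{−y/4}/√(N!·(d−1+N)!). -/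
open MeasureTheory

open Real in
/-- The triangle inequality for `Wtilde`, with `a = d - 1`. -/
theorem abs_Wtilde_le_s3 (a N : ℕ) {y : ℝ} (hy : 0 < y) :
    |Wtilde (a + 1) N y| ≤ 2 * π * exp (-y / 2) * ∑ k ∈ Finset.range (N + 1),
      √((N.factorial : ℝ) * ((a + N).factorial : ℝ)) /
        ((k.factorial : ℝ) * ((N - k).factorial : ℝ) * ((a + k).factorial : ℝ)) *
        (y ^ ((a : ℝ) / 2) * y ^ k) := by
  unfold Wtilde
  rw [abs_mul, abs_of_pos (by positivity : 0 < 2 * π * exp (-y / 2))]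
  gcongr
  refine (Finset.abs_sum_le_sum_abs _ _).trans (Finset.sum_le_sum fun k _ => le_of_eq ?_)
  have h : y ^ ((((a + 1 : ℕ) : ℝ) - 1) / 2 + (k : ℝ)) = y ^ ((a : ℝ) / 2) * y ^ k := by
    rw [rpow_add hy, rpow_natCast]
    push_cast
    rw [add_sub_cancel_right]
  rw [h, abs_mul, abs_div, abs_mul, abs_pow, abs_neg, abs_one, one_pow, one_mul,
    Nat.add_sub_cancel, abs_of_nonneg (sqrt_nonneg _), abs_of_pos (a := y ^ _ * _) (by positivity),
    abs_of_pos (a := (_ : ℝ) * _ * _) (by positivity)]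

theorem factorial_add_le_mul_pow (a N : ℕ) :
    (a + N).factorial ≤ N.factorial * a.factorial * (N + 1) ^ a := by
  induction a with
  | zero => simp
  | succ a ih =>
    rw [show a + 1 + N = (a + N) + 1 by ring, Nat.factorial_succ, Nat.factorial_succ a]
    calc (a + N + 1) * (a + N).factorial
        ≤ ((a + 1) * (N + 1)) * (N.factorial * a.factorial * (N + 1) ^ a) :=
          Nat.mul_le_mul (by nlinarith [Nat.zero_le (a * N)]) ih
      _ = _ := by ring

theorem factorial_add_le_factorial_mul_pow (n k : ℕ) :
    (n + k).factorial ≤ n.factorial * (n + k) ^ k := by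
  rw [← Nat.factorial_mul_ascFactorial]
  exact Nat.mul_le_mul_left _ (Nat.ascFactorial_le_pow_add n k)

open Real in
/-- Stirling's lower bound, used to control `x ^ a / a!` for `x ≤ a / e`. -/
theorem pow_div_factorial_le {a : ℕ} (ha : 1 ≤ a) {x : ℝ} (hx : 0 ≤ x)
    (hxa : x ≤ (a : ℝ) / exp 1) :
    x ^ a / (a.factorial : ℝ) ≤ 16 * x / (((a : ℝ) + 1) * √((a : ℝ) + 1)) := by
  have ha' : (1 : ℝ) ≤ a := by exact_mod_cast ha
  have hst := Stirling.le_factorial_stirling a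
  have hq : 0 < (a : ℝ) / exp 1 := by positivity
  have hpow : x ^ a ≤ x * ((a : ℝ) / exp 1) ^ (a - 1) := by
    obtain ⟨b, rfl⟩ : ∃ b, a = b + 1 := ⟨a - 1, by omega⟩
    rw [pow_succ', Nat.add_sub_cancel]
    gcongr
  have hsplit : ((a : ℝ) / exp 1) ^ a = ((a : ℝ) / exp 1) ^ (a - 1) * ((a : ℝ) / exp 1) := by
    rw [← pow_succ, Nat.sub_add_cancel ha]
  have hsqrt : √((a : ℝ) + 1) ≤ √(2 * π * a) :=
    sqrt_le_sqrt (by nlinarith [pi_gt_three])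
  have hkey : ((a : ℝ) + 1) * √((a : ℝ) + 1) ≤ 16 * (√(2 * π * a) * ((a : ℝ) / exp 1)) := by
    have h1 : (a : ℝ) + 1 ≤ 16 * ((a : ℝ) / exp 1) := by
      rw [mul_div_assoc', le_div_iff₀ (exp_pos 1)]
      nlinarith [exp_one_lt_three]
    calc _ ≤ 16 * ((a : ℝ) / exp 1) * √(2 * π * a) := by gcongr
      _ = _ := by ring
  rw [div_le_div_iff₀ (by positivity) (by positivity)]
  calc x ^ a * (((a : ℝ) + 1) * √((a : ℝ) + 1))
      ≤ x * ((a : ℝ) / exp 1) ^ (a - 1) * (16 * (√(2 * π * a) * ((a : ℝ) / exp 1))) := by gcongr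
    _ = 16 * x * (√(2 * π * a) * ((a : ℝ) / exp 1) ^ a) := by rw [hsplit]; ring
    _ ≤ 16 * x * a.factorial := by gcongr

open Real in
theorem leading_coefficient_le {a : ℕ} (ha : 1 ≤ a) (N : ℕ) {y : ℝ} (hy : 0 < y)
    (hya : y < (a : ℝ) / (exp 1 * ((N : ℝ) + 1))) :
    √((N.factorial : ℝ) * ((a + N).factorial : ℝ)) / ((N.factorial : ℝ) * (a.factorial : ℝ)) *
        y ^ ((a : ℝ) / 2) ≤
      4 * y ^ ((1 : ℝ) / 2) * ((N : ℝ) + 1) ^ ((3 : ℝ) / 2) * ((a : ℝ) + 1) ^ (-(3 : ℝ) / 4) := by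
  have hx : ((N : ℝ) + 1) * y ≤ (a : ℝ) / exp 1 := by
    rw [lt_div_iff₀ (by positivity)] at hya
    rw [le_div_iff₀ (exp_pos 1)]
    linarith
  have hmain := pow_div_factorial_le ha (by positivity) hx
  have hfac : ((a + N).factorial : ℝ) ≤ N.factorial * a.factorial * ((N : ℝ) + 1) ^ a := by
    exact_mod_cast factorial_add_le_mul_pow a N
  refine (le_abs_self _).trans (abs_le_of_sq_le_sq ?_ (by positivity))
  have hya2 : (y ^ ((a : ℝ) / 2)) ^ 2 = y ^ a := by
    rw [← rpow_natCast, ← rpow_mul hy.le, ← rpow_natCast]; congr 1; push_cast; ring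
  have hy2 : (y ^ ((1 : ℝ) / 2)) ^ 2 = y := by
    rw [← rpow_natCast, ← rpow_mul hy.le]; norm_num
  have hN2 : (((N : ℝ) + 1) ^ ((3 : ℝ) / 2)) ^ 2 = ((N : ℝ) + 1) ^ 3 := by
    rw [← rpow_natCast, ← rpow_mul (by positivity), ← rpow_natCast]; norm_num
  have hd2 : (((a : ℝ) + 1) ^ (-(3 : ℝ) / 4)) ^ 2 = (((a : ℝ) + 1) * √((a : ℝ) + 1))⁻¹ := by
    have hp : (0 : ℝ) < (a : ℝ) + 1 := by positivity
    rw [← rpow_natCast, ← rpow_mul hp.le, sqrt_eq_rpow, ← rpow_one_add' hp.le (by norm_num),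
      ← rpow_neg hp.le]
    norm_num
  rw [mul_pow, mul_pow, mul_pow, mul_pow, div_pow, sq_sqrt (by positivity), hya2, hy2, hN2, hd2]
  have hN1 : (N : ℝ) + 1 ≤ ((N : ℝ) + 1) ^ 3 := le_self_pow₀ (by simp) (by norm_num)
  calc (N.factorial : ℝ) * ((a + N).factorial : ℝ) / ((N.factorial : ℝ) * (a.factorial : ℝ)) ^ 2
          * y ^ a
      ≤ (N.factorial : ℝ) * (N.factorial * a.factorial * ((N : ℝ) + 1) ^ a) /
          ((N.factorial : ℝ) * (a.factorial : ℝ)) ^ 2 * y ^ a := by gcongr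
    _ = (((N : ℝ) + 1) * y) ^ a / a.factorial := by
        rw [mul_pow ((N : ℝ) + 1) y a]
        field_simp
    _ ≤ 16 * (((N : ℝ) + 1) * y) / (((a : ℝ) + 1) * √((a : ℝ) + 1)) := hmain
    _ ≤ 16 * (((N : ℝ) + 1) ^ 3 * y) / (((a : ℝ) + 1) * √((a : ℝ) + 1)) := by gcongr
    _ = _ := by rw [div_eq_mul_inv]; ring

open Real in
theorem abs_Wtilde_le_near_zero {a : ℕ} (ha : 1 ≤ a) (N : ℕ) {y : ℝ} (hy : 0 < y)
    (hya : y < (a : ℝ) / (exp 1 * ((N : ℝ) + 1))) :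
    |Wtilde (a + 1) N y| ≤ 8 * π * exp 1 * y ^ ((1 : ℝ) / 2) * ((N : ℝ) + 1) ^ ((3 : ℝ) / 2) *
      ((a : ℝ) + 1) ^ (-(3 : ℝ) / 4) := by
  have ha' : (0 : ℝ) < a := by exact_mod_cast ha
  have hlead := leading_coefficient_le ha N hy hya
  set A := √((N.factorial : ℝ) * ((a + N).factorial : ℝ)) /
    ((N.factorial : ℝ) * (a.factorial : ℝ)) * y ^ ((a : ℝ) / 2) with hA
  have hA0 : 0 ≤ A := by positivity
  have hratio : (N : ℝ) * y / a ≤ 1 := by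
    rw [lt_div_iff₀ (by positivity)] at hya
    rw [div_le_one ha']
    have h1 : (1 : ℝ) ≤ exp 1 := one_le_exp (by norm_num)
    nlinarith [mul_le_mul_of_nonneg_right h1 (by positivity : (0 : ℝ) ≤ y * ((N : ℝ) + 1))]
  have hterm : ∀ k ∈ Finset.range (N + 1),
      √((N.factorial : ℝ) * ((a + N).factorial : ℝ)) /
        ((k.factorial : ℝ) * ((N - k).factorial : ℝ) * ((a + k).factorial : ℝ)) *
        (y ^ ((a : ℝ) / 2) * y ^ k) ≤ A * (((N : ℝ) * y / a) ^ k / k.factorial) := by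
    intro k hk
    have hkN : k ≤ N := Nat.lt_succ_iff.mp (Finset.mem_range.mp hk)
    have h1 : (a.factorial : ℝ) * (a : ℝ) ^ k ≤ (a + k).factorial := by
      have h := (Nat.mul_le_mul_left a.factorial (Nat.pow_le_pow_left a.le_succ k)).trans
        Nat.factorial_mul_pow_le_factorial
      exact_mod_cast h
    have h2 : (N.factorial : ℝ) ≤ (N - k).factorial * (N : ℝ) ^ k := by
      have h := factorial_add_le_factorial_mul_pow (N - k) k
      rw [Nat.sub_add_cancel hkN] at h
      exact_mod_cast h
    have h3 : 1 / (((N - k).factorial : ℝ) * ((a + k).factorial : ℝ)) ≤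
        (N : ℝ) ^ k / (N.factorial * (a.factorial * (a : ℝ) ^ k)) := by
      rw [div_le_div_iff₀ (by positivity) (by positivity), one_mul]
      calc (N.factorial : ℝ) * (a.factorial * (a : ℝ) ^ k)
          ≤ ((N - k).factorial * (N : ℝ) ^ k) * (a + k).factorial := by gcongr
        _ = _ := by ring
    calc _ = √((N.factorial : ℝ) * ((a + N).factorial : ℝ)) / (k.factorial : ℝ) *
          (y ^ ((a : ℝ) / 2) * y ^ k) *
          (1 / (((N - k).factorial : ℝ) * ((a + k).factorial : ℝ))) := by field_simp
      _ ≤ √((N.factorial : ℝ) * ((a + N).factorial : ℝ)) / (k.factorial : ℝ) *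
          (y ^ ((a : ℝ) / 2) * y ^ k) *
          ((N : ℝ) ^ k / (N.factorial * (a.factorial * (a : ℝ) ^ k))) := by gcongr
      _ = _ := by rw [hA, div_pow, mul_pow]; field_simp
  have hsum : ∑ k ∈ Finset.range (N + 1), ((N : ℝ) * y / a) ^ k / k.factorial ≤ exp 1 :=
    (sum_le_exp_of_nonneg (by positivity) _).trans (exp_le_exp.mpr hratio)
  calc _ ≤ 2 * π * exp (-y / 2) *
        ∑ k ∈ Finset.range (N + 1), A * (((N : ℝ) * y / a) ^ k / k.factorial) := by
        exact (abs_Wtilde_le_s3 a N hy).trans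
          (mul_le_mul_of_nonneg_left (Finset.sum_le_sum hterm) (by positivity))
    _ ≤ 2 * π * 1 * (A * exp 1) := by
        rw [← Finset.mul_sum]
        gcongr
        exact exp_le_one_iff.mpr (by linarith)
    _ ≤ 2 * π * 1 * ((4 * y ^ ((1 : ℝ) / 2) * ((N : ℝ) + 1) ^ ((3 : ℝ) / 2) *
        ((a : ℝ) + 1) ^ (-(3 : ℝ) / 4)) * exp 1) := by gcongr
    _ = _ := by ring

open Real in
theorem rpow_le_exp_of_log_sq_lt {M y : ℝ} (hM : 4 < M) (hy : M * (2 * log M ^ 2) < y) :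
    y ^ ((M - 4) / 2) ≤ exp (y / 4) := by
  have hM0 : 0 < M := by linarith
  have hL0 : 0 < log M := log_pos (by linarith)
  have hy0 : 0 < y := lt_of_le_of_lt (by positivity) hy
  obtain ⟨t, ht0, hyt⟩ : ∃ t : ℝ, 0 < t ∧ y = 2 * M * t ^ 2 := by
    refine ⟨√(y / (2 * M)), by positivity, ?_⟩
    rw [sq_sqrt (by positivity)]
    field_simp
  have hLt : log M ≤ t := by
    refine (le_abs_self _).trans (abs_le_of_sq_le_sq ?_ ht0.le)
    rw [hyt] at hy
    nlinarith
  have hlog : log y = log 2 + log M + 2 * log t := by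
    rw [hyt, log_mul (by positivity) (by positivity), log_mul (by norm_num) hM0.ne', log_pow]
    norm_num
  rw [rpow_def_of_pos hy0]
  refine exp_le_exp.mpr ?_
  suffices h : (M - 4) * log y ≤ M * t ^ 2 by rw [hyt] at h ⊢; linarith
  rw [hlog]
  have hl2 := log_two_lt_d9
  have hl2' := log_two_gt_d9
  rcases le_total M 8 with h8 | h8
  · have h1 := log_le_sub_one_of_pos ht0
    have h2 : log 2 + log M + 2 * log t ≤ 2 * t ^ 2 := by nlinarith [sq_nonneg (t - 3 / 4)]
    nlinarith [sq_nonneg t, mul_le_mul_of_nonneg_left h2 (by linarith : 0 ≤ M - 4)]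
  · have h1 : log t ≤ t / 2 + log 2 - 1 := by
      have := log_le_sub_one_of_pos (half_pos ht0)
      rw [log_div ht0.ne' two_ne_zero] at this
      linarith
    have h3 : 3 * log 2 ≤ t := by
      have : log 8 ≤ log M := log_le_log (by norm_num) h8
      rw [show (8 : ℝ) = 2 ^ 3 by norm_num, log_pow] at this
      push_cast at this
      linarith
    have h2 : log 2 + log M + 2 * log t ≤ t ^ 2 := by nlinarith
    nlinarith [sq_nonneg t, mul_le_mul_of_nonneg_left h2 (by linarith : 0 ≤ M - 4)]

open Real in
theorem abs_Wtilde_le_near_infinity (a N : ℕ) {y : ℝ}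
    (hyN : ((a : ℝ) + 4 + 2 * N) * N ≤ y)
    (hyL : ((a : ℝ) + 4 + 2 * N) * (2 * log ((a : ℝ) + 4 + 2 * N) ^ 2) < y) (ha : 1 ≤ a) :
    |Wtilde (a + 1) N y| ≤ 2 * π * ((N : ℝ) + 1) * exp (-y / 4) /
      √((N.factorial : ℝ) * ((a + N).factorial : ℝ)) := by
  have ha' : (1 : ℝ) ≤ a := by exact_mod_cast ha
  have hN0 : (0 : ℝ) ≤ N := N.cast_nonneg
  have hy : 0 < y := lt_of_le_of_lt (by positivity) hyL
  have hexp := rpow_le_exp_of_log_sq_lt (by linarith) hyL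
  have hpow : y ^ ((a : ℝ) / 2) * y ^ N ≤ exp (y / 4) := by
    refine le_of_eq_of_le ?_ hexp
    rw [← rpow_natCast, ← rpow_add hy]
    congr 1
    ring
  set Q := (N.factorial : ℝ) * ((a + N).factorial : ℝ) with hQ
  have hQ0 : 0 < Q := by positivity
  have hterm : ∀ k ∈ Finset.range (N + 1),
      √Q / ((k.factorial : ℝ) * ((N - k).factorial : ℝ) * ((a + k).factorial : ℝ)) *
        (y ^ ((a : ℝ) / 2) * y ^ k) ≤ exp (y / 4) / √Q := by
    intro k hk
    have hkN : k ≤ N := Nat.lt_succ_iff.mp (Finset.mem_range.mp hk)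
    obtain ⟨j, rfl⟩ := Nat.exists_eq_add_of_le hkN
    rw [Nat.add_sub_cancel_left]
    have h1 : ((k + j).factorial : ℝ) ≤ k.factorial * ((k + j : ℕ) : ℝ) ^ j := by
      exact_mod_cast factorial_add_le_factorial_mul_pow k j
    have h2 : ((a + (k + j)).factorial : ℝ) ≤
        (a + k).factorial * ((a : ℝ) + ((k + j : ℕ) : ℝ)) ^ j := by
      have h := factorial_add_le_factorial_mul_pow (a + k) j
      rw [add_assoc] at h
      exact_mod_cast h
    have h3 : (((k + j : ℕ) : ℝ) * ((a : ℝ) + ((k + j : ℕ) : ℝ))) ^ j ≤ y ^ j := by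
      gcongr
      nlinarith
    have hj : (1 : ℝ) ≤ j.factorial := by exact_mod_cast j.factorial_pos
    have h4 : Q ≤ k.factorial * j.factorial * (a + k).factorial * y ^ j := by
      calc Q ≤ (k.factorial * ((k + j : ℕ) : ℝ) ^ j) *
            ((a + k).factorial * ((a : ℝ) + ((k + j : ℕ) : ℝ)) ^ j) := by rw [hQ]; gcongr
        _ = k.factorial * 1 * (a + k).factorial *
            (((k + j : ℕ) : ℝ) * ((a : ℝ) + ((k + j : ℕ) : ℝ))) ^ j := by rw [mul_pow]; ring
        _ ≤ _ := by gcongr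
    rw [le_div_iff₀ (by positivity)]
    calc _ = (√Q * √Q) / ((k.factorial : ℝ) * (j.factorial : ℝ) * ((a + k).factorial : ℝ)) *
          (y ^ ((a : ℝ) / 2) * y ^ k) := by ring
      _ ≤ y ^ j * (y ^ ((a : ℝ) / 2) * y ^ k) := by
          rw [mul_self_sqrt hQ0.le]
          gcongr
          rw [div_le_iff₀ (by positivity)]
          linarith
      _ = y ^ ((a : ℝ) / 2) * y ^ (k + j) := by rw [pow_add]; ring
      _ ≤ _ := hpow
  calc _ ≤ 2 * π * exp (-y / 2) * ∑ _k ∈ Finset.range (N + 1), exp (y / 4) / √Q := by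
        exact (abs_Wtilde_le_s3 a N hy).trans
          (mul_le_mul_of_nonneg_left (Finset.sum_le_sum hterm) (by positivity))
    _ = 2 * π * ((N : ℝ) + 1) * (exp (-y / 2) * exp (y / 4)) / √Q := by
        rw [Finset.sum_const, Finset.card_range, nsmul_eq_mul]
        push_cast
        ring
    _ = _ := by
        rw [← exp_add]
        congr 3
        ring

/-- Decay of `𝒲̃_{d,N}` near zero and infinity. -/
theorem stmt3 :
    ∃ C : ℝ, 0 < C ∧ ∀ (d N : ℕ), 2 ≤ d →
      (∀ y : ℝ, 0 < y → y < ((d : ℝ) - 1) / (Real.exp 1 * ((N : ℝ) + 1)) →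
        |Wtilde d N y| ≤ C * y ^ ((1 : ℝ) / 2) * ((N : ℝ) + 1) ^ ((3 : ℝ) / 2) *
          (d : ℝ) ^ (-(3 : ℝ) / 4)) ∧
      (∀ y : ℝ,
        ((d : ℝ) + 3 + 2 * (N : ℝ)) *
            max (N : ℝ) (2 * Real.log ((d : ℝ) + 3 + 2 * (N : ℝ)) ^ 2) < y →
        |Wtilde d N y| ≤ C * ((N : ℝ) + 1) * Real.exp (-y / 4) /
          Real.sqrt ((Nat.factorial N : ℝ) * (Nat.factorial (d - 1 + N) : ℝ))) := by
  refine ⟨8 * Real.pi * Real.exp 1, by positivity, fun d N hd => ?_⟩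
  obtain ⟨a, rfl⟩ : ∃ a, d = a + 1 := ⟨d - 1, by omega⟩
  have ha : 1 ≤ a := by omega
  rw [Nat.add_sub_cancel]
  push_cast
  refine ⟨fun y hy hya => ?_, fun y hy => ?_⟩
  · rw [add_sub_cancel_right] at hya
    exact abs_Wtilde_le_near_zero ha N hy hya
  · rw [show (a : ℝ) + 1 + 3 + 2 * N = a + 4 + 2 * N by ring] at hy
    have hM : (0 : ℝ) ≤ (a : ℝ) + 4 + 2 * N := by positivity
    have hyN := (mul_le_mul_of_nonneg_left (le_max_left _ _) hM).trans_lt hy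
    have hyL := (mul_le_mul_of_nonneg_left (le_max_right _ _) hM).trans_lt hy
    refine (abs_Wtilde_le_near_infinity a N hyN.le hyL ha).trans ?_
    have hC : 2 * Real.pi ≤ 8 * Real.pi * Real.exp 1 := by
      nlinarith [Real.pi_pos, Real.one_le_exp (zero_le_one' ℝ)]
    gcongr
end

section
/- For all integers d ≥ 2, N ≥ 0 and all real y > 0, π^{−(d−1)/2} √((d−1+N)!/N!) · (y/(4π))^{−(d−1)/2} · ∫_ℝ (1+x²)^{−d/2} ((1+ix)/√(1+x²))^{d+2N} e^{−iyx/2} dx = 2π e^{−y/2} Σ_{k=0}^{N} [(−1)^{N−k} √(N!·(d−1+N)!) / (k!·(N−k)!·(d−1+k)!)] y^{(d−1)/2+k}. -/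
open MeasureTheory

open Complex Set Filter Topology FourierTransform

lemma norm_pow_mul_cexp_neg_mul (n : ℕ) (a : ℂ) {t : ℝ} (ht : 0 ≤ t) :
    ‖(t : ℂ) ^ n * cexp (-(a * t))‖ = t ^ n * Real.exp (-(a.re * t)) := by
  rw [norm_mul, norm_pow, Complex.norm_exp, Complex.norm_of_nonneg ht]
  simp

lemma integrableOn_pow_mul_cexp_neg_mul_Ioi (n : ℕ) {a : ℂ} (ha : 0 < a.re) :
    IntegrableOn (fun t : ℝ => (t : ℂ) ^ n * cexp (-(a * t))) (Ioi 0) := by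
  have h := integrableOn_rpow_mul_exp_neg_mul_rpow (p := 1) (s := n) (b := a.re)
    (by linarith [n.cast_nonneg (α := ℝ)]) one_pos ha
  refine Integrable.mono' h (by fun_prop) ?_
  filter_upwards [ae_restrict_mem measurableSet_Ioi] with t ht
  rw [norm_pow_mul_cexp_neg_mul n a (le_of_lt ht)]
  simp

lemma tendsto_pow_mul_cexp_neg_mul_atTop (n : ℕ) {a : ℂ} (ha : 0 < a.re) :
    Tendsto (fun t : ℝ => (t : ℂ) ^ n * cexp (-(a * t))) atTop (𝓝 0) := by
  rw [tendsto_zero_iff_norm_tendsto_zero]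
  refine (tendsto_rpow_mul_exp_neg_mul_atTop_nhds_zero n a.re ha).congr' ?_
  filter_upwards [eventually_ge_atTop 0] with t ht
  rw [norm_pow_mul_cexp_neg_mul n a ht, Real.rpow_natCast, neg_mul]

lemma hasDerivAt_cexp_neg_mul (a : ℂ) (t : ℝ) :
    HasDerivAt (fun t : ℝ => cexp (-(a * t))) (cexp (-(a * t)) * -a) t := by
  have h := (((hasDerivAt_id (t : ℂ)).const_mul a).neg.cexp).comp_ofReal
  simpa using h

lemma integral_pow_mul_cexp_neg_mul_Ioi (n : ℕ) {a : ℂ} (ha : 0 < a.re) :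
    ∫ t : ℝ in Ioi 0, (t : ℂ) ^ n * cexp (-(a * t)) = n.factorial / a ^ (n + 1) := by
  have ha0 : a ≠ 0 := by rintro rfl; simp at ha
  induction n with
  | zero =>
    have h := integral_exp_mul_complex_Ioi (a := -a) (by simpa using ha) 0
    simpa using h
  | succ n ih =>
    have hd (t : ℝ) : HasDerivAt (fun t : ℝ => (t : ℂ) ^ (n + 1) * cexp (-(a * t)))
        ((n + 1) * ((t : ℂ) ^ n * cexp (-(a * t)))
          - a * ((t : ℂ) ^ (n + 1) * cexp (-(a * t)))) t := by
      have h := (((hasDerivAt_id (t : ℂ)).pow (n + 1)).comp_ofReal).mul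
        (hasDerivAt_cexp_neg_mul a t)
      refine HasDerivAt.congr_deriv (f := fun t : ℝ => (t : ℂ) ^ (n + 1) * cexp (-(a * t))) h ?_
      simp
      ring
    have hn := (integrableOn_pow_mul_cexp_neg_mul_Ioi n ha).const_mul ((n : ℂ) + 1)
    have hs := (integrableOn_pow_mul_cexp_neg_mul_Ioi (n + 1) ha).const_mul a
    have h := integral_Ioi_of_hasDerivAt_of_tendsto' (a := 0) (fun t _ => hd t) (hn.sub hs)
      (tendsto_pow_mul_cexp_neg_mul_atTop (n + 1) ha)
    rw [integral_sub hn hs, integral_const_mul, integral_const_mul, ih] at h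
    rw [Nat.factorial_succ]
    push_cast
    simp only [ofReal_zero, ne_eq, Nat.add_eq_zero_iff, one_ne_zero, and_false, not_false_eq_true,
      zero_pow, zero_mul, sub_zero] at h
    rw [sub_eq_zero] at h
    field_simp at h ⊢
    linear_combination -h

lemma norm_sq_one_sub_mul_I (x : ℝ) : ‖(1 : ℂ) - x * I‖ ^ 2 = 1 + x ^ 2 := by
  rw [← normSq_eq_norm_sq, normSq_apply]
  simp
  ring

lemma one_sub_ofReal_mul_I_ne_zero (x : ℝ) : (1 : ℂ) - x * I ≠ 0 := by
  intro h
  simpa using congrArg re h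

lemma integrable_inv_one_sub_mul_I_pow {n : ℕ} (hn : 2 ≤ n) :
    Integrable (fun x : ℝ => ((1 - (x : ℂ) * I) ^ n)⁻¹) := by
  refine integrable_inv_one_add_sq.mono' ?_ (Eventually.of_forall fun x => ?_)
  · exact Continuous.aestronglyMeasurable (Continuous.inv₀ (by fun_prop)
      fun x => pow_ne_zero _ (one_sub_ofReal_mul_I_ne_zero x))
  · rw [norm_inv, norm_pow, ← norm_sq_one_sub_mul_I]
    have h1 : 1 ≤ ‖(1 : ℂ) - x * I‖ := by
      nlinarith [norm_sq_one_sub_mul_I x, norm_nonneg ((1 : ℂ) - x * I), sq_nonneg x]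
    gcongr

lemma fourier_indicator_pow_mul_cexp_neg (n : ℕ) (ξ : ℝ) :
    𝓕 ((Ioi (0 : ℝ)).indicator fun t : ℝ => (t : ℂ) ^ n * cexp (-t)) ξ =
      n.factorial * ((1 - ((-(2 * Real.pi) * ξ : ℝ) : ℂ) * I) ^ (n + 1))⁻¹ := by
  have h := integral_pow_mul_cexp_neg_mul_Ioi n
    (a := 1 - ((-(2 * Real.pi) * ξ : ℝ) : ℂ) * I) (by simp)
  rw [Real.fourier_real_eq_integral_exp_smul, ← div_eq_mul_inv, ← h,
    ← integral_indicator measurableSet_Ioi]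
  congr 1 with t
  by_cases ht : t ∈ Ioi (0 : ℝ)
  · simp only [indicator_of_mem ht, smul_eq_mul]
    rw [mul_left_comm, ← Complex.exp_add]
    congr 2
    push_cast
    ring
  · simp [indicator_of_notMem ht]

lemma integral_inv_one_sub_mul_I_pow_mul_cexp {n : ℕ} (hn : 1 ≤ n) {v : ℝ} (hv : 0 < v) :
    ∫ x : ℝ, ((1 - (x : ℂ) * I) ^ (n + 1))⁻¹ * cexp (-(I * v * x)) =
      2 * Real.pi * v ^ n * cexp (-v) / n.factorial := by
  have hpi : -(2 * Real.pi) ≠ 0 := by simp [Real.pi_ne_zero]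
  set g : ℝ → ℂ := (Ioi (0 : ℝ)).indicator fun t : ℝ => (t : ℂ) ^ n * cexp (-t) with hg
  have hgi : Integrable g := by
    rw [hg, integrable_indicator_iff measurableSet_Ioi]
    simpa using integrableOn_pow_mul_cexp_neg_mul_Ioi n (a := 1) (by simp)
  have hF : 𝓕 g = fun ξ : ℝ =>
      n.factorial * ((1 - ((-(2 * Real.pi) * ξ : ℝ) : ℂ) * I) ^ (n + 1))⁻¹ :=
    funext (fourier_indicator_pow_mul_cexp_neg n)
  have hFi : Integrable (𝓕 g) := by
    rw [hF]
    exact ((integrable_inv_one_sub_mul_I_pow (by omega : 2 ≤ n + 1)).comp_mul_left'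
      hpi).const_mul _
  have hc : ContinuousAt g v := by
    refine ContinuousAt.congr (f := fun t : ℝ => (t : ℂ) ^ n * cexp (-t))
      (by fun_prop) ?_
    filter_upwards [Ioi_mem_nhds hv] with t ht
    rw [hg, indicator_of_mem ht]
  have key := hgi.fourierInv_fourier_eq hFi hc
  have hgv : g v = (v : ℂ) ^ n * cexp (-v) := by rw [hg, indicator_of_mem (mem_Ioi.2 hv)]
  have hsub := Measure.integral_comp_mul_left
    (fun x : ℝ => ((1 - (x : ℂ) * I) ^ (n + 1))⁻¹ * cexp (-(I * v * x))) (-(2 * Real.pi))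
  have hinv : 𝓕⁻ (𝓕 g) v = n.factorial * ∫ ξ : ℝ,
      ((1 - ((-(2 * Real.pi) * ξ : ℝ) : ℂ) * I) ^ (n + 1))⁻¹ *
        cexp (-(I * v * (-(2 * Real.pi) * ξ : ℝ))) := by
    rw [Real.fourierInv_eq', ← integral_const_mul, hF]
    congr 1 with ξ
    rw [smul_eq_mul, mul_comm, mul_assoc]
    congr 3
    simp
    ring
  rw [hinv, hsub, hgv, abs_inv, abs_neg, abs_of_pos Real.two_pi_pos, real_smul] at key
  have hf : (n.factorial : ℂ) ≠ 0 := by exact_mod_cast n.factorial_ne_zero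
  have hpi' : (Real.pi : ℂ) ≠ 0 := by exact_mod_cast Real.pi_ne_zero
  generalize (∫ x : ℝ, ((1 - (x : ℂ) * I) ^ (n + 1))⁻¹ * cexp (-(I * v * x))) = J at key ⊢
  push_cast at key
  field_simp at key ⊢
  linear_combination key

lemma jacquet_integrand_eq (d N : ℕ) (x : ℝ) :
    (((1 + x ^ 2) ^ (-(d : ℝ) / 2) : ℝ) : ℂ) *
        ((1 + (x : ℂ) * I) / ((Real.sqrt (1 + x ^ 2) : ℝ) : ℂ)) ^ (d + 2 * N) =
      ∑ k ∈ Finset.range (N + 1), (N.choose k * 2 ^ k * (-1) ^ (N - k)) *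
        ((1 - (x : ℂ) * I) ^ (d + k))⁻¹ := by
  have hp : 0 < 1 + x ^ 2 := by positivity
  set s : ℝ := Real.sqrt (1 + x ^ 2) with hs
  have hs0 : (s : ℂ) ≠ 0 := by exact_mod_cast (Real.sqrt_pos.2 hp).ne'
  have hd : (1 + x ^ 2) ^ (-(d : ℝ) / 2) = (s ^ d)⁻¹ := by
    rw [hs, Real.sqrt_eq_rpow, ← Real.rpow_natCast _ d, ← Real.rpow_mul hp.le, ← Real.rpow_neg hp.le]
    congr 1
    ring
  have hss : (s : ℂ) ^ 2 = (1 + x * I) * (1 - x * I) := by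
    rw [← ofReal_pow, hs, Real.sq_sqrt hp.le]
    push_cast
    linear_combination (x : ℂ) ^ 2 * I_sq
  have hm := one_sub_ofReal_mul_I_ne_zero x
  have hq : (1 : ℂ) + x * I ≠ 0 := by
    intro h
    rw [h] at hss
    simp [hs0] at hss
  have hbin : (1 + (x : ℂ) * I) ^ N = ∑ k ∈ Finset.range (N + 1),
      (2 : ℂ) ^ k * (-(1 - (x : ℂ) * I)) ^ (N - k) * N.choose k := by
    rw [← add_pow]
    ring
  have hl : (((1 + x ^ 2) ^ (-(d : ℝ) / 2) : ℝ) : ℂ) * ((1 + (x : ℂ) * I) / (s : ℂ)) ^ (d + 2 * N)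
      = (1 + (x : ℂ) * I) ^ N * ((1 - (x : ℂ) * I) ^ (d + N))⁻¹ := by
    have hpow : (s : ℂ) ^ d * (s : ℂ) ^ (d + 2 * N) =
        ((1 + x * I) * (1 - x * I)) ^ (d + N) := by
      rw [← hss]
      ring
    rw [hd, div_pow]
    push_cast
    rw [← div_eq_inv_mul, div_div, mul_comm _ ((s : ℂ) ^ d), hpow, ← div_eq_mul_inv,
      div_eq_div_iff (pow_ne_zero _ (mul_ne_zero hq hm)) (pow_ne_zero _ hm), mul_pow]
    ring
  rw [hl, hbin, Finset.sum_mul]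
  refine Finset.sum_congr rfl fun k hk => ?_
  have hkN : k ≤ N := Nat.lt_succ_iff.1 (Finset.mem_range.1 hk)
  have hsplit : (1 - (x : ℂ) * I) ^ (d + N) =
      (1 - (x : ℂ) * I) ^ (d + k) * (1 - (x : ℂ) * I) ^ (N - k) := by
    rw [← pow_add]
    congr 1
    omega
  rw [hsplit, neg_pow]
  field_simp

lemma jacquet_integral_eq_sum {d : ℕ} (hd : 2 ≤ d) (N : ℕ) {y : ℝ} (hy : 0 < y) :
    ∫ x : ℝ, (((1 + x ^ 2) ^ (-(d : ℝ) / 2) : ℝ) : ℂ) *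
        ((1 + (x : ℂ) * I) / ((Real.sqrt (1 + x ^ 2) : ℝ) : ℂ)) ^ (d + 2 * N) *
        cexp (-(I * (y : ℂ) * (x : ℂ)) / 2) =
      ((∑ k ∈ Finset.range (N + 1), (N.choose k * 2 ^ k * (-1) ^ (N - k)) *
        (2 * Real.pi * (y / 2) ^ (d - 1 + k) * Real.exp (-y / 2) /
          (d - 1 + k).factorial) : ℝ) : ℂ) := by
  have hint (k : ℕ) : Integrable fun x : ℝ =>
      ((1 - (x : ℂ) * I) ^ (d + k))⁻¹ * cexp (-(I * (y : ℂ) * (x : ℂ)) / 2) := by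
    refine (integrable_inv_one_sub_mul_I_pow (by omega : 2 ≤ d + k)).mul_bdd (c := 1)
      (by fun_prop) (Eventually.of_forall fun x => ?_)
    rw [Complex.norm_exp]
    simp
  simp_rw [jacquet_integrand_eq, Finset.sum_mul, mul_assoc _ (_⁻¹)]
  rw [integral_finsetSum _ fun k _ => (hint k).const_mul _]
  push_cast
  refine Finset.sum_congr rfl fun k _ => ?_
  rw [integral_const_mul]
  congr 1
  have h := integral_inv_one_sub_mul_I_pow_mul_cexp (n := d - 1 + k) (by omega) (half_pos hy)
  rw [show d - 1 + k + 1 = d + k by omega] at h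
  push_cast at h
  rw [neg_div, ← h]
  congr 1 with x
  congr 2
  ring

/-- The normalized Jacquet integral for the GL(2) Whittaker function equals the finite sum
`𝒲̃_{d,N}(y)`. -/
theorem stmt4 (d N : ℕ) (hd : 2 ≤ d) (y : ℝ) (hy : 0 < y) :
    ((Real.pi ^ (-(((d : ℝ) - 1) / 2)) *
        Real.sqrt ((Nat.factorial (d - 1 + N) : ℝ) / (Nat.factorial N : ℝ)) *
        (y / (4 * Real.pi)) ^ (-(((d : ℝ) - 1) / 2)) : ℝ) : ℂ) *
      (∫ x : ℝ,
        (((1 + x ^ 2) ^ (-(d : ℝ) / 2) : ℝ) : ℂ) *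
          ((1 + (x : ℂ) * Complex.I) / ((Real.sqrt (1 + x ^ 2) : ℝ) : ℂ)) ^ (d + 2 * N) *
          Complex.exp (-(Complex.I * (y : ℂ) * (x : ℂ)) / 2)) =
    ((Wtilde d N y : ℝ) : ℂ) := by
  rw [jacquet_integral_eq_sum hd N hy, ← ofReal_mul, Wtilde]
  congr 1
  rw [Finset.mul_sum, Finset.mul_sum]
  refine Finset.sum_congr rfl fun k hk => ?_
  have hkN : k ≤ N := Nat.lt_succ_iff.1 (Finset.mem_range.1 hk)
  have hpi := Real.pi_pos
  have hpow : Real.pi ^ (-(((d : ℝ) - 1) / 2)) * (y / (4 * Real.pi)) ^ (-(((d : ℝ) - 1) / 2)) *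
      (2 ^ k * (y / 2) ^ (d - 1 + k)) = y ^ (((d : ℝ) - 1) / 2 + (k : ℝ)) := by
    obtain ⟨e, rfl⟩ : ∃ e, d = e + 1 := ⟨d - 1, by omega⟩
    have h4 : (2 : ℝ) ^ (e : ℝ) = 4 ^ ((e : ℝ) / 2) := by
      rw [show (4 : ℝ) = 2 ^ (2 : ℝ) by norm_num, ← Real.rpow_mul (by norm_num)]
      congr 1
      ring
    have hye : y ^ (e : ℝ) = y ^ ((e : ℝ) / 2) * y ^ ((e : ℝ) / 2) := by
      rw [← Real.rpow_add hy]
      congr 1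
      ring
    rw [Real.rpow_natCast] at h4 hye
    simp only [Nat.cast_add, Nat.cast_one, add_sub_cancel_right, Nat.add_sub_cancel]
    rw [← Real.mul_rpow hpi.le (by positivity),
      show Real.pi * (y / (4 * Real.pi)) = y / 4 by field_simp,
      Real.rpow_neg (by positivity), Real.div_rpow hy.le (by norm_num), ← h4,
      Real.rpow_add hy, Real.rpow_natCast, pow_add, div_pow, div_pow, hye]
    have : 0 < y ^ ((e : ℝ) / 2) := by positivity
    field_simp
  have hsqrt : Real.sqrt ((Nat.factorial (d - 1 + N) : ℝ) / (Nat.factorial N : ℝ)) *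
      (Nat.factorial N : ℝ) =
      Real.sqrt ((Nat.factorial N : ℝ) * (Nat.factorial (d - 1 + N) : ℝ)) := by
    have hN : (0 : ℝ) < N.factorial := by exact_mod_cast N.factorial_pos
    symm
    rw [Real.sqrt_eq_iff_mul_self_eq (by positivity) (by positivity), mul_mul_mul_comm,
      Real.mul_self_sqrt (by positivity)]
    field_simp
  rw [← hpow, ← hsqrt, Nat.cast_choose ℝ hkN]
  ring
end

section
/- For all integers d ≥ 2, N ≥ 1 and all s ∈ ℂ with Re(s) > −(d−1)/2: 𝒲̂_{d,N+1}(s) = √(N(d+N−1)/((N+1)(d+N))) · 𝒲̂_{d,N−1}(s) + ((2s−1)/√((N+1)(d+N))) · 𝒲̂_{d,N}(s). Moreover 𝒲̂_{d,1}(s) = ((2s−1)/√d) · 𝒲̂_{d,0}(s). -/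
open MeasureTheory

/-- The Mellin transform `𝒲̂_{d,N}(s) = ∫_0^∞ 𝒲̃_{d,N}(y) y^{s−1} dy`. -/
noncomputable def WhatM (d N : ℕ) (s : ℂ) : ℂ :=
  ∫ y in Set.Ioi (0 : ℝ), ((Wtilde d N y : ℝ) : ℂ) * (y : ℂ) ^ (s - 1)

theorem integrableOn_cpow_mul_exp_neg_mul_Ioi {a : ℂ} (ha : 0 < a.re) {r : ℝ} (hr : 0 < r) :
    IntegrableOn (fun t : ℝ => (t : ℂ) ^ (a - 1) * Complex.exp (-((r : ℂ) * t)))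
      (Set.Ioi 0) := by
  have h := integrableOn_rpow_mul_exp_neg_mul_rpow (s := a.re - 1) (p := 1) (b := r)
    (by linarith) one_pos hr
  refine Integrable.mono' h ?_ ?_
  · refine ContinuousOn.aestronglyMeasurable ?_ measurableSet_Ioi
    refine ContinuousOn.mul ?_ (by fun_prop)
    exact fun t ht => ContinuousAt.continuousWithinAt <|
      (continuousAt_cpow_const (Or.inl (by simpa using ht))).comp
        Complex.continuous_ofReal.continuousAt
  · refine (ae_restrict_iff' measurableSet_Ioi).2 (ae_of_all _ fun t ht => ?_)
    rw [norm_mul, Complex.norm_cpow_eq_rpow_re_of_pos ht, Complex.norm_exp]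
    simp

/-- The Mellin transform of `e^{-y/2}` in closed form. -/
noncomputable def mellinExpHalf (a : ℂ) : ℂ := 2 ^ a * Complex.Gamma a

theorem mellinExpHalf_add_one {a : ℂ} (ha : a ≠ 0) :
    mellinExpHalf (a + 1) = 2 * a * mellinExpHalf a := by
  rw [mellinExpHalf, mellinExpHalf, Complex.Gamma_add_one a ha,
    Complex.cpow_add _ _ two_ne_zero, Complex.cpow_one]
  ring

/-- The alternating binomial sum to which the Mellin transform of `Wtilde` is proportional. -/
noncomputable def alternatingMellinSum (d : ℕ) (a : ℂ) (N : ℕ) : ℂ :=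
  ∑ k ∈ Finset.range (N + 1),
    (-1 : ℂ) ^ (N + k) * (N.choose k : ℂ) / ((d - 1 + k).factorial : ℂ) * mellinExpHalf (a + k)

theorem WhatM_eq (d N : ℕ) (s : ℂ) (hs : -(((d : ℝ) - 1) / 2) < s.re) :
    WhatM d N s = 2 * Real.pi *
      (Real.sqrt ((N.factorial : ℝ) * ((d - 1 + N).factorial : ℝ)) : ℂ) / (N.factorial : ℂ) *
        alternatingMellinSum d (((d : ℂ) - 1) / 2 + s) N := by
  set a : ℂ := ((d : ℂ) - 1) / 2 + s with ha_def
  have hre : a.re = ((d : ℝ) - 1) / 2 + s.re := by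
    have : a = ((((d : ℝ) - 1) / 2 : ℝ) : ℂ) + s := by rw [ha_def]; push_cast; ring
    rw [this, Complex.add_re, Complex.ofReal_re]
  have ha (k : ℕ) : 0 < (a + k).re := by
    rw [Complex.add_re, Complex.natCast_re, hre]
    have : (0 : ℝ) ≤ k := k.cast_nonneg
    linarith
  let c (k : ℕ) : ℂ := 2 * Real.pi *
    (Real.sqrt ((N.factorial : ℝ) * ((d - 1 + N).factorial : ℝ)) : ℂ) / (N.factorial : ℂ) *
    ((-1 : ℂ) ^ (N + k) * (N.choose k : ℂ) / ((d - 1 + k).factorial : ℂ))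
  have key : WhatM d N s = ∫ y in Set.Ioi (0 : ℝ), ∑ k ∈ Finset.range (N + 1),
      c k * ((y : ℂ) ^ (a + k - 1) * Complex.exp (-(((1 / 2 : ℝ) : ℂ) * y))) := by
    refine setIntegral_congr_fun measurableSet_Ioi fun y hy => ?_
    have hy0 : (y : ℂ) ≠ 0 := Complex.ofReal_ne_zero.2 (ne_of_gt hy)
    simp only [Wtilde, Complex.ofReal_mul, Complex.ofReal_sum, Finset.mul_sum, Finset.sum_mul]
    refine Finset.sum_congr rfl fun k hk => ?_
    have hkN : k ≤ N := Nat.lt_succ_iff.1 (Finset.mem_range.1 hk)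
    have hpow : (y : ℂ) ^ (a + k - 1) =
        ((y ^ (((d : ℝ) - 1) / 2 + (k : ℝ)) : ℝ) : ℂ) * (y : ℂ) ^ (s - 1) := by
      rw [Complex.ofReal_cpow (le_of_lt hy), ← Complex.cpow_add _ _ hy0]
      congr 1
      push_cast
      rw [ha_def]
      ring
    have hsign : (-1 : ℂ) ^ (N + k) = (-1) ^ (N - k) := by
      obtain ⟨m, rfl⟩ := Nat.exists_eq_add_of_le hkN
      rw [Nat.add_sub_cancel_left, show k + m + k = 2 * k + m by ring, pow_add, pow_mul]
      simp
    have hexp : Complex.exp (-(((1 / 2 : ℝ) : ℂ) * y)) = ((Real.exp (-y / 2) : ℝ) : ℂ) := by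
      rw [Complex.ofReal_exp]
      congr 1
      push_cast
      ring
    simp only [c]
    rw [hpow, hexp, hsign, Nat.cast_choose ℂ hkN]
    have h1 : (N.factorial : ℂ) ≠ 0 := Nat.cast_ne_zero.2 N.factorial_ne_zero
    push_cast
    field_simp
  have hint (k : ℕ) := integrableOn_cpow_mul_exp_neg_mul_Ioi (ha k) (r := 1 / 2) (by norm_num)
  rw [key, integral_finsetSum _ fun k _ => (hint k).const_mul (c k), alternatingMellinSum,
    Finset.mul_sum]
  refine Finset.sum_congr rfl fun k _ => ?_
  rw [integral_const_mul, Complex.integral_cpow_mul_exp_neg_mul_Ioi (ha k) (by norm_num)]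
  simp only [c, mellinExpHalf]
  norm_num
  ring

theorem alternatingMellinSum_one {d : ℕ} (hd : 1 ≤ d) {a : ℂ} (ha : 0 < a.re) :
    (d : ℂ) * alternatingMellinSum d a 1 = (2 * a - d) * alternatingMellinSum d a 0 := by
  obtain ⟨e, rfl⟩ := Nat.exists_eq_add_of_le' hd
  have ha0 : a ≠ 0 := fun h => by simp [h] at ha
  have h1 : (e.factorial : ℂ) ≠ 0 := Nat.cast_ne_zero.2 e.factorial_ne_zero
  have h2 : (e : ℂ) + 1 ≠ 0 := Nat.cast_add_one_ne_zero e
  simp [alternatingMellinSum, Finset.sum_range_succ, mellinExpHalf_add_one ha0,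
    Nat.factorial_succ]
  field_simp
  ring

theorem choose_three_term (e m j : ℕ) :
    ((m : ℂ) + 2 + e) * ((m + 2).choose (j + 1) : ℂ) =
      (m + 1) * (m.choose (j + 1) : ℂ) + (e + j + 1) * ((m + 1).choose j : ℂ) +
        (2 * j + 3 + e) * ((m + 1).choose (j + 1) : ℂ) := by
  have h1 : ((m + 2).choose (j + 1) : ℂ) = (m + 1).choose j + (m + 1).choose (j + 1) := by
    exact_mod_cast Nat.choose_succ_succ (m + 1) j
  have h2 : ((m : ℂ) + 1) * m.choose j = (m + 1).choose (j + 1) * (j + 1) := by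
    exact_mod_cast Nat.add_one_mul_choose_eq m j
  have h3 : ((m + 1).choose (j + 1) : ℂ) = m.choose j + m.choose (j + 1) := by
    exact_mod_cast Nat.choose_succ_succ m j
  have h4 : ((m : ℂ) + 2) * (m + 1).choose j = (m + 2).choose (j + 1) * (j + 1) := by
    exact_mod_cast Nat.add_one_mul_choose_eq (m + 1) j
  linear_combination (m + 3 + e + j) * h1 + h2 + (m + 1) * h3 + h4

theorem alternatingMellinSum_add_two {d : ℕ} (hd : 1 ≤ d) {a : ℂ} (ha : 0 < a.re) (m : ℕ) :
    ((d : ℂ) + (m + 1)) * alternatingMellinSum d a (m + 2) =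
      (m + 1) * alternatingMellinSum d a m +
        (2 * a - d) * alternatingMellinSum d a (m + 1) := by
  obtain ⟨e, rfl⟩ := Nat.exists_eq_add_of_le' hd
  have hak (k : ℕ) : a + k ≠ 0 := fun h => by
    have h' := congrArg Complex.re h
    rw [Complex.add_re, Complex.natCast_re, Complex.zero_re] at h'
    have : (0 : ℝ) ≤ k := k.cast_nonneg
    linarith
  have hG (k : ℕ) : mellinExpHalf (a + (k + 1 : ℕ)) = 2 * (a + k) * mellinExpHalf (a + k) := by
    rw [← mellinExpHalf_add_one (hak k)]
    push_cast
    rw [add_assoc]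
  let f (N k : ℕ) : ℂ := (-1 : ℂ) ^ (N + k) * (N.choose k : ℂ) / ((e + k).factorial : ℂ) *
    mellinExpHalf (a + k)
  have hS (N M : ℕ) (h : N ≤ M) :
      alternatingMellinSum (e + 1) a N = ∑ k ∈ Finset.range (M + 1), f N k := by
    refine Finset.sum_subset (Finset.range_mono (by lia)) fun k _ hk => ?_
    have : N < k := by simpa using hk
    simp [Nat.choose_eq_zero_of_lt this]
  let g (k : ℕ) : ℂ := (-1 : ℂ) ^ (m + 1 + k) * ((m + 1).choose k : ℂ) /
    ((e + k).factorial : ℂ) * mellinExpHalf (a + (k + 1 : ℕ))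
  have hshift : 2 * a * alternatingMellinSum (e + 1) a (m + 1) =
      ∑ k ∈ Finset.range (m + 2), g k - ∑ k ∈ Finset.range (m + 3), 2 * k * f (m + 1) k := by
    rw [Finset.sum_range_succ (fun k : ℕ => 2 * (k : ℂ) * f (m + 1) k) (m + 2), hS _ _ le_rfl,
      Finset.mul_sum, show f (m + 1) (m + 2) = 0 by simp [f], mul_zero, add_zero,
      ← Finset.sum_sub_distrib]
    refine Finset.sum_congr rfl fun k _ => ?_
    simp only [f, g, hG]
    ring
  have hterm (j : ℕ) : ((e : ℂ) + 1 + (m + 1)) * f (m + 2) (j + 1) =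
      (m + 1) * f m (j + 1) + g j - (2 * ((j + 1 : ℕ) : ℂ) + (e + 1)) * f (m + 1) (j + 1) := by
    have hfac : ((e + j).factorial : ℂ) ≠ 0 := Nat.cast_ne_zero.2 (e + j).factorial_ne_zero
    have hej : (e : ℂ) + j + 1 ≠ 0 := by exact_mod_cast (e + j).succ_ne_zero
    have hfs : ((e + (j + 1)).factorial : ℂ) = (e + j + 1) * (e + j).factorial := by
      rw [← add_assoc, Nat.factorial_succ]
      push_cast
      ring
    simp only [f, g, hfs]
    generalize mellinExpHalf (a + (j + 1 : ℕ)) = G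
    simp only [pow_add, Nat.cast_succ]
    field_simp
    linear_combination -G * choose_three_term e m j
  rw [sub_mul, hshift, hS (m + 2) (m + 2) le_rfl, hS m (m + 2) (by lia),
    hS (m + 1) (m + 2) (by lia)]
  simp only [Finset.sum_range_succ' _ (m + 2), mul_add, Finset.mul_sum]
  have hsum := Finset.sum_congr (rfl : Finset.range (m + 2) = _) fun j _ => hterm j
  have h0 : ((e : ℂ) + 1 + (m + 1)) * f (m + 2) 0 =
      (m + 1) * f m 0 - (e + 1) * f (m + 1) 0 := by
    simp only [f, pow_add, Nat.choose_zero_right]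
    ring
  simp only [Finset.sum_add_distrib, Finset.sum_sub_distrib, add_mul] at hsum ⊢
  simp only [add_mul] at h0
  push_cast at *
  simp only [Finset.sum_add_distrib, add_mul] at hsum ⊢
  linear_combination hsum + h0

/-- Recursion formula for the Mellin transform of the GL(2) Whittaker function. -/
theorem stmt5 (d : ℕ) (hd : 2 ≤ d) (s : ℂ) (hs : -(((d : ℝ) - 1) / 2) < s.re) :
    (∀ N : ℕ, 1 ≤ N →
      WhatM d (N + 1) s =
        ((Real.sqrt ((N : ℝ) * ((d : ℝ) + (N : ℝ) - 1) /
            (((N : ℝ) + 1) * ((d : ℝ) + (N : ℝ)))) : ℝ) : ℂ) * WhatM d (N - 1) s +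
        ((2 * s - 1) / ((Real.sqrt (((N : ℝ) + 1) * ((d : ℝ) + (N : ℝ))) : ℝ) : ℂ)) *
          WhatM d N s) ∧
    WhatM d 1 s = ((2 * s - 1) / ((Real.sqrt (d : ℝ) : ℝ) : ℂ)) * WhatM d 0 s := by
  set a : ℂ := ((d : ℂ) - 1) / 2 + s with ha_def
  have ha : 0 < a.re := by
    have : a = ((((d : ℝ) - 1) / 2 : ℝ) : ℂ) + s := by rw [ha_def]; push_cast; ring
    rw [this, Complex.add_re, Complex.ofReal_re]
    linarith
  have has : 2 * s - 1 = 2 * a - d := by rw [ha_def]; ring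
  have hsq (x : ℝ) (hx : 0 ≤ x) : ((Real.sqrt x : ℝ) : ℂ) ^ 2 = x := by
    rw [← Complex.ofReal_pow, Real.sq_sqrt hx]
  have hne (x : ℝ) (hx : 0 < x) : ((Real.sqrt x : ℝ) : ℂ) ≠ 0 :=
    Complex.ofReal_ne_zero.2 (Real.sqrt_ne_zero'.2 hx)
  have hd1 : 1 ≤ d := by lia
  constructor
  · intro N hN
    obtain ⟨m, rfl⟩ := Nat.exists_eq_add_of_le' hN
    obtain ⟨e, rfl⟩ := Nat.exists_eq_add_of_le' hd1
    have hrec := alternatingMellinSum_add_two hd1 ha m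
    rw [Nat.add_sub_cancel, WhatM_eq _ _ s hs, WhatM_eq _ _ s hs, WhatM_eq _ _ s hs,
      ← ha_def, has]
    have hp : (0 : ℝ) < ((m : ℝ) + 1) * (e + 1 + m) := by positivity
    have hq : (0 : ℝ) < ((m : ℝ) + 2) * (e + 2 + m) := by positivity
    have hr : (0 : ℝ) < (m.factorial : ℝ) * (e + m).factorial := by positivity
    have e1 : ((m + 1).factorial : ℝ) * (e + 1 - 1 + (m + 1)).factorial =
        (m.factorial * (e + m).factorial) * ((m + 1) * (e + 1 + m)) := by
      rw [Nat.add_sub_cancel, ← add_assoc, Nat.factorial_succ, Nat.factorial_succ]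
      push_cast
      ring
    have e2 : ((m + 1 + 1).factorial : ℝ) * (e + 1 - 1 + (m + 1 + 1)).factorial =
        (m.factorial * (e + m).factorial) * ((m + 1) * (e + 1 + m)) *
          ((m + 2) * (e + 2 + m)) := by
      rw [← e1, Nat.add_sub_cancel, ← add_assoc e (m + 1) 1, Nat.factorial_succ (m + 1),
        Nat.factorial_succ (e + (m + 1))]
      push_cast
      ring
    have e3 : ((m + 1 : ℕ) : ℝ) * (((e + 1 : ℕ) : ℝ) + ((m + 1 : ℕ) : ℝ) - 1) /
        ((((m + 1 : ℕ) : ℝ) + 1) * (((e + 1 : ℕ) : ℝ) + ((m + 1 : ℕ) : ℝ))) =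
        ((m + 1) * (e + 1 + m)) / ((m + 2) * (e + 2 + m)) := by
      push_cast
      congr 1 <;> ring
    have e4 : (((m + 1 : ℕ) : ℝ) + 1) * (((e + 1 : ℕ) : ℝ) + ((m + 1 : ℕ) : ℝ)) =
        (m + 2) * (e + 2 + m) := by
      push_cast
      ring
    have hfac : (m.factorial : ℂ) ≠ 0 := Nat.cast_ne_zero.2 m.factorial_ne_zero
    have hm1 : (m : ℂ) + 1 ≠ 0 := Nat.cast_add_one_ne_zero m
    have hm2 : (m : ℂ) + 2 ≠ 0 := by exact_mod_cast (m + 1).succ_ne_zero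
    rw [e1, e2, e3, e4, Real.sqrt_div hp.le, Real.sqrt_mul (mul_pos hr hp).le,
      Real.sqrt_mul hr.le, Nat.add_sub_cancel, Nat.factorial_succ (m + 1), Nat.factorial_succ m]
    have sp := hsq _ hp.le
    have sq := hsq _ hq.le
    have np := hne _ hp
    have nq := hne _ hq
    generalize Real.sqrt (((m : ℝ) + 1) * (e + 1 + m)) = P at *
    generalize Real.sqrt (((m : ℝ) + 2) * (e + 2 + m)) = Q at *
    generalize Real.sqrt ((m.factorial : ℝ) * (e + m).factorial) = R
    clear_value a
    push_cast at *
    rw [show (m : ℂ) + 1 + 1 = m + 2 by ring]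
    rw [show m + 1 + 1 = m + 2 by ring]
    field_simp
    rw [sq]
    linear_combination (R : ℂ) * (m + 2) * hrec
  · rw [WhatM_eq _ _ s hs, WhatM_eq _ _ s hs, ← ha_def, has]
    obtain ⟨e, rfl⟩ := Nat.exists_eq_add_of_le' hd1
    have hrec := alternatingMellinSum_one hd1 ha
    have hp : (0 : ℝ) < ((e + 1 : ℕ) : ℝ) := by positivity
    have hr : (0 : ℝ) < (e.factorial : ℝ) := by positivity
    have e1 : (Nat.factorial 1 : ℝ) * (e + 1 - 1 + 1).factorial =
        e.factorial * ((e + 1 : ℕ) : ℝ) := by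
      rw [Nat.add_sub_cancel, Nat.factorial_succ e]
      push_cast [Nat.factorial_one]
      ring
    rw [e1, Real.sqrt_mul hr.le]
    have sp := hsq _ hp.le
    have np := hne _ hp
    generalize Real.sqrt ((e + 1 : ℕ) : ℝ) = P at *
    clear_value a
    rw [Complex.ofReal_natCast] at sp
    simp only [Nat.factorial_zero, Nat.factorial_one, Nat.add_sub_cancel, Nat.cast_one,
      one_mul, add_zero, div_one, Complex.ofReal_mul]
    generalize Real.sqrt (e.factorial : ℝ) = R
    field_simp
    rw [sp]
    linear_combination (R : ℂ) * hrec
end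

section
/- For every δ > 0 there is a constant C_δ such that for all integers d ≥ 2, N ≥ 0 and all s ∈ ℂ with −1/2+δ ≤ Re(s) ≤ 1/2 and |Im(s)| > (4/π)(5+d+2N)·log²(5+d+2N), one has |𝒲̂_{d,N}(s)| ≤ C_δ · exp(−(π/8)|Im(s)|). -/
open MeasureTheory

/-- Integrability of `t ^ (a - 1) * exp (-r t)` on the positive half-line. -/
lemma integrableOn_cpow_mul_exp_neg_mul {a r : ℂ} (ha : 0 < a.re) (hr : 0 < r.re) :
    IntegrableOn (fun t : ℝ => (t : ℂ) ^ (a - 1) * Complex.exp (-(r * t)))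
      (Set.Ioi (0 : ℝ)) := by
  have hreal : IntegrableOn (fun t : ℝ => t ^ (a.re - 1) * Real.exp (-(r.re * t)))
      (Set.Ioi (0 : ℝ)) := by
    refine Integrable.of_integral_ne_zero ?_
    rw [Real.integral_rpow_mul_exp_neg_mul_Ioi ha hr]
    have := Real.Gamma_pos_of_pos ha
    positivity
  refine Integrable.mono' hreal ?_ ?_
  · refine ContinuousOn.aestronglyMeasurable (fun t ht => ?_) measurableSet_Ioi
    have hslit : (t : ℂ) ∈ Complex.slitPlane := Complex.ofReal_mem_slitPlane.2 ht
    refine ContinuousAt.continuousWithinAt (ContinuousAt.mul ?_ (by fun_prop))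
    exact Complex.continuous_ofReal.continuousAt.cpow continuousAt_const hslit
  · filter_upwards [ae_restrict_mem measurableSet_Ioi] with t ht
    rw [norm_mul, Complex.norm_cpow_eq_rpow_re_of_pos ht, Complex.norm_exp]
    simp

lemma hasDerivAt_integral_cpow_mul_exp_neg_mul {a r : ℂ} (ha : 0 < a.re) (hr : 0 < r.re) :
    HasDerivAt (fun z : ℂ =>
        ∫ t in Set.Ioi (0 : ℝ), (t : ℂ) ^ (a - 1) * Complex.exp (-(z * t)))
      (∫ t in Set.Ioi (0 : ℝ), (t : ℂ) ^ (a - 1) * (Complex.exp (-(r * t)) * (-t))) r := by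
  have key : ∀ z : ℂ, ∀ t ∈ Set.Ioi (0 : ℝ),
      (t : ℂ) ^ (a - 1) * (Complex.exp (-(z * t)) * (-t)) =
        -((t : ℂ) ^ (a + 1 - 1) * Complex.exp (-(z * t))) := by
    intro z t ht
    have ht0 : (t : ℂ) ≠ 0 := by exact_mod_cast (ne_of_gt ht)
    rw [show a + 1 - 1 = (a - 1) + 1 by ring, Complex.cpow_add _ _ ht0, Complex.cpow_one]
    ring
  have ha1 : 0 < (a + 1).re := by simp; linarith
  have hhalf : 0 < ((r.re / 2 : ℝ) : ℂ).re := by rw [Complex.ofReal_re]; linarith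
  have hball : ∀ z ∈ Metric.ball r (r.re / 2), r.re / 2 ≤ z.re := by
    intro z hz
    rw [mem_ball_iff_norm] at hz
    have := (abs_le.1 (Complex.abs_re_le_norm (z - r))).1
    rw [Complex.sub_re] at this
    linarith
  refine (hasDerivAt_integral_of_dominated_loc_of_deriv_le
    (μ := volume.restrict (Set.Ioi (0 : ℝ)))
    (F := fun (z : ℂ) (t : ℝ) => (t : ℂ) ^ (a - 1) * Complex.exp (-(z * t)))
    (F' := fun (z : ℂ) (t : ℝ) => (t : ℂ) ^ (a - 1) * (Complex.exp (-(z * t)) * (-t)))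
    (bound := fun t : ℝ =>
      ‖(t : ℂ) ^ (a + 1 - 1) * Complex.exp (-(((r.re / 2 : ℝ) : ℂ) * t))‖)
    (Metric.ball_mem_nhds r (half_pos hr)) ?_
    (integrableOn_cpow_mul_exp_neg_mul ha hr) ?_ ?_
    (integrableOn_cpow_mul_exp_neg_mul ha1 hhalf).norm ?_).2
  · filter_upwards [Metric.ball_mem_nhds r (half_pos hr)] with z hz
    exact (integrableOn_cpow_mul_exp_neg_mul ha
      ((half_pos hr).trans_le (hball z hz))).aestronglyMeasurable
  · refine (integrableOn_cpow_mul_exp_neg_mul ha1 hr).neg.aestronglyMeasurable.congr ?_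
    filter_upwards [ae_restrict_mem measurableSet_Ioi] with t ht
    exact (key r t ht).symm
  · filter_upwards [ae_restrict_mem measurableSet_Ioi] with t ht z hz
    rw [key z t ht, norm_neg, norm_mul, norm_mul, Complex.norm_exp, Complex.norm_exp]
    refine mul_le_mul_of_nonneg_left (Real.exp_le_exp.2 ?_) (norm_nonneg _)
    have ht' : (0 : ℝ) ≤ t := le_of_lt ht
    simpa using mul_le_mul_of_nonneg_right (hball z hz) ht'
  · refine Filter.Eventually.of_forall fun t z _ => ?_
    have h : HasDerivAt (fun z : ℂ => -(z * t)) (-(t : ℂ)) z := by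
      simpa using! ((hasDerivAt_id z).mul_const (t : ℂ)).neg
    exact h.cexp.const_mul _

/-- Euler's integral along a ray in the right half-plane. -/
lemma integral_cpow_mul_exp_neg_mul_of_re_pos {a r : ℂ} (ha : 0 < a.re) (hr : 0 < r.re) :
    ∫ t in Set.Ioi (0 : ℝ), (t : ℂ) ^ (a - 1) * Complex.exp (-(r * t)) =
      r ^ (-a) * Complex.Gamma a := by
  have hU : IsOpen {z : ℂ | 0 < z.re} := isOpen_lt continuous_const Complex.continuous_re
  have hf : AnalyticOnNhd ℂ (fun z : ℂ =>
      ∫ t in Set.Ioi (0 : ℝ), (t : ℂ) ^ (a - 1) * Complex.exp (-(z * t))) {z : ℂ | 0 < z.re} :=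
    DifferentiableOn.analyticOnNhd (fun z hz =>
      (hasDerivAt_integral_cpow_mul_exp_neg_mul ha hz).differentiableAt.differentiableWithinAt) hU
  have hg : AnalyticOnNhd ℂ (fun z : ℂ => z ^ (-a) * Complex.Gamma a) {z : ℂ | 0 < z.re} := by
    refine DifferentiableOn.analyticOnNhd (fun z hz => ?_) hU
    refine DifferentiableAt.differentiableWithinAt (DifferentiableAt.mul_const ?_ _)
    exact differentiableAt_id.cpow_const (Or.inl hz)
  have hconv : Convex ℝ {z : ℂ | 0 < z.re} := convex_halfSpace_re_gt 0
  refine hf.eqOn_of_preconnected_of_frequently_eq hg hconv.isPreconnected (z₀ := 1)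
    (by simp) ?_ hr
  have hlim : Filter.Tendsto (fun x : ℝ => (x : ℂ)) (nhdsWithin 1 {1}ᶜ) (nhdsWithin 1 {1}ᶜ) := by
    refine tendsto_nhdsWithin_iff.2 ⟨?_, ?_⟩
    · exact (Complex.continuous_ofReal.tendsto' 1 1 (by simp)).mono_left nhdsWithin_le_nhds
    · filter_upwards [self_mem_nhdsWithin] with x hx
      simpa using hx
  refine hlim.frequently (Filter.Eventually.frequently ?_)
  filter_upwards [nhdsWithin_le_nhds (Ioi_mem_nhds (zero_lt_one' ℝ))] with x hx
  rw [Complex.integral_cpow_mul_exp_neg_mul_Ioi ha hx, Complex.cpow_neg, one_div,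
    Complex.inv_cpow _ _ (by rw [Complex.arg_ofReal_of_nonneg (le_of_lt hx)]; exact Real.pi_pos.ne)]

/-- The vertical decay of the Gamma function obtained by rotating Euler's integral by the angle
`π / 3`. -/
lemma norm_Gamma_le_exp_neg_pi_div_three (a : ℂ) (ha : 0 < a.re) :
    ‖Complex.Gamma a‖ ≤
      Real.exp (-(Real.pi / 3) * |a.im|) * ((2 : ℝ) ^ a.re * Real.Gamma a.re) := by
  obtain ⟨θ, hθ, him⟩ : ∃ θ : ℝ, (θ = Real.pi / 3 ∨ θ = -(Real.pi / 3)) ∧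
      θ * a.im = Real.pi / 3 * |a.im| := by
    rcases le_total 0 a.im with h | h
    · exact ⟨_, Or.inl rfl, by rw [abs_of_nonneg h]⟩
    · exact ⟨_, Or.inr rfl, by rw [abs_of_nonpos h]; ring⟩
  have hpi := Real.pi_pos
  have hcos : Real.cos θ = 1 / 2 := by
    rcases hθ with rfl | rfl <;> simp [Real.cos_pi_div_three]
  have hθ1 : |θ| < Real.pi := by
    rw [abs_lt]
    rcases hθ with rfl | rfl <;> constructor <;> linarith
  rw [abs_lt] at hθ1
  set r : ℂ := Complex.exp (θ * Complex.I) with hr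
  have hre : r.re = 1 / 2 := by rw [hr, Complex.exp_ofReal_mul_I_re, hcos]
  have hmain := integral_cpow_mul_exp_neg_mul_of_re_pos (a := a) (r := r) ha
    (by rw [hre]; norm_num)
  have hpow : ‖r ^ (-a)‖ = Real.exp (Real.pi / 3 * |a.im|) := by
    rw [hr, Complex.cpow_def_of_ne_zero (Complex.exp_ne_zero _), Complex.log_exp
      (by simp; linarith) (by simp; linarith), Complex.norm_exp, ← him]
    congr 1
    simp
  have hbound : ‖∫ t : ℝ in Set.Ioi 0, (t : ℂ) ^ (a - 1) * Complex.exp (-(r * t))‖ ≤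
      (2 : ℝ) ^ a.re * Real.Gamma a.re := by
    have h2 := Real.integral_rpow_mul_exp_neg_mul_Ioi ha (r := 1 / 2) (by norm_num)
    rw [one_div_one_div] at h2
    rw [← h2]
    refine (norm_integral_le_integral_norm _).trans_eq ?_
    refine setIntegral_congr_fun measurableSet_Ioi fun t ht => ?_
    simp only [norm_mul, Complex.norm_cpow_eq_rpow_re_of_pos ht, Complex.norm_exp]
    simp [hre]
  rw [hmain, norm_mul, hpow] at hbound
  rw [neg_mul, Real.exp_neg]
  rw [inv_mul_eq_div, le_div_iff₀ (Real.exp_pos _), mul_comm]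
  exact hbound

lemma integral_exp_neg_half_mul_cpow (a : ℂ) (ha : 0 < a.re) :
    ∫ y in Set.Ioi (0 : ℝ), (y : ℂ) ^ (a - 1) * Complex.exp (-(1 / 2 * y)) =
      2 ^ a * Complex.Gamma a := by
  simpa using Complex.integral_cpow_mul_exp_neg_mul_Ioi ha (r := 1 / 2) (by norm_num)

/-- The coefficient of `y ^ ((d - 1) / 2 + k)` in `Wtilde`, without the factor `2π`. -/
noncomputable def whittakerCoeff (d N k : ℕ) : ℝ :=
  (-1 : ℝ) ^ (N - k) *
      Real.sqrt ((Nat.factorial N : ℝ) * (Nat.factorial (d - 1 + N) : ℝ)) /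
    ((Nat.factorial k : ℝ) * (Nat.factorial (N - k) : ℝ) *
      (Nat.factorial (d - 1 + k) : ℝ))

/-- The Mellin transform as a finite sum of Gamma values. -/
lemma WhatM_eq_sum (d N : ℕ) (s : ℂ) (hs : -(((d : ℝ) - 1) / 2) < s.re) :
    WhatM d N s = ∑ k ∈ Finset.range (N + 1), (2 * Real.pi * whittakerCoeff d N k : ℂ) *
      (2 ^ (((d : ℂ) - 1) / 2 + k + s) * Complex.Gamma (((d : ℂ) - 1) / 2 + k + s)) := by
  have hre : ∀ k : ℕ, 0 < (((d : ℂ) - 1) / 2 + k + s).re := by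
    intro k
    have hk : (((d : ℂ) - 1) / 2 + k + s).re = ((d : ℝ) - 1) / 2 + k + s.re := by simp
    rw [hk]
    have : (0 : ℝ) ≤ k := k.cast_nonneg
    linarith
  simp_rw [← integral_exp_neg_half_mul_cpow _ (hre _), ← integral_const_mul]
  rw [← integral_finsetSum _ fun k _ =>
    (integrableOn_cpow_mul_exp_neg_mul (hre k) (by norm_num)).const_mul _]
  refine setIntegral_congr_fun measurableSet_Ioi fun y hy => ?_
  have hy0 : (y : ℂ) ≠ 0 := by exact_mod_cast (ne_of_gt hy)
  simp only [Wtilde, Complex.ofReal_mul, Complex.ofReal_sum, Finset.mul_sum, Finset.sum_mul]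
  refine Finset.sum_congr rfl fun k _ => ?_
  rw [Complex.ofReal_cpow (le_of_lt hy), add_sub_assoc, Complex.cpow_add _ _ hy0]
  simp only [whittakerCoeff]
  push_cast
  rw [show (-(y : ℂ) / 2) = -(1 / 2 * y) by ring]
  ring

lemma abs_whittakerCoeff_mul_factorial_le (d N k : ℕ) :
    |whittakerCoeff d N k| * (Nat.factorial (d - 1 + k) : ℝ) ≤
      Real.sqrt ((Nat.factorial N : ℝ) * (Nat.factorial (d - 1 + N) : ℝ)) := by
  have h1 : (1 : ℝ) ≤ (Nat.factorial k : ℝ) := by exact_mod_cast k.factorial_pos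
  have h2 : (1 : ℝ) ≤ (Nat.factorial (N - k) : ℝ) := by exact_mod_cast (N - k).factorial_pos
  have h3 : (0 : ℝ) < (Nat.factorial (d - 1 + k) : ℝ) := by
    exact_mod_cast (d - 1 + k).factorial_pos
  have h12 : (1 : ℝ) ≤ (Nat.factorial k : ℝ) * (Nat.factorial (N - k) : ℝ) := by nlinarith
  rw [whittakerCoeff, abs_div, abs_mul, abs_pow, abs_neg, abs_one, one_pow, one_mul,
    abs_of_nonneg (Real.sqrt_nonneg _), abs_of_pos (by positivity), div_mul_eq_div_div,
    div_mul_cancel₀ _ h3.ne']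
  exact div_le_self (Real.sqrt_nonneg _) h12

lemma Gamma_le_mul_factorial {δ x : ℝ} (hδ : 0 < δ) (hx : δ ≤ x) (n : ℕ) (hn : x ≤ n + 1) :
    Real.Gamma x ≤ (Real.Gamma δ + 1) * (Nat.factorial n : ℝ) := by
  have hG := Real.Gamma_pos_of_pos hδ
  have hf : (1 : ℝ) ≤ (Nat.factorial n : ℝ) := by exact_mod_cast n.factorial_pos
  have h := Real.convexOn_Gamma.le_max_of_mem_Icc (x := δ) (y := (n : ℝ) + 1) hδ
    (by simp; positivity) (z := x) ⟨hx, hn⟩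
  rw [Real.Gamma_nat_eq_factorial] at h
  refine h.trans (max_le ?_ ?_) <;> nlinarith

lemma succ_mul_four_pow_mul_sqrt_factorial_le (d N : ℕ) (hd : 2 ≤ d) :
    ((N : ℝ) + 1) * (4 ^ (d + N) *
        Real.sqrt ((Nat.factorial N : ℝ) * (Nat.factorial (d - 1 + N) : ℝ))) ≤
      Real.exp (5 / 6 * ((5 + (d : ℝ) + 2 * (N : ℝ)) *
        Real.log (5 + (d : ℝ) + 2 * (N : ℝ)) ^ 2)) := by
  obtain ⟨M, hM⟩ : ∃ M : ℕ, M = 5 + d + 2 * N := ⟨_, rfl⟩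
  have hMr : 5 + (d : ℝ) + 2 * (N : ℝ) = M := by rw [hM]; push_cast; ring
  have hM7 : (7 : ℝ) ≤ M := by exact_mod_cast (by omega : 7 ≤ M)
  have hM0 : (0 : ℝ) < M := by linarith
  rw [hMr]
  have hlog : 9 / 5 ≤ Real.log M := by
    rw [Real.le_log_iff_exp_le hM0]
    refine le_trans ?_ hM7
    refine le_of_pow_le_pow_left₀ (n := 5) (by norm_num) (by norm_num) ?_
    rw [← Real.exp_nat_mul, show ((5 : ℕ) : ℝ) * (9 / 5) = (9 : ℕ) * 1 by norm_num,
      Real.exp_nat_mul]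
    calc Real.exp 1 ^ 9 ≤ 2.72 ^ 9 := by
          gcongr
          linarith [Real.exp_one_lt_d9]
      _ ≤ 7 ^ 5 := by norm_num
  have hfour : ((N : ℝ) + 1) * 4 ^ (d + N) ≤ (M : ℝ) ^ M := by
    have h1 : N + 1 ≤ 4 ^ N := Nat.lt_pow_self (by norm_num)
    have h2 : (N + 1) * 4 ^ (d + N) ≤ M ^ M := by
      calc (N + 1) * 4 ^ (d + N) ≤ 4 ^ N * 4 ^ (d + N) := by gcongr
        _ = 4 ^ (N + (d + N)) := (pow_add _ _ _).symm
        _ ≤ 4 ^ M := Nat.pow_le_pow_right (by norm_num) (by omega)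
        _ ≤ M ^ M := Nat.pow_le_pow_left (by omega) _
    exact_mod_cast h2
  have hfac : (Nat.factorial N : ℝ) * (Nat.factorial (d - 1 + N) : ℝ) ≤ (M : ℝ) ^ M := by
    have h : Nat.factorial N * Nat.factorial (d - 1 + N) ≤ M ^ M :=
      calc Nat.factorial N * Nat.factorial (d - 1 + N) ≤ Nat.factorial (N + (d - 1 + N)) :=
            Nat.le_of_dvd (Nat.factorial_pos _) (Nat.factorial_mul_factorial_dvd_factorial_add _ _)
        _ ≤ Nat.factorial M := Nat.factorial_le (by omega)
        _ ≤ M ^ M := Nat.factorial_le_pow M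
    exact_mod_cast h
  have hexp : (M : ℝ) ^ M = Real.exp (M * Real.log M) := by
    rw [Real.exp_nat_mul, Real.exp_log hM0]
  rw [hexp] at hfour hfac
  rw [← mul_assoc]
  calc _ ≤ Real.exp (M * Real.log M) * Real.exp (M * Real.log M / 2) := by
        rw [Real.exp_half]
        gcongr
    _ ≤ _ := by
        rw [← Real.exp_add, Real.exp_le_exp]
        have : 0 ≤ (M : ℝ) * Real.log M * (Real.log M - 9 / 5) :=
          mul_nonneg (mul_nonneg hM0.le (by linarith)) (by linarith)
        nlinarith

/-- Exponential decay of the Mellin transform of the GL(2) Whittaker function for large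
imaginary part. -/
theorem stmt6 (δ : ℝ) (hδ : 0 < δ) :
    ∃ C : ℝ, 0 < C ∧ ∀ (d N : ℕ) (s : ℂ), 2 ≤ d →
      -(1 / 2) + δ ≤ s.re → s.re ≤ 1 / 2 →
      (4 / Real.pi) * (5 + (d : ℝ) + 2 * (N : ℝ)) *
          Real.log (5 + (d : ℝ) + 2 * (N : ℝ)) ^ 2 < |s.im| →
      ‖WhatM d N s‖ ≤ C * Real.exp (-(Real.pi / 8) * |s.im|) := by
  have hG := Real.Gamma_pos_of_pos hδ
  have hpi := Real.pi_pos
  refine ⟨2 * Real.pi * (Real.Gamma δ + 1), by positivity, fun d N s hd hs1 hs2 ht => ?_⟩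
  have hd' : (2 : ℝ) ≤ d := by exact_mod_cast hd
  have hN0 : (0 : ℝ) ≤ N := N.cast_nonneg
  rw [WhatM_eq_sum d N s (by linarith)]
  set Q := Real.sqrt ((Nat.factorial N : ℝ) * (Nat.factorial (d - 1 + N) : ℝ)) with hQ
  have hQ0 : 0 ≤ Q := Real.sqrt_nonneg _
  have hterm : ∀ k ∈ Finset.range (N + 1), ‖(2 * Real.pi * whittakerCoeff d N k : ℂ) *
      (2 ^ (((d : ℂ) - 1) / 2 + k + s) * Complex.Gamma (((d : ℂ) - 1) / 2 + k + s))‖ ≤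
      2 * Real.pi * (Real.Gamma δ + 1) * Real.exp (-(Real.pi / 3) * |s.im|) *
        (4 ^ (d + N) * Q) := by
    intro k hk
    have hkN : (k : ℝ) ≤ N := by exact_mod_cast Finset.mem_range_succ_iff.1 hk
    have hk0 : (0 : ℝ) ≤ k := k.cast_nonneg
    set a : ℂ := ((d : ℂ) - 1) / 2 + k + s with ha
    have hare : a.re = ((d : ℝ) - 1) / 2 + k + s.re := by simp [ha]
    have haim : a.im = s.im := by simp [ha]
    have hδa : δ ≤ a.re := by rw [hare]; linarith
    have hΓ := norm_Gamma_le_exp_neg_pi_div_three a (hδ.trans_le hδa)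
    rw [haim] at hΓ
    have hcast : ((d - 1 + k : ℕ) : ℝ) = d - 1 + k := by
      rw [Nat.cast_add, Nat.cast_sub (by omega), Nat.cast_one]
    have hΓ' := Gamma_le_mul_factorial hδ hδa (d - 1 + k) (by rw [hcast, hare]; linarith)
    have hfour : (2 : ℝ) ^ a.re * 2 ^ a.re ≤ 4 ^ (d + N) := by
      rw [← Real.mul_rpow (by norm_num) (by norm_num), ← Real.rpow_natCast]
      norm_num1
      refine Real.rpow_le_rpow_of_exponent_le (by norm_num) ?_
      rw [hare]; push_cast; linarith
    have hcoeff := abs_whittakerCoeff_mul_factorial_le d N k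
    rw [← hQ] at hcoeff
    have h2 : ‖(2 : ℂ) ^ a‖ = (2 : ℝ) ^ a.re := by
      simpa using Complex.norm_cpow_eq_rpow_re_of_pos (x := 2) (by norm_num) a
    rw [norm_mul, norm_mul, norm_mul, norm_mul, h2, Complex.norm_real, Complex.norm_real,
      Real.norm_eq_abs, Real.norm_eq_abs, abs_of_pos hpi, Complex.norm_ofNat]
    calc 2 * Real.pi * |whittakerCoeff d N k| * ((2 : ℝ) ^ a.re * ‖Complex.Gamma a‖)
        ≤ 2 * Real.pi * |whittakerCoeff d N k| * ((2 : ℝ) ^ a.re *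
          (Real.exp (-(Real.pi / 3) * |s.im|) * ((2 : ℝ) ^ a.re *
            ((Real.Gamma δ + 1) * (Nat.factorial (d - 1 + k) : ℝ))))) := by
          gcongr
          exact hΓ.trans (by gcongr)
      _ = 2 * Real.pi * (Real.Gamma δ + 1) * Real.exp (-(Real.pi / 3) * |s.im|) *
          (((2 : ℝ) ^ a.re * 2 ^ a.re) *
            (|whittakerCoeff d N k| * (Nat.factorial (d - 1 + k) : ℝ))) := by ring
      _ ≤ _ := by gcongr
  refine (norm_sum_le_of_le _ hterm).trans ?_
  rw [Finset.sum_const, Finset.card_range, nsmul_eq_mul]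
  have hbig := succ_mul_four_pow_mul_sqrt_factorial_le d N hd
  rw [← hQ] at hbig
  have ht' : 5 / 6 * ((5 + (d : ℝ) + 2 * (N : ℝ)) *
      Real.log (5 + (d : ℝ) + 2 * (N : ℝ)) ^ 2) ≤ 5 * Real.pi / 24 * |s.im| := by
    rw [mul_assoc, div_mul_eq_mul_div, div_lt_iff₀ hpi] at ht
    linarith
  calc _ = 2 * Real.pi * (Real.Gamma δ + 1) * (Real.exp (-(Real.pi / 3) * |s.im|) *
        (((N : ℝ) + 1) * (4 ^ (d + N) * Q))) := by push_cast; ring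
    _ ≤ 2 * Real.pi * (Real.Gamma δ + 1) * (Real.exp (-(Real.pi / 3) * |s.im|) *
        Real.exp (5 * Real.pi / 24 * |s.im|)) := by
      gcongr
      exact hbig.trans (Real.exp_le_exp.2 ht')
    _ = _ := by
      rw [← Real.exp_add]
      ring_nf
end

section
/- For every δ > 0 there is a constant C_δ such that the following holds for all ε ∈ {±1} and m ∈ ℤ. If δ ≤ Re(a) < 6, δ ≤ Re(b+1) < 6, δ ≤ |Re(b)|, Re(b) < 6, and |Im(a−b)| > max{ (8/π)(|m|+20)·log²((8/π)(|m|+20)), 4|Im(a+b)| }, then |ℬ_{ε,m}(a,b)| ≤ C_δ · exp(−(π/16)|Im(a−b)|). -/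
open MeasureTheory

/-- The beta-type function
`ℬ_{ε,m}(a,b) = ∫_0^∞ x^{a−1} (1+x²)^{−(a+b)/2}
  [((1+ix)/√(1+x²))^{−m} + ε((1−ix)/√(1+x²))^{−m}] dx`, defined for `Re a, Re b > 0`. -/
noncomputable def Bfun (ε : ℝ) (m : ℤ) (a b : ℂ) : ℂ :=
  ∫ x in Set.Ioi (0 : ℝ),
    (x : ℂ) ^ (a - 1) * (((1 + x ^ 2 : ℝ)) : ℂ) ^ (-(a + b) / 2) *
      (((1 + (x : ℂ) * Complex.I) / ((Real.sqrt (1 + x ^ 2) : ℝ) : ℂ)) ^ (-m) +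
        (ε : ℂ) * ((1 - (x : ℂ) * Complex.I) / ((Real.sqrt (1 + x ^ 2) : ℝ) : ℂ)) ^ (-m))

open Complex Filter Topology

/-- `log (2 cosh z)`. -/
noncomputable def logTwoCosh (z : ℂ) : ℂ := log (2 * cosh z)

/-- The logarithm of `(1 + ix) / √(1 + x²)` at `x = exp z`. -/
noncomputable def logPhase (z : ℂ) : ℂ := log (1 + I * exp z) - (z + logTwoCosh z) / 2

/-- The integrand of `Bfun` after the substitution `x = exp z`, without the sign `ε`. -/
noncomputable def betaKernel (m : ℤ) (a b z : ℂ) : ℂ :=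
  exp ((a - b) / 2 * z - (a + b) / 2 * logTwoCosh z - m * logPhase z)

lemma two_cosh_re (z : ℂ) : (2 * cosh z).re = 2 * (Real.cosh z.re * Real.cos z.im) := by
  conv_lhs => rw [← re_add_im z, cosh_add, cosh_mul_I, sinh_mul_I]
  rw [← ofReal_cosh, ← ofReal_sinh, ← ofReal_cos, ← ofReal_sin]
  simp [-ofReal_cos, -ofReal_sin, -ofReal_cosh, -ofReal_sinh]

lemma two_cosh_re_pos {z : ℂ} (hz : 0 < Real.cos z.im) : 0 < (2 * cosh z).re := by
  rw [two_cosh_re]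
  have := Real.cosh_pos z.re
  positivity

lemma one_add_I_mul_exp_im_pos {z : ℂ} (hz : 0 < Real.cos z.im) : 0 < (1 + I * exp z).im := by
  have := Real.exp_pos z.re
  simp only [add_im, one_im, mul_im, I_re, I_im, exp_re, zero_mul, one_mul, zero_add]
  positivity

lemma one_sub_I_mul_exp_im_neg {z : ℂ} (hz : 0 < Real.cos z.im) : (1 - I * exp z).im < 0 := by
  have := one_add_I_mul_exp_im_pos hz
  simp only [add_im, sub_im, one_im] at *
  linarith

lemma two_cosh_ne_zero {z : ℂ} (hz : 0 < Real.cos z.im) : 2 * cosh z ≠ 0 := fun h => by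
  have := two_cosh_re_pos hz
  simp [h] at this

lemma one_add_I_mul_exp_ne_zero {z : ℂ} (hz : 0 < Real.cos z.im) : 1 + I * exp z ≠ 0 := fun h => by
  have := one_add_I_mul_exp_im_pos hz
  simp [h] at this

lemma one_sub_I_mul_exp_ne_zero {z : ℂ} (hz : 0 < Real.cos z.im) : 1 - I * exp z ≠ 0 := fun h => by
  have := one_sub_I_mul_exp_im_neg hz
  simp [h] at this

lemma two_mul_cosh (z : ℂ) : 2 * cosh z = exp z + (exp z)⁻¹ := by
  rw [cosh, exp_neg]; ring

lemma exp_logTwoCosh {z : ℂ} (hz : 0 < Real.cos z.im) : exp (logTwoCosh z) = 2 * cosh z :=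
  exp_log (two_cosh_ne_zero hz)

lemma exp_add_logTwoCosh {z : ℂ} (hz : 0 < Real.cos z.im) :
    exp (z + logTwoCosh z) = (1 + I * exp z) * (1 - I * exp z) := by
  rw [exp_add, exp_logTwoCosh hz, two_mul_cosh]
  have := exp_ne_zero z
  field_simp
  linear_combination (exp z ^ 2) * I_sq

lemma hasDerivAt_betaKernel (m : ℤ) (a b : ℂ) {z : ℂ} (hz : 0 < Real.cos z.im) :
    HasDerivAt (betaKernel m a b)
      (-b * betaKernel m a b z + (a + b) * betaKernel m a (b + 2) z
        - m * I * betaKernel m (a + 1) (b + 1) z) z := by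
  have hL : HasDerivAt logTwoCosh (2 * sinh z / (2 * cosh z)) z :=
    ((hasDerivAt_cosh z).const_mul 2).clog (Or.inl (two_cosh_re_pos hz))
  have hP : HasDerivAt logPhase
      (I * exp z / (1 + I * exp z) - (1 + 2 * sinh z / (2 * cosh z)) / 2) z :=
    ((((Complex.hasDerivAt_exp z).const_mul I).const_add 1).clog
      (Or.inr (one_add_I_mul_exp_im_pos hz).ne')).sub (((hasDerivAt_id z).add hL).div_const 2)
  have hK := ((((hasDerivAt_id z).const_mul ((a - b) / 2)).sub (hL.const_mul ((a + b) / 2))).sub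
    (hP.const_mul (m : ℂ))).cexp
  refine hK.congr_deriv ?_
  have h1 : betaKernel m a (b + 2) z = betaKernel m a b z / ((1 + I * exp z) * (1 - I * exp z)) := by
    rw [← exp_add_logTwoCosh hz, betaKernel, betaKernel, ← exp_sub]
    ring_nf
  have h2 : betaKernel m (a + 1) (b + 1) z = betaKernel m a b z / (2 * cosh z) := by
    rw [← exp_logTwoCosh hz, betaKernel, betaKernel, ← exp_sub]
    ring_nf
  rw [h1, h2]
  change betaKernel m a b z * _ = _
  have hw := exp_ne_zero z
  have hp := one_add_I_mul_exp_ne_zero hz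
  have hq := one_sub_I_mul_exp_ne_zero hz
  have hc : 2 * cosh z = (1 + I * exp z) * (1 - I * exp z) / exp z := by
    rw [← exp_add_logTwoCosh hz, ← exp_logTwoCosh hz, exp_add]; field_simp
  have hs : 2 * sinh z = exp z - (exp z)⁻¹ := by rw [sinh, exp_neg]; ring
  rw [hc, hs]
  generalize exp z = w at *
  have hI : I ^ 2 = -1 := I_sq
  rw [mul_comm I w] at hp hq
  field_simp
  ring_nf
  simp only [hI]
  ring

lemma log_norm_two_cosh_ge {z : ℂ} (hz : 1 / 2 ≤ Real.cos z.im) :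
    |z.re| - 1 ≤ (logTwoCosh z).re := by
  have h1 : Real.exp (|z.re| - 1) ≤ ‖2 * cosh z‖ := by
    refine le_trans ?_ (re_le_norm _)
    rw [two_cosh_re]
    have h2 : Real.exp |z.re| ≤ 2 * Real.cosh z.re := by
      rw [← Real.cosh_abs, Real.cosh_eq]
      have := Real.exp_pos (-|z.re|)
      linarith
    have h3 : Real.exp (|z.re| - 1) * 2 ≤ Real.exp |z.re| := by
      rw [Real.exp_sub, div_mul_eq_mul_div, div_le_iff₀ (Real.exp_pos 1)]
      have := Real.exp_one_gt_d9
      have := Real.exp_pos |z.re|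
      nlinarith
    have := Real.cosh_pos z.re
    nlinarith
  rw [logTwoCosh, log_re]
  exact (Real.le_log_iff_exp_le (lt_of_lt_of_le (Real.exp_pos _) h1)).2 h1

lemma abs_logTwoCosh_im_le {z : ℂ} (hz : 0 < Real.cos z.im) :
    |(logTwoCosh z).im| ≤ Real.pi / 2 := by
  rw [logTwoCosh, log_im]
  exact abs_arg_le_pi_div_two_iff.2 (two_cosh_re_pos hz).le

lemma abs_logPhase_re_le {z : ℂ} (hz : 1 / 2 ≤ Real.cos z.im) : |(logPhase z).re| ≤ 1 := by
  have hz0 : 0 < Real.cos z.im := by linarith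
  have hp := norm_pos_iff.2 (one_add_I_mul_exp_ne_zero hz0)
  have hq := norm_pos_iff.2 (one_sub_I_mul_exp_ne_zero hz0)
  have hre : (logPhase z).re
      = (Real.log ‖1 + I * exp z‖ - Real.log ‖1 - I * exp z‖) / 2 := by
    have h1 : (z + logTwoCosh z).re = Real.log ‖1 + I * exp z‖ + Real.log ‖1 - I * exp z‖ := by
      rw [← Real.log_mul hp.ne' hq.ne', ← norm_mul, ← exp_add_logTwoCosh hz0, norm_exp,
        Real.log_exp]
    rw [logPhase, sub_re, log_re, div_ofNat_re, h1]
    ring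
  have hv : (exp z).im ^ 2 ≤ 3 * (exp z).re ^ 2 := by
    rw [exp_re, exp_im]
    have := Real.sin_sq_add_cos_sq z.im
    have h2 : Real.sin z.im ^ 2 ≤ 3 * Real.cos z.im ^ 2 := by nlinarith
    nlinarith [mul_le_mul_of_nonneg_left h2 (sq_nonneg (Real.exp z.re))]
  have key : ∀ p q : ℂ, ‖p‖ ^ 2 ≤ 16 * ‖q‖ ^ 2 → 0 < ‖p‖ → 0 < ‖q‖ →
      Real.log ‖p‖ - Real.log ‖q‖ ≤ 2 := by
    intro p q h hp hq
    have h4 : ‖p‖ ≤ 4 * ‖q‖ := by nlinarith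
    have := Real.log_le_log hp h4
    rw [Real.log_mul (by norm_num) hq.ne', show (4 : ℝ) = 2 ^ 2 by norm_num, Real.log_pow] at this
    have := Real.log_two_lt_d9
    push_cast at *
    linarith
  have h1 := key (1 + I * exp z) (1 - I * exp z) ?_ hp hq
  have h2 := key (1 - I * exp z) (1 + I * exp z) ?_ hq hp
  · rw [hre, abs_le]; constructor <;> linarith
  all_goals
    rw [Complex.sq_norm, Complex.sq_norm, normSq_apply, normSq_apply]
    simp only [add_re, add_im, sub_re, sub_im, one_re, one_im, mul_re, mul_im, I_re, I_im]
    nlinarith [sq_nonneg (30 * (exp z).im - 17), sq_nonneg (30 * (exp z).im + 17)]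

lemma norm_betaKernel_le (m : ℤ) {a b z : ℂ} {β R : ℝ} (ha : β ≤ a.re) (hb : β ≤ b.re)
    (hβ : 0 ≤ β) (hR : (a + b).re ≤ R) (hz : 1 / 2 ≤ Real.cos z.im) :
    ‖betaKernel m a b z‖ ≤ Real.exp (R - (a - b).im * z.im / 2 + |(a + b).im| * (Real.pi / 4)
      + |(m : ℝ)|) * Real.exp (-β * |z.re|) := by
  have h1 := log_norm_two_cosh_ge hz
  have h2 := abs_logTwoCosh_im_le (z := z) (by linarith)
  have h3 := abs_logPhase_re_le hz
  have h4 : |(a + b).im * (logTwoCosh z).im| ≤ |(a + b).im| * (Real.pi / 2) := by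
    rw [abs_mul]; gcongr
  have h5 : |(m : ℝ) * (logPhase z).re| ≤ |(m : ℝ)| := by
    rw [abs_mul]; nlinarith [abs_nonneg (m : ℝ)]
  rw [betaKernel, norm_exp, ← Real.exp_add]
  refine Real.exp_le_exp.2 ?_
  have e : ((a - b) / 2 * z - (a + b) / 2 * logTwoCosh z - m * logPhase z).re
      = (a.re - b.re) / 2 * z.re - (a - b).im / 2 * z.im - (a + b).re / 2 * (logTwoCosh z).re
        + (a + b).im * (logTwoCosh z).im / 2 - m * (logPhase z).re := by
    simp only [sub_re, mul_re, div_ofNat_re, div_ofNat_im, intCast_re, intCast_im, zero_mul]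
    ring
  rw [e]
  have h6 := le_of_abs_le h4
  have h7 := neg_le_of_abs_le h5
  simp only [add_re] at *
  have h8 : (a.re + b.re) / 2 * (|z.re| - 1) ≤ (a.re + b.re) / 2 * (logTwoCosh z).re := by
    apply mul_le_mul_of_nonneg_left h1; linarith
  have h9 : (a.re - b.re) / 2 * z.re - (a.re + b.re) / 2 * |z.re| ≤ -β * |z.re| := by
    rcases abs_cases z.re with ⟨h, h'⟩ | ⟨h, h'⟩ <;> rw [h] <;> nlinarith
  linarith

lemma integral_exp_neg_mul_abs {β : ℝ} (hβ : 0 < β) :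
    ∫ t : ℝ, Real.exp (-β * |t|) = 2 / β := by
  rw [integral_comp_abs (f := fun t : ℝ => Real.exp (-β * t)),
    integral_exp_mul_Ioi (neg_neg_of_pos hβ)]
  simp [div_eq_mul_inv]

lemma integrable_exp_neg_mul_abs {β : ℝ} (hβ : 0 < β) :
    Integrable (fun t : ℝ => Real.exp (-β * |t|)) :=
  Integrable.of_integral_ne_zero (by rw [integral_exp_neg_mul_abs hβ]; positivity)

lemma integral_comp_add_mul_I_eq {f : ℂ → ℂ} {C β η : ℝ} (hβ : 0 < β)
    (hf : ∀ z : ℂ, z.im ∈ Set.uIcc 0 η → DifferentiableAt ℂ f z)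
    (hbound : ∀ z : ℂ, z.im ∈ Set.uIcc 0 η → ‖f z‖ ≤ C * Real.exp (-β * |z.re|)) :
    ∫ t : ℝ, f (t + η * I) = ∫ t : ℝ, f t := by
  have hint : ∀ y ∈ Set.uIcc 0 η, Integrable (fun t : ℝ => f (t + y * I)) := by
    intro y hy
    refine ((integrable_exp_neg_mul_abs hβ).const_mul C).mono'
      (Continuous.aestronglyMeasurable ?_) (ae_of_all _ fun t => ?_)
    · rw [continuous_iff_continuousAt]
      intro t
      refine ContinuousAt.comp (g := f) (hf _ (by simpa using hy)).continuousAt ?_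
      fun_prop
    · simpa using hbound (t + y * I) (by simpa using hy)
  have hvert : ∀ s : ℝ, s = 1 ∨ s = -1 →
      Tendsto (fun T : ℝ => I • ∫ y : ℝ in (0 : ℝ)..η, f ((s * T : ℝ) + y * I)) atTop (𝓝 0) := by
    intro s hs
    have hexp : Tendsto (fun T : ℝ => C * Real.exp (-β * |s * T|) * |η - 0|) atTop (𝓝 0) := by
      have h1 : Tendsto (fun T : ℝ => Real.exp (-(β * T))) atTop (𝓝 0) :=
        Real.tendsto_exp_neg_atTop_nhds_zero.comp (tendsto_id.const_mul_atTop hβ)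
      have h2 := (h1.const_mul C).mul_const |η - 0|
      rw [mul_zero, zero_mul] at h2
      refine h2.congr' ?_
      filter_upwards [eventually_ge_atTop 0] with T hT
      have : |s * T| = T := by
        rcases hs with rfl | rfl <;> simp [abs_of_nonneg hT]
      rw [this, neg_mul]
    refine squeeze_zero_norm (fun T => ?_) hexp
    rw [norm_smul, norm_I, one_mul]
    refine intervalIntegral.norm_integral_le_of_norm_le_const fun y hy => ?_
    have := hbound ((s * T : ℝ) + y * I) (by simpa using Set.uIoc_subset_uIcc hy)
    simpa using this
  have hrect : ∀ T : ℝ, (∫ x : ℝ in -T..T, f (x + (0 : ℝ) * I)) - (∫ x : ℝ in -T..T, f (x + η * I))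
      + I • (∫ y : ℝ in (0 : ℝ)..η, f ((1 * T : ℝ) + y * I))
      - I • (∫ y : ℝ in (0 : ℝ)..η, f ((-1 * T : ℝ) + y * I)) = 0 := by
    intro T
    have h := integral_boundary_rect_eq_zero_of_differentiableOn f (⟨-T, 0⟩ : ℂ) ⟨T, η⟩
      fun z hz => (hf z hz.2).differentiableWithinAt
    simpa using h
  have hlim := (((intervalIntegral_tendsto_integral (hint 0 Set.left_mem_uIcc)
    tendsto_neg_atTop_atBot tendsto_id).sub (intervalIntegral_tendsto_integral
      (hint η Set.right_mem_uIcc) tendsto_neg_atTop_atBot tendsto_id)).add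
        (hvert 1 (Or.inl rfl))).sub (hvert (-1) (Or.inr rfl))
  have h0 := tendsto_nhds_unique (hlim.congr hrect) tendsto_const_nhds
  simp only [ofReal_zero, zero_mul, add_zero, sub_zero] at h0
  exact (sub_eq_zero.1 h0).symm

/-- The contribution of the phase `((1 + ix) / √(1 + x²)) ^ (-m)` to `Bfun`. -/
noncomputable def phaseIntegral (m : ℤ) (a b : ℂ) : ℂ := ∫ t : ℝ, betaKernel m a b t

lemma continuous_betaKernel_ofReal (m : ℤ) (a b : ℂ) :
    Continuous fun t : ℝ => betaKernel m a b t := by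
  rw [continuous_iff_continuousAt]
  intro t
  exact ContinuousAt.comp (g := betaKernel m a b)
    (hasDerivAt_betaKernel m a b (by simp)).continuousAt continuous_ofReal.continuousAt

lemma integrable_betaKernel (m : ℤ) {a b : ℂ} (ha : 0 < a.re) (hb : 0 < b.re) :
    Integrable fun t : ℝ => betaKernel m a b t := by
  refine ((integrable_exp_neg_mul_abs (lt_min ha hb)).const_mul
    (Real.exp ((a + b).re + |(a + b).im| * (Real.pi / 4) + |(m : ℝ)|))).mono'
    (continuous_betaKernel_ofReal m a b).aestronglyMeasurable (ae_of_all _ fun t => ?_)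
  simpa using norm_betaKernel_le m (z := (t : ℂ)) (min_le_left a.re b.re) (min_le_right a.re b.re)
    (lt_min ha hb).le le_rfl (by norm_num)

lemma norm_phaseIntegral_le (m : ℤ) {a b : ℂ} {β R : ℝ} (hβ : 0 < β) (ha : β ≤ a.re)
    (hb : β ≤ b.re) (hR : (a + b).re ≤ R) :
    ‖phaseIntegral m a b‖ ≤ Real.exp (R - |(a - b).im| * (Real.pi / 6)
      + |(a + b).im| * (Real.pi / 4) + |(m : ℝ)|) * (2 / β) := by
  obtain ⟨η, hη, hη'⟩ : ∃ η : ℝ, |η| = Real.pi / 3 ∧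
      (a - b).im * η / 2 = |(a - b).im| * (Real.pi / 6) := by
    have := Real.pi_pos
    rcases abs_cases (a - b).im with ⟨h, -⟩ | ⟨h, -⟩
    · exact ⟨Real.pi / 3, abs_of_pos (by positivity), by rw [h]; ring⟩
    · exact ⟨-(Real.pi / 3), by rw [abs_neg]; exact abs_of_pos (by positivity), by rw [h]; ring⟩
  have hcos : ∀ y ∈ Set.uIcc 0 η, 1 / 2 ≤ Real.cos y := by
    intro y hy
    have hy' : |y| ≤ Real.pi / 3 := by
      have := Set.abs_sub_left_of_mem_uIcc hy
      simpa [hη] using this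
    rw [← Real.cos_abs, ← Real.cos_pi_div_three]
    exact Real.cos_le_cos_of_nonneg_of_le_pi (abs_nonneg y) (by linarith [Real.pi_pos]) hy'
  have hη2 : |(a - b).im * η| = |(a - b).im| * (Real.pi / 3) := by rw [abs_mul, hη]
  have hshift := integral_comp_add_mul_I_eq (f := betaKernel m a b) (η := η) hβ
    (C := Real.exp (R + |(a - b).im| * (Real.pi / 6) + |(a + b).im| * (Real.pi / 4) + |(m : ℝ)|))
    (fun z hz => (hasDerivAt_betaKernel m a b (by linarith [hcos _ hz])).differentiableAt)
    (fun z hz => by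
      refine (norm_betaKernel_le m ha hb hβ.le hR (hcos _ hz)).trans ?_
      gcongr
      have h1 : |(a - b).im * z.im| ≤ |(a - b).im| * (Real.pi / 3) := by
        rw [abs_mul, ← hη]
        refine mul_le_mul_of_nonneg_left ?_ (abs_nonneg _)
        simpa using Set.abs_sub_left_of_mem_uIcc hz
      have := neg_le_of_abs_le h1
      linarith)
  rw [phaseIntegral, ← hshift, ← integral_exp_neg_mul_abs hβ, ← integral_const_mul]
  refine norm_integral_le_of_norm_le ((integrable_exp_neg_mul_abs hβ).const_mul _)
    (ae_of_all _ fun t => ?_)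
  have := norm_betaKernel_le m (z := t + η * I) ha hb hβ.le hR
    (by simpa using hcos η Set.right_mem_uIcc)
  rwa [show (t + η * I : ℂ).im = η by simp, show (t + η * I : ℂ).re = t by simp, hη'] at this

lemma mul_phaseIntegral (m : ℤ) {a b : ℂ} (ha : 0 < a.re) (hb : 0 < b.re) :
    b * phaseIntegral m a b
      = (a + b) * phaseIntegral m a (b + 2) - m * I * phaseIntegral m (a + 1) (b + 1) := by
  have h0 := integrable_betaKernel m ha hb
  have h1 := integrable_betaKernel m (a := a) (b := b + 2) ha (by simp; linarith)
  have h2 := integrable_betaKernel m (a := a + 1) (b := b + 1) (by simp; linarith)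
    (by simp; linarith)
  have h := integral_eq_zero_of_hasDerivAt_of_integrable
    (fun t : ℝ => (hasDerivAt_betaKernel m a b (z := (t : ℂ)) (by simp)).comp_ofReal)
    (((h0.const_mul (-b)).add (h1.const_mul (a + b))).sub (h2.const_mul (m * I))) h0
  rw [integral_sub _ (h2.const_mul (m * I)), integral_add (h0.const_mul (-b))
    (h1.const_mul (a + b)), integral_const_mul, integral_const_mul, integral_const_mul] at h
  swap
  · exact (h0.const_mul (-b)).add (h1.const_mul (a + b))
  simp only [phaseIntegral]
  linear_combination -h

lemma logTwoCosh_ofReal (t : ℝ) : logTwoCosh t = (Real.log (2 * Real.cosh t) : ℝ) := by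
  rw [logTwoCosh, ofReal_log (by have := Real.cosh_pos t; positivity)]
  push_cast
  rfl

lemma log_one_add_exp_sq (t : ℝ) :
    ((Real.log (1 + Real.exp t ^ 2) : ℝ) : ℂ) = t + logTwoCosh t := by
  rw [logTwoCosh_ofReal, ← ofReal_add]
  congr 1
  have hc := Real.cosh_pos t
  rw [show 1 + Real.exp t ^ 2 = Real.exp t * (2 * Real.cosh t) by
    rw [Real.cosh_eq, Real.exp_neg]; field_simp; ring,
    Real.log_mul (Real.exp_pos t).ne' (by positivity), Real.log_exp]

lemma norm_ofReal_add_logTwoCosh_le (t : ℝ) : ‖(t : ℂ) + logTwoCosh t‖ ≤ 1 + 2 * |t| := by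
  rw [logTwoCosh_ofReal, ← ofReal_add, norm_real, Real.norm_eq_abs]
  have h1 : 1 ≤ 2 * Real.cosh t := by linarith [Real.one_le_cosh t]
  have h2 : 2 * Real.cosh t ≤ Real.exp (1 + |t|) := by
    rw [← Real.cosh_abs, Real.cosh_eq, Real.exp_add]
    have h3 : Real.exp (-|t|) ≤ Real.exp |t| := by gcongr; linarith [abs_nonneg t]
    nlinarith [Real.exp_one_gt_d9, Real.exp_pos |t|]
  have h4 := Real.log_nonneg h1
  have h5 := (Real.log_le_iff_le_exp (by linarith)).2 h2
  calc _ ≤ |t| + |Real.log (2 * Real.cosh t)| := abs_add_le _ _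
    _ ≤ _ := by rw [abs_of_nonneg h4]; linarith

lemma differentiableAt_phaseIntegral (m : ℤ) {a b₀ : ℂ} (ha : 0 < a.re) (hb : 0 < b₀.re) :
    DifferentiableAt ℂ (phaseIntegral m a) b₀ := by
  obtain ⟨β, hβ, hβa, hβb⟩ : ∃ β : ℝ, 0 < β ∧ β ≤ a.re ∧ 2 * β ≤ b₀.re :=
    ⟨min a.re (b₀.re / 2), by positivity, min_le_left _ _, by
      linarith [min_le_right a.re (b₀.re / 2)]⟩
  set M : ℝ := |(a + b₀).im| + β
  set K : ℝ := Real.exp ((a + b₀).re + β + M * (Real.pi / 4) + |(m : ℝ)|)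
  have hderiv : ∀ (t : ℝ) (b : ℂ), HasDerivAt (fun b => betaKernel m a b t)
      (betaKernel m a b t * (-(t + logTwoCosh t) / 2)) b := by
    intro t b
    have h := (((((hasDerivAt_id b).const_sub a).div_const 2).mul_const (t : ℂ)).sub
      ((((hasDerivAt_id b).const_add a).div_const 2).mul_const (logTwoCosh t))).sub_const
        (m * logPhase t) |>.cexp
    refine h.congr_deriv ?_
    change betaKernel m a b t * _ = _
    ring
  refine (hasDerivAt_integral_of_dominated_loc_of_deriv_le (μ := volume)
    (F := fun b (t : ℝ) => betaKernel m a b t)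
    (F' := fun b (t : ℝ) => betaKernel m a b t * (-(t + logTwoCosh t) / 2))
    (bound := fun t => K * (1 + 2 / β) * Real.exp (-(β / 2) * |t|))
    (Metric.ball_mem_nhds b₀ hβ)
    (Eventually.of_forall fun b => (continuous_betaKernel_ofReal m a b).aestronglyMeasurable)
    (integrable_betaKernel m ha hb) ?_ (ae_of_all _ fun t b hbb => ?_)
    ((integrable_exp_neg_mul_abs (half_pos hβ)).const_mul _)
    (ae_of_all _ fun t b _ => hderiv t b)).2.differentiableAt
  · refine Continuous.aestronglyMeasurable ?_
    refine (continuous_betaKernel_ofReal m a b₀).mul ?_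
    have : Continuous fun t : ℝ => logTwoCosh t := by
      refine Continuous.clog (by fun_prop) fun t => Or.inl (two_cosh_re_pos (by simp))
    fun_prop
  · rw [Metric.mem_ball, dist_eq] at hbb
    have hre := (abs_re_le_norm (b - b₀)).trans hbb.le
    have him := (abs_im_le_norm (b - b₀)).trans hbb.le
    rw [sub_re, abs_le] at hre
    have him' : |(a + b).im| ≤ M := by
      calc |(a + b).im| = |(a + b₀).im + (b - b₀).im| := by simp
        _ ≤ _ := (abs_add_le _ _).trans (by simp only [M]; gcongr)
    have h1 := norm_betaKernel_le m (z := (t : ℂ)) (a := a) (b := b) (β := β)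
      (R := (a + b₀).re + β) hβa (by linarith) hβ.le (by simp only [add_re]; linarith) (by norm_num)
    have h2 : ‖betaKernel m a b t‖ ≤ K * Real.exp (-β * |t|) := by
      refine h1.trans ?_
      simp only [ofReal_im, mul_zero, zero_div, sub_zero, ofReal_re, K]
      gcongr
    have h3 : 1 + 2 * |t| ≤ 2 * ((1 + 2 / β) * Real.exp (β / 2 * |t|)) := by
      have h4 := Real.add_one_le_exp (β / 2 * |t|)
      have h5 : 2 / β * (β / 2 * |t|) = |t| := by field_simp
      have h6 : 0 ≤ β / 2 * |t| := by positivity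
      have h7 : 0 < 2 / β := by positivity
      nlinarith
    rw [norm_mul, norm_div, norm_neg]
    have h8 : ‖(t : ℂ) + logTwoCosh t‖ / ‖(2 : ℂ)‖ ≤ (1 + 2 / β) * Real.exp (β / 2 * |t|) := by
      rw [RCLike.norm_ofNat]
      linarith [norm_ofReal_add_logTwoCosh_le t]
    refine (mul_le_mul h2 h8 (by positivity) (by positivity)).trans_eq ?_
    have : Real.exp (-(β / 2) * |t|) = Real.exp (-β * |t|) * Real.exp (β / 2 * |t|) := by
      rw [← Real.exp_add]; ring_nf
    rw [this]; ring

lemma exp_neg_int_mul_logPhase (m : ℤ) (t : ℝ) :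
    exp (-(m * logPhase t)) = ((1 + (Real.exp t : ℂ) * I)
      / ((Real.sqrt (1 + Real.exp t ^ 2) : ℝ) : ℂ)) ^ (-m) := by
  have hz : 0 < Real.cos (t : ℂ).im := by simp
  have hsq : exp ((t + logTwoCosh t) / 2) = ((Real.sqrt (1 + Real.exp t ^ 2) : ℝ) : ℂ) := by
    rw [← log_one_add_exp_sq, ← Real.exp_log (show 0 < Real.sqrt (1 + Real.exp t ^ 2) by positivity),
      Real.log_sqrt (by positivity)]
    push_cast
    rfl
  rw [← hsq, ← neg_mul, ← Int.cast_neg, exp_int_mul, logPhase, exp_sub,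
    exp_log (one_add_I_mul_exp_ne_zero hz), ofReal_exp, mul_comm I]

lemma Bfun_eq_phaseIntegral (ε : ℝ) (m : ℤ) {a b : ℂ} (ha : 0 < a.re) (hb : 0 < b.re) :
    Bfun ε m a b = phaseIntegral m a b + ε * phaseIntegral (-m) a b := by
  rw [Bfun, ← Real.range_exp, ← Set.image_univ, integral_image_eq_integral_abs_deriv_smul
    MeasurableSet.univ (fun t _ => (Real.hasDerivAt_exp t).hasDerivWithinAt)
    Real.exp_injective.injOn, setIntegral_univ, phaseIntegral, phaseIntegral,
    ← integral_const_mul, ← integral_add (integrable_betaKernel m ha hb)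
      ((integrable_betaKernel (-m) ha hb).const_mul (ε : ℂ))]
  refine integral_congr_ae (ae_of_all _ fun t => ?_)
  have hker : ∀ n : ℤ, betaKernel n a b t = exp ((a - b) / 2 * t - (a + b) / 2 * logTwoCosh t) *
      ((1 + (Real.exp t : ℂ) * I) / ((Real.sqrt (1 + Real.exp t ^ 2) : ℝ) : ℂ)) ^ (-n) := by
    intro n
    rw [← exp_neg_int_mul_logPhase, ← exp_add, betaKernel, sub_eq_add_neg _ (n * logPhase t : ℂ)]
  have hinv : (1 - (Real.exp t : ℂ) * I) / ((Real.sqrt (1 + Real.exp t ^ 2) : ℝ) : ℂ)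
      = ((1 + (Real.exp t : ℂ) * I) / ((Real.sqrt (1 + Real.exp t ^ 2) : ℝ) : ℂ))⁻¹ := by
    have hs : ((Real.sqrt (1 + Real.exp t ^ 2) : ℝ) : ℂ) ^ 2 = 1 + (Real.exp t : ℂ) ^ 2 := by
      rw [← ofReal_pow, Real.sq_sqrt (by positivity)]
      push_cast
      rfl
    have hs0 : ((Real.sqrt (1 + Real.exp t ^ 2) : ℝ) : ℂ) ≠ 0 :=
      ofReal_ne_zero.2 (by positivity)
    refine eq_inv_of_mul_eq_one_left ?_
    rw [div_mul_div_comm, ← sq, hs, div_eq_one_iff_eq (by rw [← hs]; exact pow_ne_zero 2 hs0)]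
    linear_combination (-(Real.exp t : ℂ) ^ 2) * I_sq
  have hx : ((Real.exp t : ℝ) : ℂ) ≠ 0 := ofReal_ne_zero.2 (Real.exp_pos t).ne'
  have hy : ((1 + Real.exp t ^ 2 : ℝ) : ℂ) ≠ 0 := ofReal_ne_zero.2 (by positivity)
  have hpow : (Real.exp t : ℂ) * ((Real.exp t : ℂ) ^ (a - 1)
      * ((1 + Real.exp t ^ 2 : ℝ) : ℂ) ^ (-(a + b) / 2))
      = exp ((a - b) / 2 * t - (a + b) / 2 * logTwoCosh t) := by
    rw [cpow_def_of_ne_zero hx, cpow_def_of_ne_zero hy, ← ofReal_log (Real.exp_pos t).le,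
      ← ofReal_log (by positivity), log_one_add_exp_sq, Real.log_exp, ofReal_exp, ← exp_add,
      ← exp_add]
    ring_nf
  simp only [hker, hinv, inv_zpow', abs_of_pos (Real.exp_pos t), real_smul, ← hpow]
  ring

lemma ten_mul_le_mul_log_sq {x : ℝ} (hx : 20 ≤ x) :
    10 * x ≤ (8 / Real.pi) * x * Real.log ((8 / Real.pi) * x) ^ 2 := by
  have hpi : 5 / 2 ≤ 8 / Real.pi := by
    rw [le_div_iff₀ Real.pi_pos]; linarith [Real.pi_lt_d2]
  have hN : 5 / 2 * x ≤ (8 / Real.pi) * x := by gcongr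
  have hlog : 2 ≤ Real.log ((8 / Real.pi) * x) := by
    rw [Real.le_log_iff_exp_le (by linarith), show (2 : ℝ) = 1 + 1 by norm_num, Real.exp_add]
    nlinarith [Real.exp_one_lt_d9, Real.exp_pos 1]
  have : 2 ^ 2 ≤ Real.log ((8 / Real.pi) * x) ^ 2 := by gcongr
  nlinarith

/-- The function `b ↦ b * Bfun ε m a b`, continued to `-1 < b.re`. -/
noncomputable def mulBfunExt (ε : ℝ) (m : ℤ) (a b : ℂ) : ℂ :=
  (a + b) * (phaseIntegral m a (b + 2) + ε * phaseIntegral (-m) a (b + 2))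
    - m * I * (phaseIntegral m (a + 1) (b + 1) - ε * phaseIntegral (-m) (a + 1) (b + 1))

lemma mul_Bfun (ε : ℝ) (m : ℤ) {a b : ℂ} (ha : 0 < a.re) (hb : 0 < b.re) :
    b * Bfun ε m a b = mulBfunExt ε m a b := by
  have h := mul_phaseIntegral (-m) ha hb
  push_cast at h
  rw [Bfun_eq_phaseIntegral ε m ha hb, mulBfunExt]
  linear_combination mul_phaseIntegral m ha hb + ε * h

lemma differentiableOn_mulBfunExt (ε : ℝ) (m : ℤ) {a : ℂ} (ha : 0 < a.re) :
    DifferentiableOn ℂ (mulBfunExt ε m a) {b : ℂ | -1 < b.re} := by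
  intro b hb
  rw [Set.mem_ofPred_eq] at hb
  have h2 : ∀ n : ℤ, DifferentiableAt ℂ (fun b => phaseIntegral n a (b + 2)) b := fun n =>
    (differentiableAt_phaseIntegral n ha (by simp; linarith)).comp b (by fun_prop)
  have h1 : ∀ n : ℤ, DifferentiableAt ℂ (fun b => phaseIntegral n (a + 1) (b + 1)) b := fun n =>
    (differentiableAt_phaseIntegral n (by simp; linarith) (by simp; linarith)).comp b
      (by fun_prop)
  unfold mulBfunExt
  exact (((differentiableAt_id.const_add a).mul ((h2 m).add ((h2 (-m)).const_mul (ε : ℂ)))).sub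
    (((h1 m).sub ((h1 (-m)).const_mul (ε : ℂ))).const_mul (m * I))).differentiableWithinAt

lemma norm_mulBfunExt_le {ε : ℝ} (hε : |ε| = 1) (m : ℤ) {a b : ℂ} {β R : ℝ} (hβ : 0 < β)
    (ha : β ≤ a.re) (hb₁ : β ≤ b.re + 1) (hb₂ : β ≤ b.re + 2) (hR : (a + b).re + 2 ≤ R) :
    ‖mulBfunExt ε m a b‖ ≤ 2 * (‖a + b‖ + |(m : ℝ)|) * (Real.exp (R - |(a - b).im| * (Real.pi / 6)
      + |(a + b).im| * (Real.pi / 4) + |(m : ℝ)|) * (2 / β)) := by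
  set D := Real.exp (R - |(a - b).im| * (Real.pi / 6)
      + |(a + b).im| * (Real.pi / 4) + |(m : ℝ)|) * (2 / β) with hD
  have hεc : ‖(ε : ℂ)‖ = 1 := by rw [norm_real, Real.norm_eq_abs, hε]
  have h2 : ∀ n : ℤ, |(n : ℝ)| = |(m : ℝ)| → ‖phaseIntegral n a (b + 2)‖ ≤ D := by
    intro n hn
    have := norm_phaseIntegral_le n (a := a) (b := b + 2) (R := R) hβ ha (by simpa using hb₂)
      (by simp only [add_re, re_ofNat] at *; linarith)
    rw [hn] at this
    simpa [hD] using this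
  have h1 : ∀ n : ℤ, |(n : ℝ)| = |(m : ℝ)| → ‖phaseIntegral n (a + 1) (b + 1)‖ ≤ D := by
    intro n hn
    have := norm_phaseIntegral_le n (a := a + 1) (b := b + 1) (R := R) hβ
      (by rw [add_re, one_re]; linarith) (by simpa using hb₁)
      (by simp only [add_re, one_re] at *; linarith)
    rw [hn] at this
    simpa [hD] using this
  have hneg : |((-m : ℤ) : ℝ)| = |(m : ℝ)| := by push_cast; exact abs_neg _
  have hA : ‖phaseIntegral m a (b + 2) + ε * phaseIntegral (-m) a (b + 2)‖ ≤ 2 * D := by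
    refine (norm_add_le _ _).trans ?_
    rw [norm_mul, hεc, one_mul]
    linarith [h2 m rfl, h2 (-m) hneg]
  have hB : ‖phaseIntegral m (a + 1) (b + 1) - ε * phaseIntegral (-m) (a + 1) (b + 1)‖
      ≤ 2 * D := by
    refine (norm_sub_le _ _).trans ?_
    rw [norm_mul, hεc, one_mul]
    linarith [h1 m rfl, h1 (-m) hneg]
  calc ‖mulBfunExt ε m a b‖ ≤ ‖a + b‖ * (2 * D) + |(m : ℝ)| * (2 * D) := by
        refine (norm_sub_le _ _).trans ?_
        rw [norm_mul, norm_mul _ (_ - _), norm_mul, norm_I, mul_one, norm_intCast]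
        gcongr
    _ = _ := by ring

/-- Exponential decay of (the meromorphic continuation in `b` of) `ℬ_{ε,m}(a,b)` when
`|Im(a−b)|` is large. -/
theorem stmt8 (δ : ℝ) (hδ : 0 < δ) :
    ∃ C : ℝ, 0 < C ∧ ∀ (ε : ℝ) (m : ℤ) (a : ℂ), (ε = 1 ∨ ε = -1) →
      δ ≤ a.re → a.re < 6 →
      ∃ g h : ℂ → ℂ,
        (∀ b : ℂ, 0 < b.re → g b = Bfun ε m a b) ∧
        DifferentiableOn ℂ g {b : ℂ | -1 < b.re ∧ b ≠ 0} ∧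
        DifferentiableOn ℂ h {b : ℂ | -1 < b.re} ∧
        (∀ b : ℂ, -1 < b.re → b ≠ 0 → g b = h b / b) ∧
        (∀ b : ℂ, δ ≤ (b + 1).re → (b + 1).re < 6 → δ ≤ |b.re| → b.re < 6 →
          max ((8 / Real.pi) * (|(m : ℝ)| + 20) *
              Real.log ((8 / Real.pi) * (|(m : ℝ)| + 20)) ^ 2)
            (4 * |(a + b).im|) < |(a - b).im| →
          ‖g b‖ ≤ C * Real.exp (-(Real.pi / 16) * |(a - b).im|)) := by
  obtain ⟨β, hβ, hβδ, hβ1⟩ : ∃ β : ℝ, 0 < β ∧ β ≤ δ ∧ β ≤ 1 :=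
    ⟨min δ 1, by positivity, min_le_left _ _, min_le_right _ _⟩
  refine ⟨200 * Real.exp 14 / (β * δ), by positivity, fun ε m a hε haδ ha6 => ?_⟩
  have ha : 0 < a.re := hδ.trans_le haδ
  refine ⟨fun b => mulBfunExt ε m a b / b, mulBfunExt ε m a, fun b hb => ?_, ?_,
    differentiableOn_mulBfunExt ε m ha, fun b _ _ => rfl, fun b hb1 hb6 hbδ _ hT => ?_⟩
  · have hb0 : b ≠ 0 := by rintro rfl; simp at hb
    change mulBfunExt ε m a b / b = _
    rw [← mul_Bfun ε m ha hb, mul_div_cancel_left₀ _ hb0]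
  · exact ((differentiableOn_mulBfunExt ε m ha).mono fun b hb => hb.1).div differentiableOn_id
      fun b hb => hb.2
  obtain ⟨hT1, hT2⟩ := max_lt_iff.1 hT
  have hT3 := (ten_mul_le_mul_log_sq (x := |(m : ℝ)| + 20) (by linarith [abs_nonneg (m : ℝ)])).trans
    hT1.le
  rw [Complex.add_re, Complex.one_re] at hb1 hb6
  have hε1 : |ε| = 1 := by rcases hε with rfl | rfl <;> simp
  have hnorm := norm_mulBfunExt_le hε1 m (a := a) (b := b) (R := 14) hβ (hβδ.trans haδ)
    (hβδ.trans hb1) (by linarith) (by rw [Complex.add_re]; linarith)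
  have hab : ‖a + b‖ ≤ 12 + |(a + b).im| := by
    refine (norm_le_abs_re_add_abs_im _).trans ?_
    gcongr
    rw [Complex.add_re, abs_le]
    constructor <;> linarith
  have hbn : δ ≤ ‖b‖ := hbδ.trans (abs_re_le_norm b)
  have hm := abs_nonneg (m : ℝ)
  generalize |(a - b).im| = T at *
  generalize |(a + b).im| = S at *
  have hfac : ‖a + b‖ + |(m : ℝ)| ≤ 50 * Real.exp (T / 50) := by
    linarith [Real.add_one_le_exp (T / 50)]
  have hexp : Real.exp (14 - T * (Real.pi / 6) + S * (Real.pi / 4) + |(m : ℝ)|)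
      ≤ Real.exp 14 * (Real.exp (-(Real.pi / 16) * T) * Real.exp (-(T / 50))) := by
    rw [← Real.exp_add, ← Real.exp_add]
    refine Real.exp_le_exp.2 ?_
    nlinarith [Real.pi_gt_d2, Real.pi_pos]
  calc ‖mulBfunExt ε m a b / b‖ = ‖mulBfunExt ε m a b‖ / ‖b‖ := norm_div _ _
    _ ≤ (2 * (50 * Real.exp (T / 50)) * (Real.exp 14 * (Real.exp (-(Real.pi / 16) * T)
          * Real.exp (-(T / 50))) * (2 / β))) / δ := by
        refine div_le_div₀ (by positivity) (hnorm.trans ?_) hδ hbn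
        gcongr
    _ = 200 * Real.exp 14 / (β * δ) * Real.exp (-(Real.pi / 16) * T) := by
        rw [Real.exp_neg (T / 50)]
        field_simp
        norm_num
end

section
/- Let r ∈ ℂ and let s₁,s₂ ∈ ℂ with −1 < Re(s₁) < −1/2 and −1 < Re(s₂) < −1/2. Then the series Σ_{d=3}^{∞} (−1)^d Q(d,s₁) Q(d,s₂) [((d−1)/2)³ − 9r²·((d−1)/2)] converges absolutely and equals (1/(8(s₁+s₂)))·[(4s₁s₂+3)/(1+s₁+s₂) + 36r² − 3]·Γ(3/2+s₁)Γ(3/2+s₂)/(Γ(3/2−s₁)Γ(3/2−s₂)) − (1/(2(s₁+s₂)))·[s₁s₂/(1+s₁+s₂) + 9r²]·Γ(1+s₁)Γ(1+s₂)/(Γ(1−s₁)Γ(1−s₂)). -/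
open MeasureTheory

/-- `Q(d,s) = Γ((d−1)/2+s) / Γ((d+1)/2−s)`. -/
noncomputable def Qfun (d : ℕ) (s : ℂ) : ℂ :=
  Complex.Gamma (((d : ℂ) - 1) / 2 + s) / Complex.Gamma (((d : ℂ) + 1) / 2 - s)

open Filter Topology Asymptotics

theorem Complex.Gamma_add_nat_add_one_eq_prod {z : ℂ} (hz : 0 < z.re) (n : ℕ) :
    Complex.Gamma (z + n + 1) =
      (∏ j ∈ Finset.range (n + 1), (z + j)) * Complex.Gamma z := by
  have ne (m : ℕ) : z + m ≠ 0 := by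
    intro h
    have h' := congrArg Complex.re h
    simp only [Complex.add_re, Complex.natCast_re, Complex.zero_re] at h'
    have : (0 : ℝ) ≤ m := m.cast_nonneg
    linarith
  induction n with
  | zero => simpa using Complex.Gamma_add_one z (by simpa using ne 0)
  | succ n ih =>
    rw [Finset.prod_range_succ, Complex.Gamma_add_one _ (ne (n + 1))]
    push_cast
    rw [← add_assoc, ih]
    ring

theorem Complex.tendsto_Gamma_add_nat_div {z : ℂ} (hz : 0 < z.re) :
    Tendsto (fun n : ℕ => Complex.Gamma (z + n + 1) / ((n : ℂ) ^ z * (n.factorial : ℂ)))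
      atTop (𝓝 1) := by
  have hne := Complex.Gamma_ne_zero_of_re_pos hz
  have h := (tendsto_const_nhds (x := Complex.Gamma z)).div
    (Complex.GammaSeq_tendsto_Gamma z) hne
  rw [div_self hne] at h
  refine h.congr fun n => ?_
  simp only [Pi.div_apply]
  rw [Complex.Gamma_add_nat_add_one_eq_prod hz, Complex.GammaSeq, div_div_eq_mul_div, mul_comm]

/-- The ratio `Γ(n+1+a)/Γ(n+1+b)` is at most of order `n ^ Re (a-b)`. -/
theorem Complex.isBigO_Gamma_div_Gamma {a b : ℂ} (ha : 0 < a.re) (hb : 0 < b.re) :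
    (fun n : ℕ => Complex.Gamma (a + n + 1) / Complex.Gamma (b + n + 1)) =O[atTop]
      fun n : ℕ => (n : ℝ) ^ (a.re - b.re) := by
  have h := ((Complex.tendsto_Gamma_add_nat_div ha).div
    (Complex.tendsto_Gamma_add_nat_div hb) one_ne_zero).isBigO_one ℝ
  have h2 : (fun n : ℕ => (n : ℂ) ^ (a - b)) =O[atTop]
      fun n : ℕ => (n : ℝ) ^ (a.re - b.re) := by
    refine IsBigO.of_bound 1 ?_
    filter_upwards [eventually_gt_atTop 0] with n hn
    rw [Complex.norm_natCast_cpow_of_pos hn, Complex.sub_re, one_mul]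
    exact le_abs_self _
  refine (h.mul h2).congr' ?_ (by simp)
  filter_upwards [eventually_gt_atTop 0] with n hn
  have hn0 : (n : ℂ) ≠ 0 := by exact_mod_cast hn.ne'
  have hf : (n.factorial : ℂ) ≠ 0 := by exact_mod_cast n.factorial_ne_zero
  have hpa : (n : ℂ) ^ a ≠ 0 := by simp [Complex.cpow_eq_zero_iff, hn0]
  have hpb : (n : ℂ) ^ b ≠ 0 := by simp [Complex.cpow_eq_zero_iff, hn0]
  have hg : Complex.Gamma (b + n + 1) ≠ 0 := by
    refine Complex.Gamma_ne_zero_of_re_pos ?_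
    simp only [Complex.add_re, Complex.natCast_re, Complex.one_re]
    positivity
  simp only [Pi.div_apply]
  rw [Complex.cpow_sub _ _ hn0]
  field_simp

theorem isBigO_add_natCast (c : ℂ) :
    (fun n : ℕ => c + (n : ℂ)) =O[atTop] fun n : ℕ => (n : ℝ) := by
  refine IsBigO.of_bound (‖c‖ + 1) ?_
  filter_upwards [eventually_ge_atTop 1] with n hn
  have hn' : (1 : ℝ) ≤ n := by exact_mod_cast hn
  have h := norm_add_le c (n : ℂ)
  rw [Complex.norm_natCast] at h
  rw [Real.norm_natCast]
  nlinarith [norm_nonneg c]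

theorem isBigO_natCast_pow {k m : ℕ} (h : k ≤ m) :
    (fun n : ℕ => (n : ℝ) ^ k) =O[atTop] fun n : ℕ => (n : ℝ) ^ m := by
  refine IsBigO.of_bound 1 ?_
  filter_upwards [eventually_ge_atTop 1] with n hn
  have hn' : (1 : ℝ) ≤ n := by exact_mod_cast hn
  rw [Real.norm_of_nonneg (by positivity), Real.norm_of_nonneg (by positivity), one_mul]
  exact pow_le_pow_right₀ hn' h

theorem isBigO_const_natCast_pow (c : ℂ) (m : ℕ) :
    (fun _ : ℕ => c) =O[atTop] fun n : ℕ => (n : ℝ) ^ m := by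
  refine IsBigO.trans ?_ (isBigO_natCast_pow (Nat.zero_le m))
  simpa using isBigO_const_const c (one_ne_zero (α := ℝ)) atTop

/-- The summand as a function of `x = (d-1)/2`, without the sign. -/
noncomputable def gammaTerm (r s₁ s₂ x : ℂ) : ℂ :=
  Complex.Gamma (x + s₁) / Complex.Gamma (x + 1 - s₁) *
    (Complex.Gamma (x + s₂) / Complex.Gamma (x + 1 - s₂)) * (x ^ 3 - 9 * r ^ 2 * x)

/-- An antidifference of `gammaTerm`. -/
noncomputable def gammaPrimitive (r s₁ s₂ x : ℂ) : ℂ :=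
  Complex.Gamma (x + s₁) / Complex.Gamma (x - s₁) *
    (Complex.Gamma (x + s₂) / Complex.Gamma (x - s₂)) *
    ((x ^ 2 - x) / (2 * (1 + s₁ + s₂)) -
      (9 * r ^ 2 + s₁ * s₂ / (1 + s₁ + s₂)) / (2 * (s₁ + s₂)))

theorem gammaPrimitive_add_one_sub {r s₁ s₂ x : ℂ} (hσ : s₁ + s₂ ≠ 0) (hσ' : 1 + s₁ + s₂ ≠ 0)
    (h₁ : 0 < (x + s₁).re) (h₂ : 0 < (x + s₂).re)
    (h₁' : 0 < (x - s₁).re) (h₂' : 0 < (x - s₂).re) :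
    gammaPrimitive r s₁ s₂ (x + 1) - gammaPrimitive r s₁ s₂ x = gammaTerm r s₁ s₂ x := by
  have ne {z : ℂ} (hz : 0 < z.re) : z ≠ 0 := by
    rintro rfl
    simp at hz
  have e₁ := Complex.Gamma_add_one _ (ne h₁)
  have e₂ := Complex.Gamma_add_one _ (ne h₂)
  have e₁' := Complex.Gamma_add_one _ (ne h₁')
  have e₂' := Complex.Gamma_add_one _ (ne h₂')
  have g₁ := Complex.Gamma_ne_zero_of_re_pos h₁'
  have g₂ := Complex.Gamma_ne_zero_of_re_pos h₂'
  have n₁ := ne h₁'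
  have n₂ := ne h₂'
  unfold gammaPrimitive gammaTerm
  rw [add_right_comm x 1 s₁, add_right_comm x 1 s₂, add_sub_right_comm x 1 s₁,
    add_sub_right_comm x 1 s₂, e₁, e₂, e₁', e₂']
  field_simp
  ring

theorem hasSum_gammaTerm {r s₁ s₂ y : ℂ} (hσ : s₁.re + s₂.re < -1)
    (h₁ : 0 < (y + s₁).re) (h₂ : 0 < (y + s₂).re)
    (h₁' : 0 < (y - s₁).re) (h₂' : 0 < (y - s₂).re) :
    HasSum (fun n : ℕ => gammaTerm r s₁ s₂ (y + n)) (-gammaPrimitive r s₁ s₂ y) := by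
  have hσ0 : s₁ + s₂ ≠ 0 := by
    intro h
    have := congrArg Complex.re h
    simp at this
    linarith
  have hσ1 : 1 + s₁ + s₂ ≠ 0 := by
    intro h
    have := congrArg Complex.re h
    simp at this
    linarith
  have lin := (isBigO_add_natCast (y + 1))
  have hsum : Summable (fun n : ℕ => gammaTerm r s₁ s₂ (y + n)) := by
    rw [← summable_nat_add_iff 1]
    refine summable_of_isBigO_nat
      (Real.summable_nat_rpow.2 (show 1 + 2 * (s₁.re + s₂.re) < -1 by linarith)) ?_
    have b₁ := Complex.isBigO_Gamma_div_Gamma h₁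
      (show 0 < (y - s₁ + 1).re by rw [Complex.add_re, Complex.one_re]; linarith)
    have b₂ := Complex.isBigO_Gamma_div_Gamma h₂
      (show 0 < (y - s₂ + 1).re by rw [Complex.add_re, Complex.one_re]; linarith)
    have p := (lin.pow 3).sub
      (((lin.pow 1).trans (isBigO_natCast_pow (show 1 ≤ 3 by norm_num))).const_mul_left (9 * r ^ 2))
    refine ((b₁.mul b₂).mul p).congr' ?_ ?_
    · filter_upwards with n
      unfold gammaTerm
      push_cast
      ring_nf
    · filter_upwards [eventually_gt_atTop 0] with n hn
      have hn' : (0 : ℝ) < n := by exact_mod_cast hn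
      rw [← Real.rpow_natCast (n : ℝ) 3, ← Real.rpow_add hn', ← Real.rpow_add hn']
      congr 1
      simp
      ring
  have hlim : Tendsto (fun n : ℕ => gammaPrimitive r s₁ s₂ (y + n)) atTop (𝓝 0) := by
    rw [← tendsto_add_atTop_iff_nat 1]
    have b₁ := Complex.isBigO_Gamma_div_Gamma h₁ h₁'
    have b₂ := Complex.isBigO_Gamma_div_Gamma h₂ h₂'
    have p := (((lin.pow 2).sub
      ((lin.pow 1).trans (isBigO_natCast_pow (show 1 ≤ 2 by norm_num)))).const_mul_left
        (1 / (2 * (1 + s₁ + s₂)))).sub (isBigO_const_natCast_pow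
          ((9 * r ^ 2 + s₁ * s₂ / (1 + s₁ + s₂)) / (2 * (s₁ + s₂))) 2)
    have hz : Tendsto (fun n : ℕ => (n : ℝ) ^ (-(-(2 + 2 * (s₁.re + s₂.re))))) atTop (𝓝 0) :=
      (tendsto_rpow_neg_atTop (by linarith)).comp tendsto_natCast_atTop_atTop
    refine IsBigO.trans_tendsto (((b₁.mul b₂).mul p).congr' ?_ ?_) hz
    · filter_upwards with n
      unfold gammaPrimitive
      push_cast
      ring_nf
    · filter_upwards [eventually_gt_atTop 0] with n hn
      have hn' : (0 : ℝ) < n := by exact_mod_cast hn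
      rw [← Real.rpow_natCast (n : ℝ) 2, ← Real.rpow_add hn', ← Real.rpow_add hn']
      congr 1
      simp
      ring
  rw [hsum.hasSum_iff_tendsto_nat]
  have step (n : ℕ) : gammaTerm r s₁ s₂ (y + n) =
      gammaPrimitive r s₁ s₂ (y + (n + 1 : ℕ)) - gammaPrimitive r s₁ s₂ (y + n) := by
    have hn : (0 : ℝ) ≤ n := n.cast_nonneg
    simp only [Complex.add_re, Complex.sub_re] at h₁ h₂ h₁' h₂'
    rw [Nat.cast_succ, ← add_assoc, gammaPrimitive_add_one_sub hσ0 hσ1] <;>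
      simp only [Complex.add_re, Complex.sub_re, Complex.natCast_re] <;> linarith
  simp_rw [step]
  simp_rw [Finset.sum_range_sub (fun n : ℕ => gammaPrimitive r s₁ s₂ (y + n))]
  simpa using hlim.sub_const (gammaPrimitive r s₁ s₂ y)

/-- Evaluation of the series `Σ_{d=3}^∞ (−1)^d Q(d,s₁)Q(d,s₂)[((d−1)/2)³ − 9r²(d−1)/2]`. -/
theorem stmt11 (r s₁ s₂ : ℂ) (h₁ : -1 < s₁.re) (h₁' : s₁.re < -(1 / 2))
    (h₂ : -1 < s₂.re) (h₂' : s₂.re < -(1 / 2)) :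
    Summable (fun n : ℕ =>
      ‖(-1 : ℂ) ^ (n + 3) * Qfun (n + 3) s₁ * Qfun (n + 3) s₂ *
        ((((n : ℂ) + 2) / 2) ^ 3 - 9 * r ^ 2 * (((n : ℂ) + 2) / 2))‖) ∧
    ∑' n : ℕ, (-1 : ℂ) ^ (n + 3) * Qfun (n + 3) s₁ * Qfun (n + 3) s₂ *
        ((((n : ℂ) + 2) / 2) ^ 3 - 9 * r ^ 2 * (((n : ℂ) + 2) / 2)) =
      (1 / (8 * (s₁ + s₂))) * ((4 * s₁ * s₂ + 3) / (1 + s₁ + s₂) + 36 * r ^ 2 - 3) *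
          (Complex.Gamma (3 / 2 + s₁) * Complex.Gamma (3 / 2 + s₂) /
            (Complex.Gamma (3 / 2 - s₁) * Complex.Gamma (3 / 2 - s₂))) -
        (1 / (2 * (s₁ + s₂))) * (s₁ * s₂ / (1 + s₁ + s₂) + 9 * r ^ 2) *
          (Complex.Gamma (1 + s₁) * Complex.Gamma (1 + s₂) /
            (Complex.Gamma (1 - s₁) * Complex.Gamma (1 - s₂))) := by
  set f : ℕ → ℂ := fun n => (-1 : ℂ) ^ (n + 3) * Qfun (n + 3) s₁ * Qfun (n + 3) s₂ *
    ((((n : ℂ) + 2) / 2) ^ 3 - 9 * r ^ 2 * (((n : ℂ) + 2) / 2)) with hf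
  have hf' (n : ℕ) : f n = (-1 : ℂ) ^ (n + 1) * gammaTerm r s₁ s₂ (((n : ℂ) + 2) / 2) := by
    have e (s : ℂ) : Qfun (n + 3) s = Complex.Gamma (((n : ℂ) + 2) / 2 + s) /
        Complex.Gamma (((n : ℂ) + 2) / 2 + 1 - s) := by
      unfold Qfun
      push_cast
      ring_nf
    simp only [hf, e, gammaTerm]
    ring
  have even_part : HasSum (fun k : ℕ => f (2 * k)) (gammaPrimitive r s₁ s₂ 1) := by
    have h := (hasSum_gammaTerm (r := r) (s₁ := s₁) (s₂ := s₂) (y := 1) (by linarith)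
      (by simp; linarith) (by simp; linarith) (by simp; linarith) (by simp; linarith)).neg
    rw [neg_neg] at h
    refine h.congr_fun fun k => ?_
    rw [hf', pow_succ, pow_mul]
    push_cast
    rw [show (2 * (k : ℂ) + 2) / 2 = 1 + k by ring]
    simp
  have odd_part : HasSum (fun k : ℕ => f (2 * k + 1)) (-gammaPrimitive r s₁ s₂ (3 / 2)) := by
    have h32 : (3 / 2 : ℂ).re = 3 / 2 := by norm_num
    refine (hasSum_gammaTerm (r := r) (s₁ := s₁) (s₂ := s₂) (y := 3 / 2) (by linarith)
      ?_ ?_ ?_ ?_).congr_fun fun k => ?_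
    iterate 4
      simp only [Complex.add_re, Complex.sub_re, h32]
      linarith
    rw [hf', show 2 * k + 1 + 1 = 2 * (k + 1) by ring, pow_mul]
    push_cast
    rw [show (2 * (k : ℂ) + 1 + 2) / 2 = 3 / 2 + k by ring]
    simp
  have total := even_part.even_add_odd odd_part
  refine ⟨total.summable.norm, ?_⟩
  rw [total.tsum_eq]
  have hσ0 : s₁ + s₂ ≠ 0 := by
    intro h
    have := congrArg Complex.re h
    simp at this
    linarith
  have hσ1 : 1 + s₁ + s₂ ≠ 0 := by
    intro h
    have := congrArg Complex.re h
    simp at this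
    linarith
  unfold gammaPrimitive
  simp only [div_mul_div_comm (Complex.Gamma _)]
  generalize Complex.Gamma (1 + s₁) * Complex.Gamma (1 + s₂) /
    (Complex.Gamma (1 - s₁) * Complex.Gamma (1 - s₂)) = A
  generalize Complex.Gamma (3 / 2 + s₁) * Complex.Gamma (3 / 2 + s₂) /
    (Complex.Gamma (3 / 2 - s₁) * Complex.Gamma (3 / 2 - s₂)) = B
  field_simp
  ring
end
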